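/- Let V ⊂ ℝ² be a convex polygon with vertices P₁,…,P_r listed in cyclic order (P_{r+1} = P₁), and for each i let ν_i be the outward unit normal of the edge [P_i, P_{i+1}]. Let Ω(V) be the union of the closed polygonal region bounded by V with the closed half-strips S_i = {x + tν_i : x ∈ [P_i, P_{i+1}], t ≥ 0}; its boundary consists of the 2r half-lines L_i⁺ = {P_i + tν_i : t ≥ 0} and L_i⁻ = {P_i + tν_{i−1} : t ≥ 0}. If u₁ and u₂ are C² solutions of the minimal surfaces equation on the interior of Ω(V) such that, for i = 1,…,r and j = 1,2, u_j → +∞ on L_i⁺ ∖ {P_i} and u_j → −∞ on L_i⁻ ∖ {P_i}, then u₁ − u₂ is a constant function. -/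

import Mathlib

open Real Filter Set Topology MeasureTheory

/-- Partial derivative in the first (x) variable. -/
noncomputable def pd1 (u : ℝ × ℝ → ℝ) (z : ℝ × ℝ) : ℝ := deriv (fun t => u (t, z.2)) z.1

/-- Partial derivative in the second (y) variable. -/
noncomputable def pd2 (u : ℝ × ℝ → ℝ) (z : ℝ × ℝ) : ℝ := deriv (fun t => u (z.1, t)) z.2

/-- `W = √(1 + p² + q²)` for the function `u`. -/
noncomputable def Wg (u : ℝ × ℝ → ℝ) (z : ℝ × ℝ) : ℝ :=
  Real.sqrt (1 + pd1 u z ^ 2 + pd2 u z ^ 2)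

/-- `u` is a C² solution of the minimal surfaces equation
`(1+q²)r − 2pq·s + (1+p²)t = 0` on `Ω`. -/
def IsMSE (u : ℝ × ℝ → ℝ) (Ω : Set (ℝ × ℝ)) : Prop :=
  ContDiffOn ℝ 2 u Ω ∧ ∀ z ∈ Ω,
    (1 + pd2 u z ^ 2) * pd1 (pd1 u) z
      - 2 * pd1 u z * pd2 u z * pd2 (pd1 u) z
      + (1 + pd1 u z ^ 2) * pd2 (pd2 u) z = 0

/-- Euclidean length of a planar vector. -/
noncomputable def len (v : ℝ × ℝ) : ℝ := Real.sqrt (v.1 ^ 2 + v.2 ^ 2)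

/-- Euclidean open disk in the plane. -/
def eball (P : ℝ × ℝ) (ρ : ℝ) : Set (ℝ × ℝ) := {z | len (z - P) < ρ}

/-- Euclidean dot product in the plane. -/
def dotp (a b : ℝ × ℝ) : ℝ := a.1 * b.1 + a.2 * b.2

/-- The closed half-strip erected over the segment `[Pi, Pi1]` in the direction `νi`. -/
def halfStrip (Pi Pi1 νi : ℝ × ℝ) : Set (ℝ × ℝ) :=
  {z | ∃ x ∈ segment ℝ Pi Pi1, ∃ t : ℝ, 0 ≤ t ∧ z = x + t • νi}

/-- The closed region bounded by the polygon with vertices `P 0, …, P (r-1)`. -/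
noncomputable def polyHull (r : ℕ) (P : ℕ → ℝ × ℝ) : Set (ℝ × ℝ) :=
  convexHull ℝ (P '' Set.Iio r)

/-- The unbounded multi-domain `Ω(V)`: the polygonal region together with the
half-strips over its edges. -/
noncomputable def OmegaV (r : ℕ) (P ν : ℕ → ℝ × ℝ) : Set (ℝ × ℝ) :=
  polyHull r P ∪ ⋃ i ∈ Set.Iio r, halfStrip (P i) (P (i + 1)) (ν i)

/-- The hypotheses: `P 0, …, P (r-1)` are the vertices, in cyclic order, of a convex
polygon `V` (with nonempty interior), extended `r`-periodically, and `ν i` is the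
outward unit normal of the edge `[P i, P (i+1)]`. -/
structure IsConvexPolygonData (r : ℕ) (P ν : ℕ → ℝ × ℝ) : Prop where
  three_le : 3 ≤ r
  periodicP : ∀ i, P (i + r) = P i
  periodicν : ∀ i, ν (i + r) = ν i
  inj : Set.InjOn P (Set.Iio r)
  interior_nonempty : (interior (polyHull r P)).Nonempty
  edges_boundary : ∀ i < r, segment ℝ (P i) (P (i + 1)) ⊆ frontier (polyHull r P)
  unit : ∀ i, len (ν i) = 1
  orth : ∀ i, dotp (ν i) (P (i + 1) - P i) = 0
  outward : ∀ i, ∀ x ∈ polyHull r P, dotp (x - P i) (ν i) ≤ 0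

/-- continuous trapezoid weight on `[0,1]` -/
noncomputable def trap (η y : ℝ) : ℝ := max 0 (min 1 (min (y / η - 1) ((1 - y) / η - 1)))

lemma trap_cont (η : ℝ) : Continuous (trap η) := by
  unfold trap; fun_prop

lemma trap_nonneg (η y : ℝ) : 0 ≤ trap η y := le_max_left _ _

lemma trap_le_one (η y : ℝ) : trap η y ≤ 1 := max_le zero_le_one (min_le_left _ _)

lemma trap_eq_zero_left {η y : ℝ} (hη : 0 < η) (hy : y ≤ η) : trap η y = 0 := by
  have : y / η ≤ 1 := by rw [div_le_one hη]; exact hy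
  exact max_eq_left ((min_le_right _ _).trans ((min_le_left _ _).trans (by linarith)))

lemma trap_eq_zero_right {η y : ℝ} (hη : 0 < η) (hy : 1 - η ≤ y) : trap η y = 0 := by
  have : (1 - y) / η ≤ 1 := by rw [div_le_one hη]; linarith
  exact max_eq_left ((min_le_right _ _).trans ((min_le_right _ _).trans (by linarith)))

lemma trap_eq_one {η y : ℝ} (hη : 0 < η) (hy : 2 * η ≤ y) (hy' : y ≤ 1 - 2 * η) :
    trap η y = 1 := by
  have h1 : 2 ≤ y / η := by rw [le_div_iff₀ hη]; exact hy
  have h2 : 2 ≤ (1 - y) / η := by rw [le_div_iff₀ hη]; linarith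
  unfold trap
  rw [min_eq_left (le_min (by linarith) (by linarith)), max_eq_right zero_le_one]

/-- total mass of the trapezoid -/
noncomputable def trapMass (η : ℝ) : ℝ := ∫ y in (0:ℝ)..1, trap η y

lemma trap_ii (η a b : ℝ) : IntervalIntegrable (trap η) volume a b :=
  (trap_cont η).intervalIntegrable _ _

lemma trapMass_pos {η : ℝ} (hη : 0 < η) (hη' : η ≤ 1 / 4) : 0 < trapMass η := by
  have hpos : 0 < trap η (1 / 2) := by
    rw [trap_eq_one hη (by linarith) (by linarith)]; exact one_pos
  exact intervalIntegral.integral_pos one_pos (trap_cont η).continuousOn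
    (fun y _ => trap_nonneg η y) ⟨1 / 2, by norm_num, hpos⟩

lemma trapMass_le_one (η : ℝ) : trapMass η ≤ 1 := by
  have := intervalIntegral.integral_mono_on (zero_le_one) (trap_ii η 0 1)
    (intervalIntegrable_const (c := (1:ℝ))) (fun y _ => trap_le_one η y)
  simpa [trapMass] using this

/-- smooth step -/
noncomputable def stepη (η x : ℝ) : ℝ := (∫ y in (0:ℝ)..x, trap η y) / trapMass η

lemma step_hasDerivAt (η x : ℝ) : HasDerivAt (stepη η) (trap η x / trapMass η) x := by
  have := intervalIntegral.integral_hasDerivAt_right (trap_ii η 0 x)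
    ((trap_cont η).stronglyMeasurableAtFilter _ _) (trap_cont η).continuousAt
  exact this.div_const _

lemma step_contDiff (η : ℝ) : ContDiff ℝ 1 (stepη η) := by
  rw [contDiff_one_iff_deriv]
  refine ⟨fun x => (step_hasDerivAt η x).differentiableAt, ?_⟩
  have : deriv (stepη η) = fun x => trap η x / trapMass η := by
    ext x; exact (step_hasDerivAt η x).deriv
  rw [this]
  exact (trap_cont η).div_const _

lemma step_left {η x : ℝ} (hη : 0 < η) (hx : x ≤ η) : stepη η x = 0 := by
  unfold stepη
  have : ∫ y in (0:ℝ)..x, trap η y = ∫ y in (0:ℝ)..x, (0:ℝ) := by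
    apply intervalIntegral.integral_congr
    intro y hy
    apply trap_eq_zero_left hη
    rcases le_total 0 x with h | h
    · rw [uIcc_of_le h] at hy; exact hy.2.trans hx
    · rw [uIcc_of_ge h] at hy; exact hy.2.trans hη.le
  rw [this]; simp

lemma step_right {η x : ℝ} (hη : 0 < η) (hη' : η ≤ 1 / 4) (hx : 1 - η ≤ x) : stepη η x = 1 := by
  unfold stepη
  have h : ∫ y in (1:ℝ)..x, trap η y = ∫ y in (1:ℝ)..x, (0:ℝ) := by
    apply intervalIntegral.integral_congr
    intro y hy
    apply trap_eq_zero_right hη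
    rcases le_total 1 x with h | h
    · rw [uIcc_of_le h] at hy; linarith [hy.1]
    · rw [uIcc_of_ge h] at hy; linarith [hy.1]
  rw [← intervalIntegral.integral_add_adjacent_intervals (trap_ii η 0 1) (trap_ii η 1 x), h]
  simp only [intervalIntegral.integral_zero, add_zero]
  exact div_self (trapMass_pos hη hη').ne'

lemma step_mono {η : ℝ} (hη : 0 < η) (hη' : η ≤ 1 / 4) : Monotone (stepη η) := by
  apply monotone_of_deriv_nonneg (fun x => (step_hasDerivAt η x).differentiableAt)
  intro x; rw [(step_hasDerivAt η x).deriv]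
  exact div_nonneg (trap_nonneg _ _) (trapMass_pos hη hη').le

lemma step_nonneg {η : ℝ} (hη : 0 < η) (hη' : η ≤ 1 / 4) (x : ℝ) : 0 ≤ stepη η x := by
  rcases le_total x η with h | h
  · rw [step_left hη h]
  · rw [← step_left hη (le_refl η)]; exact step_mono hη hη' h

lemma step_le_one {η : ℝ} (hη : 0 < η) (hη' : η ≤ 1 / 4) (x : ℝ) : stepη η x ≤ 1 := by
  rcases le_total (1 - η) x with h | h
  · rw [step_right hη hη' h]
  · rw [← step_right hη hη' (le_refl (1 - η))]; exact step_mono hη hη' h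

noncomputable def stp (x : ℝ) : ℝ := stepη (1 / 4) x
noncomputable def stp' (x : ℝ) : ℝ := trap (1 / 4) x / trapMass (1 / 4)
/-- bound for the derivative of the step -/
noncomputable def stpC : ℝ := 1 / trapMass (1 / 4)

lemma stpC_pos : 0 < stpC := one_div_pos.2 (trapMass_pos (by norm_num) le_rfl)
lemma stp_hasDerivAt (x : ℝ) : HasDerivAt stp (stp' x) x := step_hasDerivAt _ x
lemma stp_contDiff : ContDiff ℝ 1 stp := step_contDiff _
lemma stp_left {x : ℝ} (hx : x ≤ 0) : stp x = 0 := step_left (by norm_num) (by linarith)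
lemma stp_right {x : ℝ} (hx : 1 ≤ x) : stp x = 1 :=
  step_right (by norm_num) le_rfl (by linarith)
lemma stp_nonneg (x : ℝ) : 0 ≤ stp x := step_nonneg (by norm_num) le_rfl x
lemma stp_le_one (x : ℝ) : stp x ≤ 1 := step_le_one (by norm_num) le_rfl x
lemma stp_mono : Monotone stp := step_mono (by norm_num) le_rfl
lemma stp'_nonneg (x : ℝ) : 0 ≤ stp' x :=
  div_nonneg (trap_nonneg _ _) (trapMass_pos (by norm_num) le_rfl).le
lemma stp'_le (x : ℝ) : stp' x ≤ stpC :=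
  div_le_div_of_nonneg_right (trap_le_one _ _) (trapMass_pos (by norm_num) le_rfl).le
lemma stp'_left {x : ℝ} (hx : x ≤ 0) : stp' x = 0 := by
  unfold stp'; rw [trap_eq_zero_left (by norm_num) (by linarith)]; simp
lemma stp'_right {x : ℝ} (hx : 1 ≤ x) : stp' x = 0 := by
  unfold stp'; rw [trap_eq_zero_right (by norm_num) (by linarith)]; simp

/-- the odd truncation -/
noncomputable def trunc (x : ℝ) : ℝ := stp x - stp (-x)
noncomputable def trunc' (x : ℝ) : ℝ := stp' x + stp' (-x)
lemma trunc_hasDerivAt (x : ℝ) : HasDerivAt trunc (trunc' x) x := by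
  have h1 := stp_hasDerivAt x
  have h2 := (stp_hasDerivAt (-x)).comp x (hasDerivAt_neg x)
  have := h1.sub h2
  have e : trunc' x = stp' x - stp' (-x) * -1 := by unfold trunc'; ring
  rw [e]; exact this
lemma trunc_contDiff : ContDiff ℝ 1 trunc :=
  stp_contDiff.sub (stp_contDiff.comp contDiff_neg)
lemma trunc_zero : trunc 0 = 0 := by simp [trunc]
lemma trunc_top {x : ℝ} (hx : 1 ≤ x) : trunc x = 1 := by
  rw [trunc, stp_right hx, stp_left (by linarith)]; simp
lemma trunc_bot {x : ℝ} (hx : x ≤ -1) : trunc x = -1 := by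
  rw [trunc, stp_left (by linarith), stp_right (by linarith)]; simp
lemma trunc_abs_le (x : ℝ) : |trunc x| ≤ 1 := by
  rw [abs_le, trunc]
  constructor <;> linarith [stp_nonneg x, stp_nonneg (-x), stp_le_one x, stp_le_one (-x)]
lemma trunc'_nonneg (x : ℝ) : 0 ≤ trunc' x := add_nonneg (stp'_nonneg _) (stp'_nonneg _)
lemma trunc'_le (x : ℝ) : trunc' x ≤ 2 * stpC := by
  unfold trunc'; linarith [stp'_le x, stp'_le (-x)]

/-- divergence-free `C¹` vector field on `Ω` -/
structure DivFree (X : ℝ × ℝ → ℝ × ℝ) (Ω : Set (ℝ × ℝ)) : Prop where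
  cd : ContDiffOn ℝ 1 X Ω
  div : ∀ z ∈ Ω, (fderiv ℝ X z (1, 0)).1 + (fderiv ℝ X z (0, 1)).2 = 0

lemma DivFree.sub {X Y : ℝ × ℝ → ℝ × ℝ} {Ω : Set (ℝ × ℝ)} (ho : IsOpen Ω)
    (hX : DivFree X Ω) (hY : DivFree Y Ω) : DivFree (fun z => X z - Y z) Ω := by
  refine ⟨hX.cd.sub hY.cd, fun z hz => ?_⟩
  have h1 := (hX.cd.contDiffAt (ho.mem_nhds hz)).differentiableAt one_ne_zero
  have h2 := (hY.cd.contDiffAt (ho.mem_nhds hz)).differentiableAt one_ne_zero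
  rw [fderiv_fun_sub h1 h2]
  have := hX.div z hz
  have := hY.div z hz
  simp only [sub_apply, Prod.fst_sub, Prod.snd_sub]
  linarith

lemma divFree_const (n : ℝ × ℝ) (Ω : Set (ℝ × ℝ)) : DivFree (fun _ => n) Ω :=
  ⟨contDiffOn_const, fun z _ => by simp⟩

lemma integral_fderiv_zero (F : ℝ × ℝ → ℝ) (hF : ContDiff ℝ 1 F) (hc : HasCompactSupport F)
    (v : ℝ × ℝ) : ∫ z, fderiv ℝ F z v = 0 := by
  have hcont : Continuous (fun z => fderiv ℝ F z v) :=
    (hF.continuous_fderiv one_ne_zero).clm_apply continuous_const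
  have hcs : HasCompactSupport (fun z => fderiv ℝ F z v) := hc.fderiv_apply ℝ v
  have := integral_mul_fderiv_eq_neg_fderiv_mul_of_integrable (μ := volume) (𝕜 := ℝ)
    (f := fun _ : ℝ × ℝ => (1:ℝ)) (g := F) (v := v) (by simp)
    (by simpa using hcont.integrable_of_hasCompactSupport hcs)
    (by simpa using hF.continuous.integrable_of_hasCompactSupport hc)
    (fun x _ => differentiableAt_const _)
    (fun x _ => (hF.differentiable one_ne_zero) x)
  simpa using this

/-- a compact subset of `Ω` carrying `g` -/
lemma compact_core {Ω K : Set (ℝ × ℝ)} {g : ℝ × ℝ → ℝ} (hK : IsCompact K)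
    (hb : ∀ z ∈ K, z ∉ Ω → ∀ᶠ y in 𝓝[Ω] z, g y = 0) :
    IsCompact (K ∩ closure {z | z ∈ Ω ∧ g z ≠ 0}) ∧ K ∩ closure {z | z ∈ Ω ∧ g z ≠ 0} ⊆ Ω := by
  refine ⟨hK.inter_right isClosed_closure, ?_⟩
  rintro z ⟨hz, hz'⟩
  by_contra h
  have h1 := hb z hz h
  rw [eventually_nhdsWithin_iff] at h1
  rw [mem_closure_iff_frequently] at hz'
  obtain ⟨y, hy1, hy2⟩ := (hz'.and_eventually h1).exists
  exact hy1.2 (hy2 hy1.1)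

lemma weak_form {Ω K : Set (ℝ × ℝ)} (ho : IsOpen Ω) {X : ℝ × ℝ → ℝ × ℝ} (hX : DivFree X Ω)
    {g : ℝ × ℝ → ℝ} (hg : ContDiffOn ℝ 1 g Ω) (hK : IsCompact K)
    (h0 : ∀ z ∈ Ω, z ∉ K → g z = 0)
    (hb : ∀ z ∈ K, z ∉ Ω → ∀ᶠ y in 𝓝[Ω] z, g y = 0) :
    IntegrableOn (fun z => fderiv ℝ g z (X z)) Ω ∧ ∫ z in Ω, fderiv ℝ g z (X z) = 0 := by
  obtain ⟨hKc, hKΩ⟩ := compact_core (Ω := Ω) hK hb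
  set K' := K ∩ closure {z | z ∈ Ω ∧ g z ≠ 0} with hK'
  have hgz : ∀ z ∈ Ω, z ∉ K' → g z = 0 := by
    intro z hz hzK
    by_contra hne
    by_cases hzk : z ∈ K
    · exact hzK ⟨hzk, subset_closure ⟨hz, hne⟩⟩
    · exact hne (h0 z hz hzk)
  set G : ℝ × ℝ → ℝ × ℝ := Ω.indicator (fun z => g z • X z) with hG
  have hGz : ∀ z, z ∉ K' → G z = 0 := by
    intro z hz
    by_cases hzo : z ∈ Ω
    · simp [hG, hzo, hgz z hzo hz]
    · simp [hG, hzo]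
  have hGev : ∀ z ∈ Ω, G =ᶠ[𝓝 z] fun z => g z • X z := by
    intro z hz
    filter_upwards [ho.mem_nhds hz] with y hy
    simp [hG, hy]
  have hGev0 : ∀ z, z ∉ K' → G =ᶠ[𝓝 z] fun _ => 0 := by
    intro z hz
    filter_upwards [hKc.isClosed.isOpen_compl.mem_nhds hz] with y hy
    exact hGz y hy
  have hGC : ContDiff ℝ 1 G := by
    rw [contDiff_iff_contDiffAt]
    intro z
    by_cases hz : z ∈ K'
    · have hz := hKΩ hz
      have := ((hg.contDiffAt (ho.mem_nhds hz)).smul (hX.cd.contDiffAt (ho.mem_nhds hz)))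
      exact this.congr_of_eventuallyEq (hGev z hz)
    · exact contDiffAt_const.congr_of_eventuallyEq (hGev0 z hz)
  have hGs : HasCompactSupport G := HasCompactSupport.intro hKc hGz
  have hG1 : ContDiff ℝ 1 (fun z => (G z).1) := contDiff_fst.comp hGC
  have hG2 : ContDiff ℝ 1 (fun z => (G z).2) := contDiff_snd.comp hGC
  have hs1 : HasCompactSupport (fun z => (G z).1) :=
    HasCompactSupport.intro hKc (fun z hz => by simp [hGz z hz])
  have hs2 : HasCompactSupport (fun z => (G z).2) :=
    HasCompactSupport.intro hKc (fun z hz => by simp [hGz z hz])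
  have i1 := integral_fderiv_zero _ hG1 hs1 (1, 0)
  have i2 := integral_fderiv_zero _ hG2 hs2 (0, 1)
  have c1 : Integrable (fun z => fderiv ℝ (fun z => (G z).1) z (1, 0)) :=
    ((hG1.continuous_fderiv one_ne_zero).clm_apply continuous_const).integrable_of_hasCompactSupport
      (hs1.fderiv_apply ℝ _)
  have c2 : Integrable (fun z => fderiv ℝ (fun z => (G z).2) z (0, 1)) :=
    ((hG2.continuous_fderiv one_ne_zero).clm_apply continuous_const).integrable_of_hasCompactSupport
      (hs2.fderiv_apply ℝ _)
  have key : ∀ z ∈ Ω, fderiv ℝ (fun z => (G z).1) z (1, 0) + fderiv ℝ (fun z => (G z).2) z (0, 1)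
      = fderiv ℝ g z (X z) := by
    intro z hz
    have d1 := (hg.contDiffAt (ho.mem_nhds hz)).differentiableAt one_ne_zero
    have d2 := (hX.cd.contDiffAt (ho.mem_nhds hz)).differentiableAt one_ne_zero
    have dG : HasFDerivAt G (fderiv ℝ G z) z := (hGC.differentiable one_ne_zero z).hasFDerivAt
    have e1 : fderiv ℝ (fun z => (G z).1) z = (ContinuousLinearMap.fst ℝ ℝ ℝ).comp (fderiv ℝ G z) :=
      dG.fst.fderiv
    have e2 : fderiv ℝ (fun z => (G z).2) z = (ContinuousLinearMap.snd ℝ ℝ ℝ).comp (fderiv ℝ G z) :=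
      dG.snd.fderiv
    have e3 : fderiv ℝ G z = g z • fderiv ℝ X z + (fderiv ℝ g z).smulRight (X z) := by
      rw [(hGev z hz).fderiv_eq]
      exact (d1.hasFDerivAt.smul d2.hasFDerivAt).fderiv
    have hd := hX.div z hz
    have e4 : fderiv ℝ g z (X z) = (X z).1 * fderiv ℝ g z (1, 0) + (X z).2 * fderiv ℝ g z (0, 1) := by
      have : X z = (X z).1 • ((1:ℝ), (0:ℝ)) + (X z).2 • ((0:ℝ), (1:ℝ)) := by
        ext <;> simp
      conv_lhs => rw [this]
      rw [map_add, map_smul, map_smul]; simp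
    rw [e1, e2, e3, e4]
    simp
    linear_combination (g z) * hd
  have key0 : ∀ z, z ∉ Ω → fderiv ℝ (fun z => (G z).1) z (1, 0) +
      fderiv ℝ (fun z => (G z).2) z (0, 1) = 0 := by
    intro z hz
    have hz' : z ∉ K' := fun h => hz (hKΩ h)
    have h1 : (fun z => (G z).1) =ᶠ[𝓝 z] fun _ => 0 := by
      filter_upwards [hGev0 z hz'] with y hy; rw [hy]; rfl
    have h2 : (fun z => (G z).2) =ᶠ[𝓝 z] fun _ => 0 := by
      filter_upwards [hGev0 z hz'] with y hy; rw [hy]; rfl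
    rw [h1.fderiv_eq, h2.fderiv_eq]; simp
  constructor
  · exact (c1.add c2).integrableOn.congr_fun (fun z hz => key z hz) ho.measurableSet
  · rw [setIntegral_congr_fun ho.measurableSet (fun z hz => (key z hz).symm),
      setIntegral_eq_integral_of_forall_compl_eq_zero (fun z hz => key0 z hz),
      integral_add c1 c2, i1, i2, add_zero]

lemma trap'_cont : Continuous trunc' := by
  unfold trunc' stp'
  have := trap_cont (1/4)
  fun_prop

lemma trunc'_sat {x : ℝ} (hx : 1 ≤ |x|) : trunc' x = 0 := by
  unfold trunc'
  rcases le_abs.1 hx with h | h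
  · rw [stp'_right h, stp'_left (by linarith), add_zero]
  · rw [stp'_right h, stp'_left (by linarith), add_zero]

/-- the normalized gradient field of `u` -/
structure Fld (u : ℝ × ℝ → ℝ) (X : ℝ × ℝ → ℝ × ℝ) (Ω : Set (ℝ × ℝ)) : Prop where
  cd : ContDiffOn ℝ 1 u Ω
  df : DivFree X Ω
  eq1 : ∀ z ∈ Ω, (X z).1 = fderiv ℝ u z (1, 0) /
    Real.sqrt (1 + (fderiv ℝ u z (1, 0)) ^ 2 + (fderiv ℝ u z (0, 1)) ^ 2)
  eq2 : ∀ z ∈ Ω, (X z).2 = fderiv ℝ u z (0, 1) /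
    Real.sqrt (1 + (fderiv ℝ u z (1, 0)) ^ 2 + (fderiv ℝ u z (0, 1)) ^ 2)

lemma clm_split (A : ℝ × ℝ →L[ℝ] ℝ) (v : ℝ × ℝ) : A v = v.1 * A (1, 0) + v.2 * A (0, 1) := by
  have : v = v.1 • ((1:ℝ), (0:ℝ)) + v.2 • ((0:ℝ), (1:ℝ)) := by ext <;> simp
  conv_lhs => rw [this]
  rw [map_add, map_smul, map_smul]; simp

lemma Fld.sq_le {u : ℝ × ℝ → ℝ} {X : ℝ × ℝ → ℝ × ℝ} {Ω : Set (ℝ × ℝ)} (h : Fld u X Ω)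
    {z : ℝ × ℝ} (hz : z ∈ Ω) : (X z).1 ^ 2 + (X z).2 ^ 2 ≤ 1 := by
  rw [h.eq1 z hz, h.eq2 z hz, div_pow, div_pow, Real.sq_sqrt (by positivity), ← add_div,
    div_le_one (by positivity)]
  linarith

lemma norm_le_one_of_sq {v : ℝ × ℝ} (h : v.1 ^ 2 + v.2 ^ 2 ≤ 1) : ‖v‖ ≤ 1 := by
  rw [Prod.norm_def, max_le_iff, Real.norm_eq_abs, Real.norm_eq_abs]
  constructor <;> refine abs_le_of_sq_le_sq ?_ zero_le_one <;> nlinarith [sq_nonneg v.1, sq_nonneg v.2]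

lemma pw_lower {p q a b : ℝ} (h : a ^ 2 + b ^ 2 ≤ 1) :
    -1 ≤ (p / √(1 + p ^ 2 + q ^ 2) - a) * p + (q / √(1 + p ^ 2 + q ^ 2) - b) * q := by
  set W := √(1 + p ^ 2 + q ^ 2) with hW
  have hW2 : W ^ 2 = 1 + p ^ 2 + q ^ 2 := Real.sq_sqrt (by positivity)
  have hWp : 1 ≤ W := by rw [hW]; exact Real.one_le_sqrt.2 (by nlinarith [sq_nonneg p, sq_nonneg q])
  have h1 : a * p + b * q ≤ W := by
    apply le_of_sq_le_sq _ (by linarith) |> fun h => h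
    nlinarith [sq_nonneg (a * q - b * p), sq_nonneg p, sq_nonneg q]
  have h2 : (p / W - a) * p + (q / W - b) * q = W - 1 / W - (a * p + b * q) := by
    field_simp
    linear_combination (-1 : ℝ) * hW2
  have h3 : 1 / W ≤ 1 := by rw [div_le_one (by linarith)]; exact hWp
  rw [h2]; linarith

lemma pw_mono (p q a b : ℝ) :
    0 ≤ (p / √(1 + p ^ 2 + q ^ 2) - a / √(1 + a ^ 2 + b ^ 2)) * (p - a)
      + (q / √(1 + p ^ 2 + q ^ 2) - b / √(1 + a ^ 2 + b ^ 2)) * (q - b) ∧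
    ((p / √(1 + p ^ 2 + q ^ 2) - a / √(1 + a ^ 2 + b ^ 2)) * (p - a)
      + (q / √(1 + p ^ 2 + q ^ 2) - b / √(1 + a ^ 2 + b ^ 2)) * (q - b) = 0 → p = a ∧ q = b) := by
  set W := √(1 + p ^ 2 + q ^ 2) with hW
  set V := √(1 + a ^ 2 + b ^ 2) with hV
  have hW2 : W ^ 2 = 1 + p ^ 2 + q ^ 2 := Real.sq_sqrt (by positivity)
  have hV2 : V ^ 2 = 1 + a ^ 2 + b ^ 2 := Real.sq_sqrt (by positivity)
  have hWp : 0 < W := Real.sqrt_pos.2 (by positivity)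
  have hVp : 0 < V := Real.sqrt_pos.2 (by positivity)
  have e : (p / W - a / V) * (p - a) + (q / W - b / V) * (q - b)
      = (W + V) / (W * V) * (W * V - (1 + p * a + q * b)) := by
    field_simp
    linear_combination (-V) * hW2 + (-W) * hV2
  have hid : (W * V) ^ 2 - (1 + p * a + q * b) ^ 2
      = (p - a) ^ 2 + (q - b) ^ 2 + (p * b - q * a) ^ 2 := by
    rw [mul_pow, hW2, hV2]; ring
  have hle : 1 + p * a + q * b ≤ W * V := by
    apply le_of_sq_le_sq _ (by positivity) |> fun h => h
    nlinarith [sq_nonneg (p - a), sq_nonneg (q - b), sq_nonneg (p * b - q * a)]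
  have hc : 0 < (W + V) / (W * V) := by positivity
  rw [e]
  refine ⟨mul_nonneg hc.le (by linarith), fun h0 => ?_⟩
  have h1 : W * V - (1 + p * a + q * b) = 0 := by
    rcases mul_eq_zero.1 h0 with h | h
    · exact absurd h hc.ne'
    · exact h
  have h2 : (p - a) ^ 2 + (q - b) ^ 2 + (p * b - q * a) ^ 2 = 0 := by
    rw [← hid]; have : W * V = 1 + p * a + q * b := by linarith
    rw [this]; ring
  constructor <;> nlinarith [sq_nonneg (p - a), sq_nonneg (q - b), sq_nonneg (p * b - q * a)]

lemma Fld.lower {u : ℝ × ℝ → ℝ} {X : ℝ × ℝ → ℝ × ℝ} {Ω : Set (ℝ × ℝ)} (h : Fld u X Ω)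
    {z : ℝ × ℝ} (hz : z ∈ Ω) {Y : ℝ × ℝ} (hY : Y.1 ^ 2 + Y.2 ^ 2 ≤ 1) :
    -1 ≤ fderiv ℝ u z (X z - Y) := by
  rw [clm_split, Prod.fst_sub, Prod.snd_sub, h.eq1 z hz, h.eq2 z hz]
  exact pw_lower hY

lemma Fld.mono {u u' : ℝ × ℝ → ℝ} {X X' : ℝ × ℝ → ℝ × ℝ} {Ω : Set (ℝ × ℝ)} (h : Fld u X Ω)
    (h' : Fld u' X' Ω) {z : ℝ × ℝ} (hz : z ∈ Ω) :
    0 ≤ (fderiv ℝ u z - fderiv ℝ u' z) (X z - X' z) ∧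
    ((fderiv ℝ u z - fderiv ℝ u' z) (X z - X' z) = 0 → fderiv ℝ u z = fderiv ℝ u' z) := by
  rw [clm_split, Prod.fst_sub, Prod.snd_sub, h.eq1 z hz, h.eq2 z hz, h'.eq1 z hz, h'.eq2 z hz,
    sub_apply, sub_apply]
  obtain ⟨h1, h2⟩ := pw_mono (fderiv ℝ u z (1, 0)) (fderiv ℝ u z (0, 1))
    (fderiv ℝ u' z (1, 0)) (fderiv ℝ u' z (0, 1))
  refine ⟨h1, fun h0 => ?_⟩
  obtain ⟨h3, h4⟩ := h2 h0
  ext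
  · simpa using h3
  · simpa using h4

/-- admissible cut-off functions -/
structure Adm (ρ : ℝ × ℝ → ℝ) (Ω K : Set (ℝ × ℝ)) : Prop where
  cd : ContDiffOn ℝ 1 ρ Ω
  nonneg : ∀ z ∈ Ω, 0 ≤ ρ z
  le_one : ∀ z ∈ Ω, ρ z ≤ 1
  cpt : IsCompact K
  zero : ∀ z ∈ Ω, z ∉ K → ρ z = 0
  bdd : ∃ M, ∀ z ∈ Ω, ‖fderiv ℝ ρ z‖ ≤ M

lemma integrableOn_bdd {Ω K : Set (ℝ × ℝ)} (ho : IsOpen Ω) (hK : IsCompact K) {F : ℝ × ℝ → ℝ}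
    (hF : ContinuousOn F Ω) {M : ℝ} (hM : ∀ z ∈ Ω, |F z| ≤ M) (h0 : ∀ z ∈ Ω, z ∉ K → F z = 0) :
    IntegrableOn F Ω := by
  have h1 : IntegrableOn F (Ω ∩ K) := by
    have : IsFiniteMeasure (volume.restrict (Ω ∩ K)) :=
      ⟨by rw [Measure.restrict_apply_univ]
          exact (measure_mono inter_subset_right).trans_lt hK.measure_lt_top⟩
    apply Integrable.of_bound (C := M)
    · exact (hF.aestronglyMeasurable ho.measurableSet).mono_measure
        (Measure.restrict_mono inter_subset_left le_rfl)
    · filter_upwards [ae_restrict_mem (ho.measurableSet.inter hK.measurableSet)] with z hz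
      exact hM z hz.1
  have h2 : IntegrableOn F (Ω \ K) := by
    apply IntegrableOn.congr_fun (integrableOn_zero) _ (ho.measurableSet.diff hK.measurableSet)
    intro z hz; exact (h0 z hz.1 hz.2).symm
  rw [← inter_union_sdiff Ω K]; exact h1.union h2

lemma integrableOn_core {Ω K : Set (ℝ × ℝ)} (ho : IsOpen Ω) (hK : IsCompact K)
    {F g : ℝ × ℝ → ℝ} (hF : ContinuousOn F Ω) (hg0 : ∀ z ∈ Ω, z ∉ K → g z = 0)
    (hb : ∀ z ∈ K, z ∉ Ω → ∀ᶠ y in 𝓝[Ω] z, g y = 0) (h0 : ∀ z ∈ Ω, g z = 0 → F z = 0) :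
    IntegrableOn F Ω := by
  obtain ⟨hKc, hKΩ⟩ := compact_core (Ω := Ω) hK hb
  obtain ⟨M, hM⟩ := hKc.exists_bound_of_continuousOn (hF.mono hKΩ)
  have hz0 : ∀ z ∈ Ω, z ∉ K ∩ closure {z | z ∈ Ω ∧ g z ≠ 0} → F z = 0 := by
    intro z hz hzK
    apply h0 z hz
    by_contra hne
    by_cases hzk : z ∈ K
    · exact hzK ⟨hzk, subset_closure ⟨hz, hne⟩⟩
    · exact hne (hg0 z hz hzk)
  apply integrableOn_bdd ho hKc hF (M := max M 0) _ hz0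
  intro z hz
  by_cases hzK : z ∈ K ∩ closure {z | z ∈ Ω ∧ g z ≠ 0}
  · exact (hM z hzK).trans (le_max_left _ _)
  · rw [hz0 z hz hzK]; simp

/-- `u → ±∞` at the boundary points in `K`, and `h = ±1` nearby -/
def Sat (u h : ℝ × ℝ → ℝ) (Ω K : Set (ℝ × ℝ)) : Prop :=
  ∀ z ∈ K, z ∉ Ω →
    (Tendsto u (𝓝[Ω] z) atTop ∧ ∀ᶠ y in 𝓝[Ω] z, h y = 1) ∨
    (Tendsto u (𝓝[Ω] z) atBot ∧ ∀ᶠ y in 𝓝[Ω] z, h y = -1)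

lemma Sat.ev {u h : ℝ × ℝ → ℝ} {Ω K : Set (ℝ × ℝ)} (hs : Sat u h Ω K) {k : ℝ} (hk : 0 < k)
    {z : ℝ × ℝ} (hz : z ∈ K) (hz' : z ∉ Ω) :
    ∀ᶠ y in 𝓝[Ω] z, h y = trunc (u y / k) ∧ 1 ≤ |u y / k| ∧ |h y| = 1 := by
  rcases hs z hz hz' with ⟨h1, h2⟩ | ⟨h1, h2⟩
  · filter_upwards [h1.eventually_ge_atTop k, h2] with y hy1 hy2
    have : 1 ≤ u y / k := by rw [le_div_iff₀ hk]; linarith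
    exact ⟨by rw [hy2, trunc_top this], le_abs.2 (Or.inl this), by rw [hy2]; simp⟩
  · filter_upwards [h1.eventually_le_atBot (-k), h2] with y hy1 hy2
    have : u y / k ≤ -1 := by rw [div_le_iff₀ hk]; linarith
    exact ⟨by rw [hy2, trunc_bot this], le_abs.2 (Or.inr (by linarith)), by rw [hy2]; simp⟩

/-- truncation at level `k` -/
noncomputable def trk (u : ℝ × ℝ → ℝ) (k : ℝ) (z : ℝ × ℝ) : ℝ := trunc (u z / k)

lemma diffAt {g : ℝ × ℝ → ℝ} {Ω : Set (ℝ × ℝ)} (ho : IsOpen Ω) (hg : ContDiffOn ℝ 1 g Ω)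
    {z : ℝ × ℝ} (hz : z ∈ Ω) : DifferentiableAt ℝ g z :=
  (hg.contDiffAt (ho.mem_nhds hz)).differentiableAt one_ne_zero

lemma trk_cd {u : ℝ × ℝ → ℝ} {Ω : Set (ℝ × ℝ)} (hu : ContDiffOn ℝ 1 u Ω) (k : ℝ) :
    ContDiffOn ℝ 1 (trk u k) Ω :=
  trunc_contDiff.comp_contDiffOn (hu.div_const k)

lemma trk_fderiv {u : ℝ × ℝ → ℝ} {Ω : Set (ℝ × ℝ)} (ho : IsOpen Ω) (hu : ContDiffOn ℝ 1 u Ω)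
    (k : ℝ) {z : ℝ × ℝ} (hz : z ∈ Ω) (v : ℝ × ℝ) :
    fderiv ℝ (trk u k) z v = trunc' (u z / k) / k * fderiv ℝ u z v := by
  have h1 : HasFDerivAt (fun z => u z / k) (k⁻¹ • fderiv ℝ u z) z := by
    simpa [div_eq_inv_mul] using (diffAt ho hu hz).hasFDerivAt.const_mul k⁻¹
  have h2 := (trunc_hasDerivAt (u z / k)).comp_hasFDerivAt z h1
  have h3 : fderiv ℝ (trk u k) z = trunc' (u z / k) • (k⁻¹ • fderiv ℝ u z) := h2.fderiv
  rw [h3]; simp; ring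

lemma cont_fd {g : ℝ × ℝ → ℝ} {Z : ℝ × ℝ → ℝ × ℝ} {Ω : Set (ℝ × ℝ)} (ho : IsOpen Ω)
    (hg : ContDiffOn ℝ 1 g Ω) (hZ : ContinuousOn Z Ω) :
    ContinuousOn (fun z => fderiv ℝ g z (Z z)) Ω :=
  (hg.continuousOn_fderiv_of_isOpen ho le_rfl).clm_apply hZ

lemma fd_mul {f g : ℝ × ℝ → ℝ} {Ω : Set (ℝ × ℝ)} (ho : IsOpen Ω)
    (hf : ContDiffOn ℝ 1 f Ω) (hg : ContDiffOn ℝ 1 g Ω) {z : ℝ × ℝ} (hz : z ∈ Ω) (v : ℝ × ℝ) :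
    fderiv ℝ (fun z => f z * g z) z v = f z * fderiv ℝ g z v + g z * fderiv ℝ f z v := by
  rw [fderiv_fun_mul (diffAt ho hf hz) (diffAt ho hg hz)]; simp

section
variable {Ω K : Set (ℝ × ℝ)} {ρ u : ℝ × ℝ → ℝ} {Z : ℝ × ℝ → ℝ × ℝ}

lemma Adm.fd_zero (ho : IsOpen Ω) (ha : Adm ρ Ω K) {z : ℝ × ℝ} (hz : z ∈ Ω) (hzK : z ∉ K) :
    fderiv ℝ ρ z = 0 := by
  have : ρ =ᶠ[𝓝 z] fun _ => 0 := by
    filter_upwards [(ho.inter ha.cpt.isClosed.isOpen_compl).mem_nhds ⟨hz, hzK⟩] with y hy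
    exact ha.zero y hy.1 hy.2
  rw [this.fderiv_eq]; simp

lemma Adm.int_gen (ho : IsOpen Ω) (ha : Adm ρ Ω K) (hZ : ContinuousOn Z Ω)
    (hZb : ∀ z ∈ Ω, ‖Z z‖ ≤ 2) {f : ℝ × ℝ → ℝ} (hf : ContinuousOn f Ω) {C : ℝ}
    (hfb : ∀ z ∈ Ω, |f z| ≤ C) : IntegrableOn (fun z => f z * fderiv ℝ ρ z (Z z)) Ω := by
  obtain ⟨M, hM⟩ := ha.bdd
  apply integrableOn_bdd ho ha.cpt (hf.mul (cont_fd ho ha.cd hZ)) (M := C * (M * 2))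
  · intro z hz
    change |f z * fderiv ℝ ρ z (Z z)| ≤ _
    rw [abs_mul]
    have h1 := (fderiv ℝ ρ z).le_opNorm (Z z)
    rw [Real.norm_eq_abs] at h1
    have h2 : ‖fderiv ℝ ρ z‖ * ‖Z z‖ ≤ M * 2 :=
      mul_le_mul (hM z hz) (hZb z hz) (norm_nonneg _) ((norm_nonneg _).trans (hM z hz))
    exact mul_le_mul (hfb z hz) (h1.trans h2) (abs_nonneg _) ((abs_nonneg _).trans (hfb z hz))
  · intro z hz hzK
    change f z * fderiv ℝ ρ z (Z z) = 0
    rw [ha.fd_zero ho hz hzK]; simp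

lemma Adm.int_rho (ho : IsOpen Ω) (ha : Adm ρ Ω K) : IntegrableOn ρ Ω :=
  integrableOn_bdd ho ha.cpt ha.cd.continuousOn (M := 1)
    (fun z hz => abs_le.2 ⟨by linarith [ha.nonneg z hz], ha.le_one z hz⟩) ha.zero

lemma Adm.int_core (ho : IsOpen Ω) (ha : Adm ρ Ω K) (hZ : ContinuousOn Z Ω)
    (hu : ContDiffOn ℝ 1 u Ω) {h : ℝ × ℝ → ℝ} (hs : Sat u h Ω K) {k : ℝ} (hk : 0 < k)
    {f : ℝ × ℝ → ℝ} (hf : ContinuousOn f Ω) :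
    IntegrableOn (fun z => f z * (ρ z * fderiv ℝ (trk u k) z (Z z))) Ω := by
  apply integrableOn_core ho ha.cpt (g := fun z => ρ z * trunc' (u z / k))
  · exact hf.mul (ha.cd.continuousOn.mul (cont_fd ho (trk_cd hu k) hZ))
  · intro z hz hzK; rw [ha.zero z hz hzK]; simp
  · intro z hz hz'
    filter_upwards [hs.ev hk hz hz'] with y hy
    rw [trunc'_sat hy.2.1, mul_zero]
  · intro z hz h0
    rw [trk_fderiv ho hu k hz]
    linear_combination (f z * fderiv ℝ u z (Z z) / k) * h0

lemma Adm.tendsto_zero (ho : IsOpen Ω) (ha : Adm ρ Ω K) (hZ : ContinuousOn Z Ω)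
    (hZb : ∀ z ∈ Ω, ‖Z z‖ ≤ 2) (hu : ContDiffOn ℝ 1 u Ω) :
    Tendsto (fun n : ℕ => ∫ z in Ω, trk u (n + 1) z * fderiv ℝ ρ z (Z z)) atTop (𝓝 0) := by
  have h0 : (0:ℝ) = ∫ z in Ω, (0:ℝ) := by simp
  rw [h0]
  have hi := ha.int_gen ho hZ hZb (f := fun _ => 1) continuousOn_const (C := 1) (by simp)
  apply tendsto_integral_of_dominated_convergence (fun z => |1 * fderiv ℝ ρ z (Z z)|)
  · intro n
    exact ((trk_cd hu _).continuousOn.mul (cont_fd ho ha.cd hZ)).aestronglyMeasurable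
      ho.measurableSet
  · exact hi.abs
  · intro n
    refine Eventually.of_forall fun z => ?_
    rw [Real.norm_eq_abs, abs_mul, abs_mul]
    apply mul_le_mul_of_nonneg_right _ (abs_nonneg _)
    simpa [trk] using trunc_abs_le (u z / (n + 1))
  · refine Eventually.of_forall fun z => ?_
    have h1 : Tendsto (fun n : ℕ => u z / ((n:ℝ) + 1)) atTop (𝓝 0) :=
      tendsto_const_nhds.div_atTop
        (tendsto_atTop_add_const_right _ _ tendsto_natCast_atTop_atTop)
    have h2 := (trunc_contDiff.continuous.tendsto 0).comp h1
    rw [trunc_zero] at h2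
    simpa [trk, Function.comp_def] using h2.mul_const (fderiv ℝ ρ z (Z z))

lemma nat_pos' (n : ℕ) : (0:ℝ) < (n:ℝ) + 1 := by positivity

lemma trk_lower (ho : IsOpen Ω) (ha : Adm ρ Ω K) {X Y : ℝ × ℝ → ℝ × ℝ} (hf : Fld u X Ω)
    (hY1 : ∀ z ∈ Ω, (Y z).1 ^ 2 + (Y z).2 ^ 2 ≤ 1) {k : ℝ} (hk : 0 < k) {z : ℝ × ℝ} (hz : z ∈ Ω) :
    -(2 * stpC / k) * ρ z ≤ ρ z * fderiv ℝ (trk u k) z (X z - Y z) := by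
  rw [trk_fderiv ho hf.cd k hz]
  have h1 := hf.lower hz (hY1 z hz)
  have h2 : 0 ≤ trunc' (u z / k) / k := div_nonneg (trunc'_nonneg _) hk.le
  have h3 : trunc' (u z / k) / k ≤ 2 * stpC / k :=
    div_le_div_of_nonneg_right (trunc'_le _) hk.le
  have h4 : -(2 * stpC / k) ≤ trunc' (u z / k) / k * fderiv ℝ u z (X z - Y z) := by nlinarith
  nlinarith [ha.nonneg z hz]

lemma lim_C (C : ℝ) : Tendsto (fun n : ℕ => C / ((n:ℝ) + 1)) atTop (𝓝 0) :=
  tendsto_const_nhds.div_atTop (tendsto_atTop_add_const_right _ _ tendsto_natCast_atTop_atTop)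

lemma flux_split (ho : IsOpen Ω) (ha : Adm ρ Ω K) (hZ : DivFree Z Ω) (hZb : ∀ z ∈ Ω, ‖Z z‖ ≤ 2)
    (hu : ContDiffOn ℝ 1 u Ω) {h : ℝ × ℝ → ℝ} (hh : ContDiffOn ℝ 1 h Ω)
    (hs : Sat u h Ω K) {k : ℝ} (hk : 0 < k) :
    IntegrableOn (fun z => fderiv ℝ (fun z => ρ z * h z) z (Z z)) Ω ∧
    ∫ z in Ω, fderiv ℝ (fun z => ρ z * h z) z (Z z) =
      (∫ z in Ω, ρ z * fderiv ℝ (trk u k) z (Z z)) +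
        ∫ z in Ω, trk u k z * fderiv ℝ ρ z (Z z) := by
  have hg : ContDiffOn ℝ 1 (fun z => ρ z * (h z - trk u k z)) Ω := ha.cd.mul (hh.sub (trk_cd hu k))
  obtain ⟨w1, w2⟩ := weak_form ho hZ hg ha.cpt (fun z hz hzK => by rw [ha.zero z hz hzK, zero_mul])
    (fun z hz hz' => by
      filter_upwards [hs.ev hk hz hz'] with y hy
      rw [hy.1]; simp [trk])
  have i1 : IntegrableOn (fun z => ρ z * fderiv ℝ (trk u k) z (Z z)) Ω := by
    simpa using ha.int_core ho hZ.cd.continuousOn hu hs hk (f := fun _ => 1) continuousOn_const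
  have i2 : IntegrableOn (fun z => trk u k z * fderiv ℝ ρ z (Z z)) Ω :=
    ha.int_gen ho hZ.cd.continuousOn hZb (trk_cd hu k).continuousOn (C := 1)
      (fun z _ => trunc_abs_le _)
  have e : ∀ z ∈ Ω, fderiv ℝ (fun z => ρ z * (h z - trk u k z)) z (Z z)
      + (ρ z * fderiv ℝ (trk u k) z (Z z) + trk u k z * fderiv ℝ ρ z (Z z))
      = fderiv ℝ (fun z => ρ z * h z) z (Z z) := by
    intro z hz
    rw [fd_mul ho ha.cd (hh.sub (trk_cd hu k)) hz, fd_mul ho ha.cd hh hz,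
      fderiv_fun_sub (diffAt ho hh hz) (diffAt ho (trk_cd hu k) hz), sub_apply]
    ring
  constructor
  · exact (w1.add (i1.add i2)).congr_fun e ho.measurableSet
  · rw [← setIntegral_congr_fun ho.measurableSet e]
    have i3 : IntegrableOn (fun z => ρ z * fderiv ℝ (trk u k) z (Z z)
      + trk u k z * fderiv ℝ ρ z (Z z)) Ω := i1.add i2
    rw [integral_add w1 i3, w2, zero_add]
    exact integral_add i1 i2

lemma norm_sub_le_two {X Y : ℝ × ℝ → ℝ × ℝ} (h1 : ∀ z ∈ Ω, (X z).1 ^ 2 + (X z).2 ^ 2 ≤ 1)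
    (h2 : ∀ z ∈ Ω, (Y z).1 ^ 2 + (Y z).2 ^ 2 ≤ 1) : ∀ z ∈ Ω, ‖X z - Y z‖ ≤ 2 := by
  intro z hz
  have := norm_sub_le (X z) (Y z)
  linarith [norm_le_one_of_sq (h1 z hz), norm_le_one_of_sq (h2 z hz)]

lemma flux_nonneg (ho : IsOpen Ω) (ha : Adm ρ Ω K) {X Y : ℝ × ℝ → ℝ × ℝ} (hf : Fld u X Ω)
    (hY : DivFree Y Ω) (hY1 : ∀ z ∈ Ω, (Y z).1 ^ 2 + (Y z).2 ^ 2 ≤ 1)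
    {h : ℝ × ℝ → ℝ} (hh : ContDiffOn ℝ 1 h Ω) (hs : Sat u h Ω K) :
    0 ≤ ∫ z in Ω, fderiv ℝ (fun z => ρ z * h z) z (X z - Y z) := by
  have hZ := hf.df.sub ho hY
  have hZb := norm_sub_le_two (fun z hz => hf.sq_le hz) hY1
  have l1 := ha.tendsto_zero ho hZ.cd.continuousOn hZb hf.cd
  have l2 := ((lim_C (2 * stpC)).neg.mul_const (∫ z in Ω, ρ z)).add l1
  simp only [neg_zero, zero_mul, add_zero] at l2
  apply le_of_tendsto l2
  refine Eventually.of_forall fun n => ?_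
  rw [(flux_split ho ha hZ hZb hf.cd hh hs (nat_pos' n)).2]
  refine add_le_add ?_ le_rfl
  rw [← integral_const_mul]
  have i1 : IntegrableOn (fun z => ρ z * fderiv ℝ (trk u (n + 1)) z (X z - Y z)) Ω := by
    simpa using ha.int_core ho hZ.cd.continuousOn hf.cd hs (nat_pos' n) (f := fun _ => 1)
      continuousOn_const
  apply setIntegral_mono_on ((ha.int_rho ho).const_mul _) i1 ho.measurableSet
  intro z hz
  exact trk_lower ho ha hf hY1 (nat_pos' n) hz

end

section
variable {Ω K : Set (ℝ × ℝ)} {ρ u₁ u₂ : ℝ × ℝ → ℝ} {X₁ X₂ : ℝ × ℝ → ℝ × ℝ}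

/-- both functions blow up with the same sign at the boundary points in `K` -/
def SameBlow (u₁ u₂ : ℝ × ℝ → ℝ) (Ω K : Set (ℝ × ℝ)) : Prop :=
  ∀ z ∈ K, z ∉ Ω →
    (Tendsto u₁ (𝓝[Ω] z) atTop ∧ Tendsto u₂ (𝓝[Ω] z) atTop) ∨
    (Tendsto u₁ (𝓝[Ω] z) atBot ∧ Tendsto u₂ (𝓝[Ω] z) atBot)

lemma SameBlow.sat1 (hs : SameBlow u₁ u₂ Ω K) : Sat u₁ (trk u₁ 1) Ω K := by
  intro z hz hz'
  rcases hs z hz hz' with ⟨h1, -⟩ | ⟨h1, -⟩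
  · left
    refine ⟨h1, ?_⟩
    filter_upwards [h1.eventually_ge_atTop 1] with y hy
    exact trunc_top (by simpa using hy)
  · right
    refine ⟨h1, ?_⟩
    filter_upwards [h1.eventually_le_atBot (-1)] with y hy
    exact trunc_bot (by simpa using hy)

lemma SameBlow.sat2 (hs : SameBlow u₁ u₂ Ω K) : Sat u₂ (trk u₁ 1) Ω K := by
  intro z hz hz'
  rcases hs z hz hz' with ⟨h1, h2⟩ | ⟨h1, h2⟩
  · left
    refine ⟨h2, ?_⟩
    filter_upwards [h1.eventually_ge_atTop 1] with y hy
    exact trunc_top (by simpa using hy)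
  · right
    refine ⟨h2, ?_⟩
    filter_upwards [h1.eventually_le_atBot (-1)] with y hy
    exact trunc_bot (by simpa using hy)

lemma flux_zero (ho : IsOpen Ω) (ha : Adm ρ Ω K) (h₁ : Fld u₁ X₁ Ω) (h₂ : Fld u₂ X₂ Ω)
    (hs : SameBlow u₁ u₂ Ω K) :
    ∫ z in Ω, fderiv ℝ (fun z => ρ z * trk u₁ 1 z) z (X₁ z - X₂ z) = 0 := by
  have a1 := flux_nonneg ho ha h₁ h₂.df (fun z hz => h₂.sq_le hz) (trk_cd h₁.cd 1) hs.sat1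
  have a2 := flux_nonneg ho ha h₂ h₁.df (fun z hz => h₁.sq_le hz) (trk_cd h₁.cd 1) hs.sat2
  have e : ∫ z in Ω, fderiv ℝ (fun z => ρ z * trk u₁ 1 z) z (X₂ z - X₁ z)
      = - ∫ z in Ω, fderiv ℝ (fun z => ρ z * trk u₁ 1 z) z (X₁ z - X₂ z) := by
    rw [← integral_neg]
    congr 1; ext z
    rw [← map_neg, neg_sub]
  rw [e] at a2
  linarith

lemma layer_tendsto (ho : IsOpen Ω) (ha : Adm ρ Ω K) (h₁ : Fld u₁ X₁ Ω) (h₂ : Fld u₂ X₂ Ω)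
    (hs : SameBlow u₁ u₂ Ω K) :
    Tendsto (fun n : ℕ => ∫ z in Ω, |ρ z * fderiv ℝ (trk u₁ (n + 1)) z (X₁ z - X₂ z)|)
      atTop (𝓝 0) := by
  have hZ := h₁.df.sub ho h₂.df
  have hZb := norm_sub_le_two (fun z hz => h₁.sq_le hz) (fun z hz => h₂.sq_le hz)
  have l1 := ha.tendsto_zero ho hZ.cd.continuousOn hZb h₁.cd
  have l2 := (l1.neg).add ((lim_C (4 * stpC)).mul_const (∫ z in Ω, ρ z))
  simp only [neg_zero, zero_mul, add_zero] at l2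
  refine tendsto_of_tendsto_of_tendsto_of_le_of_le tendsto_const_nhds l2
    (fun n => integral_nonneg (fun z => abs_nonneg _)) (fun n => ?_)
  have hfs := (flux_split ho ha hZ hZb h₁.cd (trk_cd h₁.cd 1) hs.sat1 (nat_pos' n)).2
  rw [flux_zero ho ha h₁ h₂ hs] at hfs
  have i1 : IntegrableOn (fun z => ρ z * fderiv ℝ (trk u₁ (n + 1)) z (X₁ z - X₂ z)) Ω := by
    simpa using ha.int_core ho hZ.cd.continuousOn h₁.cd hs.sat1 (nat_pos' n) (f := fun _ => 1)
      continuousOn_const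
  have e1 : -(∫ z in Ω, trk u₁ (n + 1) z * fderiv ℝ ρ z (X₁ z - X₂ z)) =
      ∫ z in Ω, ρ z * fderiv ℝ (trk u₁ (n + 1)) z (X₁ z - X₂ z) := by linarith
  rw [e1, ← integral_const_mul, ← integral_add i1 ((ha.int_rho ho).const_mul _)]
  apply setIntegral_mono_on i1.abs (i1.add ((ha.int_rho ho).const_mul _)) ho.measurableSet
  intro z hz
  have hl := trk_lower ho ha h₁ (fun z hz => h₂.sq_le hz) (nat_pos' n) hz
  have hp : 0 ≤ 2 * stpC / (n + 1) * ρ z :=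
    mul_nonneg (div_nonneg (by linarith [stpC_pos]) (nat_pos' n).le) (ha.nonneg z hz)
  have h4 : 4 * stpC / (n + 1) * ρ z = 2 * (2 * stpC / (n + 1) * ρ z) := by ring
  change |ρ z * fderiv ℝ (trk u₁ (n + 1)) z (X₁ z - X₂ z)| ≤
    ρ z * fderiv ℝ (trk u₁ (n + 1)) z (X₁ z - X₂ z) + 4 * stpC / (n + 1) * ρ z
  rw [h4, abs_le]
  constructor <;> linarith

/-- the energy density -/
noncomputable def enr (u₁ u₂ : ℝ × ℝ → ℝ) (X₁ X₂ : ℝ × ℝ → ℝ × ℝ) (z : ℝ × ℝ) : ℝ :=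
  (1 + (u₁ z - u₂ z) ^ 2)⁻¹ * (fderiv ℝ u₁ z - fderiv ℝ u₂ z) (X₁ z - X₂ z)

lemma enr_nonneg (h₁ : Fld u₁ X₁ Ω) (h₂ : Fld u₂ X₂ Ω) {z : ℝ × ℝ} (hz : z ∈ Ω) :
    0 ≤ enr u₁ u₂ X₁ X₂ z :=
  mul_nonneg (by positivity) (h₁.mono h₂ hz).1

lemma enr_cont (ho : IsOpen Ω) (h₁ : Fld u₁ X₁ Ω) (h₂ : Fld u₂ X₂ Ω) :
    ContinuousOn (enr u₁ u₂ X₁ X₂) Ω := by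
  unfold enr
  apply ContinuousOn.mul
  · apply ContinuousOn.inv₀
    · exact continuousOn_const.add ((h₁.cd.continuousOn.sub h₂.cd.continuousOn).pow 2)
    · intro z _; positivity
  · exact ((h₁.cd.continuousOn_fderiv_of_isOpen ho le_rfl).sub
      (h₂.cd.continuousOn_fderiv_of_isOpen ho le_rfl)).clm_apply
      (h₁.df.sub ho h₂.df).cd.continuousOn

lemma energy_le (ho : IsOpen Ω) (ha : Adm ρ Ω K) (h₁ : Fld u₁ X₁ Ω) (h₂ : Fld u₂ X₂ Ω)
    (hs : SameBlow u₁ u₂ Ω K) {B : Set (ℝ × ℝ)} (hB : IsCompact B) (hBΩ : B ⊆ Ω)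
    (hρB : ∀ z ∈ B, ρ z = 1) :
    ∫ z in B, enr u₁ u₂ X₁ X₂ z ≤ (π / 2) * ∫ z in Ω, |fderiv ℝ ρ z (X₁ z - X₂ z)| := by
  have hZ := h₁.df.sub ho h₂.df
  have hZb := norm_sub_le_two (fun z hz => h₁.sq_le hz) (fun z hz => h₂.sq_le hz)
  have hZc := hZ.cd.continuousOn
  have hw : ContDiffOn ℝ 1 (fun z => arctan (u₁ z - u₂ z)) Ω :=
    (Real.contDiff_arctan).comp_contDiffOn (h₁.cd.sub h₂.cd)
  have iρ : IntegrableOn (fun z => |fderiv ℝ ρ z (X₁ z - X₂ z)|) Ω := by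
    have := ha.int_gen ho hZc hZb (f := fun _ => 1) continuousOn_const (C := 1) (by simp)
    simp only [one_mul] at this
    exact this.abs
  have step : ∀ n : ℕ, ∫ z in B, (1 - (trk u₁ (n + 1) z) ^ 2) * enr u₁ u₂ X₁ X₂ z ≤
      ((π / 2) * ∫ z in Ω, |fderiv ℝ ρ z (X₁ z - X₂ z)|) +
      π * ∫ z in Ω, |ρ z * fderiv ℝ (trk u₁ (n + 1)) z (X₁ z - X₂ z)| := by
    intro n
    have hk := nat_pos' n
    set f := trk u₁ ((n:ℝ) + 1) with hf
    have hfc : ContDiffOn ℝ 1 f Ω := trk_cd h₁.cd _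
    have hfb : ∀ z, |f z| ≤ 1 := fun z => trunc_abs_le _
    have hf2 : ∀ z, 0 ≤ 1 - f z ^ 2 ∧ 1 - f z ^ 2 ≤ 1 := fun z => by
      have := abs_le.1 (hfb z)
      constructor <;> nlinarith [sq_nonneg (f z)]
    have hcut : ContDiffOn ℝ 1 (fun z => ρ z * (1 - f z ^ 2)) Ω :=
      ha.cd.mul (contDiffOn_const.sub (hfc.pow 2))
    have hz0 : ∀ z ∈ Ω, z ∉ K → ρ z * (1 - f z ^ 2) = 0 := fun z hz hzK => by
      rw [ha.zero z hz hzK, zero_mul]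
    have hzb : ∀ z ∈ K, z ∉ Ω → ∀ᶠ y in 𝓝[Ω] z, ρ y * (1 - f y ^ 2) = 0 := by
      intro z hz hz'
      filter_upwards [hs.sat1.ev hk hz hz', hs.sat1.ev one_pos hz hz'] with y hy hy'
      have : |f y| = 1 := by rw [hf]; unfold trk; rw [← hy.1]; exact hy.2.2
      rw [← sq_abs, this]; simp
    obtain ⟨w1, w2⟩ := weak_form ho hZ (hcut.mul hw) ha.cpt
      (fun z hz hzK => by simp [hz0 z hz hzK])
      (fun z hz hz' => by filter_upwards [hzb z hz hz'] with y hy; simp [hy])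
    have i1 : IntegrableOn (fun z => ρ z * (1 - f z ^ 2) * enr u₁ u₂ X₁ X₂ z) Ω :=
      integrableOn_core ho ha.cpt (hcut.continuousOn.mul (enr_cont ho h₁ h₂)) hz0 hzb
        (fun z _ h => by simp [h])
    have i2 : IntegrableOn (fun z => |ρ z * fderiv ℝ f z (X₁ z - X₂ z)|) Ω := by
      have := ha.int_core ho hZc h₁.cd hs.sat1 hk (f := fun _ => 1) continuousOn_const
      simp only [one_mul] at this
      exact this.abs
    have pw : ∀ z ∈ Ω, ρ z * (1 - f z ^ 2) * enr u₁ u₂ X₁ X₂ z ≤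
        fderiv ℝ (fun z => ρ z * (1 - f z ^ 2) * arctan (u₁ z - u₂ z)) z (X₁ z - X₂ z) +
        ((π / 2) * |fderiv ℝ ρ z (X₁ z - X₂ z)| +
          π * |ρ z * fderiv ℝ f z (X₁ z - X₂ z)|) := by
      intro z hz
      rw [fd_mul ho hcut hw hz, fd_mul ho ha.cd (contDiffOn_const.sub (hfc.pow 2)) hz]
      have e1 : fderiv ℝ (fun z => arctan (u₁ z - u₂ z)) z (X₁ z - X₂ z)
          = enr u₁ u₂ X₁ X₂ z := by
        have hd := ((diffAt ho h₁.cd hz).hasFDerivAt.fun_sub (diffAt ho h₂.cd hz).hasFDerivAt).arctan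
        rw [hd.fderiv]
        simp [enr]
      have e2 : fderiv ℝ (fun z => 1 - f z ^ 2) z (X₁ z - X₂ z)
          = -(2 * f z * fderiv ℝ f z (X₁ z - X₂ z)) := by
        have hd := ((diffAt ho hfc hz).hasFDerivAt.pow 2).const_sub 1
        have : fderiv ℝ (fun z => 1 - f z ^ 2) z = _ := hd.fderiv
        rw [this]
        simp
      rw [e1, e2]
      set a := fderiv ℝ ρ z (X₁ z - X₂ z)
      set b := fderiv ℝ f z (X₁ z - X₂ z)
      set φ := arctan (u₁ z - u₂ z)
      have hφ : |φ| ≤ π / 2 := abs_le.2 ⟨(neg_pi_div_two_lt_arctan _).le, (arctan_lt_pi_div_two _).le⟩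
      have t1 : |φ * (1 - f z ^ 2) * a| ≤ (π / 2) * |a| := by
        rw [abs_mul, abs_mul]
        apply mul_le_mul_of_nonneg_right _ (abs_nonneg _)
        rw [abs_of_nonneg (hf2 z).1]
        nlinarith [(hf2 z).2, (hf2 z).1, abs_nonneg φ]
      have t2 : |φ * f z * (ρ z * b)| ≤ (π / 2) * |ρ z * b| := by
        rw [abs_mul, abs_mul]
        apply mul_le_mul_of_nonneg_right _ (abs_nonneg _)
        nlinarith [hfb z, abs_nonneg (f z), abs_nonneg φ]
      have := abs_le.1 t1
      have := abs_le.1 t2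
      nlinarith
    have int1 : ∫ z in Ω, ρ z * (1 - f z ^ 2) * enr u₁ u₂ X₁ X₂ z ≤
        ((π / 2) * ∫ z in Ω, |fderiv ℝ ρ z (X₁ z - X₂ z)|) +
        π * ∫ z in Ω, |ρ z * fderiv ℝ f z (X₁ z - X₂ z)| := by
      have i3 : IntegrableOn (fun z => (π / 2) * |fderiv ℝ ρ z (X₁ z - X₂ z)| +
          π * |ρ z * fderiv ℝ f z (X₁ z - X₂ z)|) Ω := (iρ.const_mul _).add (i2.const_mul _)
      have := setIntegral_mono_on i1 (w1.add i3) ho.measurableSet pw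
      refine this.trans (le_of_eq ?_)
      have e := integral_add (μ := volume.restrict Ω) w1 i3
      have e' := integral_add (μ := volume.restrict Ω) (iρ.const_mul (π / 2)) (i2.const_mul π)
      rw [integral_const_mul, integral_const_mul] at e'
      rw [w2, zero_add] at e
      exact e.trans e'
    refine le_trans ?_ int1
    have e3 : ∫ z in B, (1 - f z ^ 2) * enr u₁ u₂ X₁ X₂ z
        = ∫ z in B, ρ z * (1 - f z ^ 2) * enr u₁ u₂ X₁ X₂ z :=
      setIntegral_congr_fun hB.measurableSet (fun z hz => by
        rw [hρB z hz, one_mul])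
    rw [e3]
    apply setIntegral_mono_set i1
    · filter_upwards [ae_restrict_mem ho.measurableSet] with z hz
      exact mul_nonneg (mul_nonneg (ha.nonneg z hz) (hf2 z).1) (enr_nonneg h₁ h₂ hz)
    · exact hBΩ.eventuallyLE
  have lim1 : Tendsto (fun n : ℕ => ∫ z in B, (1 - (trk u₁ (n + 1) z) ^ 2) * enr u₁ u₂ X₁ X₂ z)
      atTop (𝓝 (∫ z in B, enr u₁ u₂ X₁ X₂ z)) := by
    have hec := (enr_cont ho h₁ h₂).mono hBΩ
    apply tendsto_integral_of_dominated_convergence (fun z => |enr u₁ u₂ X₁ X₂ z|)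
    · intro n
      exact (((continuousOn_const.sub (((trk_cd h₁.cd _).continuousOn.mono hBΩ).pow 2))).mul
        hec).aestronglyMeasurable hB.measurableSet
    · exact (hec.integrableOn_compact hB).abs
    · intro n
      refine Eventually.of_forall fun z => ?_
      rw [Real.norm_eq_abs, abs_mul]
      have h := abs_le.1 (trunc_abs_le (u₁ z / (n + 1)))
      have : |1 - trk u₁ (n + 1) z ^ 2| ≤ 1 := by
        unfold trk
        rw [abs_le]; constructor <;> nlinarith [sq_nonneg (trunc (u₁ z / (n + 1)))]
      nlinarith [abs_nonneg (enr u₁ u₂ X₁ X₂ z)]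
    · refine Eventually.of_forall fun z => ?_
      have h2 := (trunc_contDiff.continuous.tendsto 0).comp (lim_C (u₁ z))
      rw [trunc_zero] at h2
      simpa [trk, Function.comp_def] using
        ((h2.pow 2).const_sub 1).mul_const (enr u₁ u₂ X₁ X₂ z)
  have lim2 := (layer_tendsto ho ha h₁ h₂ hs).const_mul π |>.const_add
    ((π / 2) * ∫ z in Ω, |fderiv ℝ ρ z (X₁ z - X₂ z)|)
  rw [mul_zero, add_zero] at lim2
  exact le_of_tendsto_of_tendsto' lim1 lim2 step

end

lemma pd1_eq {u : ℝ × ℝ → ℝ} {z : ℝ × ℝ} (h : DifferentiableAt ℝ u z) :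
    pd1 u z = fderiv ℝ u z (1, 0) := by
  have h2 : HasDerivAt (fun t : ℝ => (t, z.2)) ((1:ℝ), (0:ℝ)) z.1 :=
    (hasDerivAt_id z.1).prodMk (hasDerivAt_const z.1 z.2)
  have h3 := (show HasFDerivAt u (fderiv ℝ u z) ((fun t : ℝ => (t, z.2)) z.1) from
    h.hasFDerivAt).comp_hasDerivAt z.1 h2
  exact h3.deriv

lemma pd2_eq {u : ℝ × ℝ → ℝ} {z : ℝ × ℝ} (h : DifferentiableAt ℝ u z) :
    pd2 u z = fderiv ℝ u z (0, 1) := by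
  have h2 : HasDerivAt (fun t : ℝ => (z.1, t)) ((0:ℝ), (1:ℝ)) z.2 :=
    (hasDerivAt_const z.2 z.1).prodMk (hasDerivAt_id z.2)
  have h3 := (show HasFDerivAt u (fderiv ℝ u z) ((fun t : ℝ => (z.1, t)) z.2) from
    h.hasFDerivAt).comp_hasDerivAt z.2 h2
  exact h3.deriv

lemma hasFDerivAt_quot {f g : ℝ × ℝ → ℝ} {f' g' : ℝ × ℝ →L[ℝ] ℝ} {z : ℝ × ℝ}
    (hf : HasFDerivAt f f' z) (hg : HasFDerivAt g g' z) (h0 : g z ≠ 0) :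
    HasFDerivAt (fun y => f y / g y) ((g z ^ 2)⁻¹ • (g z • f' - f z • g')) z := by
  have h := hf.fun_mul ((hasDerivAt_inv h0).comp_hasFDerivAt z hg)
  have e : (g z ^ 2)⁻¹ • (g z • f' - f z • g')
      = f z • -(g z ^ 2)⁻¹ • g' + ((fun y => y⁻¹) ∘ g) z • f' := by
    ext v <;> simp <;> field_simp <;> ring
  rw [e]
  exact h

lemma div_alg {p q r s t W : ℝ} (hW : 0 < W) (hW2 : W ^ 2 = 1 + p ^ 2 + q ^ 2)
    (h : (1 + q ^ 2) * r - 2 * p * q * s + (1 + p ^ 2) * t = 0) :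
    (r * W - p * ((p * r + q * s) / W)) / W ^ 2 + (t * W - q * ((p * s + q * t) / W)) / W ^ 2 = 0 := by
  have : (r * W - p * ((p * r + q * s) / W)) / W ^ 2 + (t * W - q * ((p * s + q * t) / W)) / W ^ 2
      = ((1 + q ^ 2) * r - 2 * p * q * s + (1 + p ^ 2) * t) / W ^ 3 := by
    field_simp
    rw [hW2]; ring
  rw [this, h, zero_div]

lemma fld_of_mse {u : ℝ × ℝ → ℝ} {Ω : Set (ℝ × ℝ)} (ho : IsOpen Ω) (h : IsMSE u Ω) :
    Fld u (fun z => (fderiv ℝ u z (1, 0) / √(1 + (fderiv ℝ u z (1, 0)) ^ 2 + (fderiv ℝ u z (0, 1)) ^ 2),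
      fderiv ℝ u z (0, 1) / √(1 + (fderiv ℝ u z (1, 0)) ^ 2 + (fderiv ℝ u z (0, 1)) ^ 2))) Ω := by
  obtain ⟨hu, hm⟩ := h
  have hd : ContDiffOn ℝ 1 (fderiv ℝ u) Ω := hu.fderiv_of_isOpen ho (by norm_num)
  have hp : ContDiffOn ℝ 1 (fun z => fderiv ℝ u z (1, 0)) Ω := hd.clm_apply contDiffOn_const
  have hq : ContDiffOn ℝ 1 (fun z => fderiv ℝ u z (0, 1)) Ω := hd.clm_apply contDiffOn_const
  have hWp : ∀ z, 0 < 1 + (fderiv ℝ u z (1, 0)) ^ 2 + (fderiv ℝ u z (0, 1)) ^ 2 := fun z => by positivity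
  have hW : ContDiffOn ℝ 1 (fun z => √(1 + (fderiv ℝ u z (1, 0)) ^ 2 + (fderiv ℝ u z (0, 1)) ^ 2)) Ω :=
    ((contDiffOn_const.add (hp.pow 2)).add (hq.pow 2)).sqrt (fun z _ => (hWp z).ne')
  have hWne : ∀ z, √(1 + (fderiv ℝ u z (1, 0)) ^ 2 + (fderiv ℝ u z (0, 1)) ^ 2) ≠ 0 :=
    fun z => (Real.sqrt_pos.2 (hWp z)).ne'
  have hA := hp.div hW (fun z _ => hWne z)
  have hB := hq.div hW (fun z _ => hWne z)
  refine ⟨hu.of_le (by norm_num), ⟨hA.prodMk hB, fun z hz => ?_⟩, fun z _ => rfl, fun z _ => rfl⟩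
  have dA := (hA.contDiffAt (ho.mem_nhds hz)).differentiableAt one_ne_zero
  have dB := (hB.contDiffAt (ho.mem_nhds hz)).differentiableAt one_ne_zero
  have dp := (hp.contDiffAt (ho.mem_nhds hz)).differentiableAt one_ne_zero
  have dq := (hq.contDiffAt (ho.mem_nhds hz)).differentiableAt one_ne_zero
  have dd := (hd.contDiffAt (ho.mem_nhds hz)).differentiableAt one_ne_zero
  have hud : ∀ y ∈ Ω, DifferentiableAt ℝ u y := fun y hy =>
    (hu.contDiffAt (ho.mem_nhds hy)).differentiableAt two_ne_zero
  -- second partials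
  have ep : pd1 u =ᶠ[𝓝 z] fun y => fderiv ℝ u y (1, 0) := by
    filter_upwards [ho.mem_nhds hz] with y hy using pd1_eq (hud y hy)
  have eq : pd2 u =ᶠ[𝓝 z] fun y => fderiv ℝ u y (0, 1) := by
    filter_upwards [ho.mem_nhds hz] with y hy using pd2_eq (hud y hy)
  have m := hm z hz
  rw [pd1_eq (ep.differentiableAt_iff.2 dp), pd2_eq (ep.differentiableAt_iff.2 dp),
    pd2_eq (eq.differentiableAt_iff.2 dq), ep.fderiv_eq, eq.fderiv_eq, ep.eq_of_nhds,
    eq.eq_of_nhds] at m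
  have sym : fderiv ℝ (fun y => fderiv ℝ u y (1, 0)) z (0, 1)
      = fderiv ℝ (fun y => fderiv ℝ u y (0, 1)) z (1, 0) := by
    have e1 : ∀ v : ℝ × ℝ, ∀ w, fderiv ℝ (fun y => fderiv ℝ u y v) z w = fderiv ℝ (fderiv ℝ u) z w v := by
      intro v w
      rw [fderiv_clm_apply dd (differentiableAt_const v)]
      simp
    rw [e1, e1]
    have := (hu.contDiffAt (ho.mem_nhds hz)).isSymmSndFDerivAt (by simp)
    exact this.eq _ _
  have hpd := dp.hasFDerivAt
  have hqd := dq.hasFDerivAt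
  have hWd := (((hpd.pow 2).const_add 1).fun_add (hqd.pow 2)).sqrt (hWp z).ne'
  have hAd := hasFDerivAt_quot hpd hWd (hWne z)
  have hBd := hasFDerivAt_quot hqd hWd (hWne z)
  have := (hAd.prodMk hBd).fderiv
  rw [this]
  have hpos := Real.sqrt_pos.2 (hWp z)
  have hsq := Real.sq_sqrt (hWp z).le
  have fin := div_alg hpos hsq m
  refine Eq.trans ?_ fin
  simp only [ContinuousLinearMap.prod_apply, ContinuousLinearMap.smul_apply, ContinuousLinearMap.sub_apply,
    ContinuousLinearMap.add_apply, smul_eq_mul]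
  rw [← sym]
  field_simp
  simp
  ring

/-- an orthonormal frame of the plane -/
structure Frame (τ ν : ℝ × ℝ) : Prop where
  tt : dotp τ τ = 1
  nn : dotp ν ν = 1
  tn : dotp τ ν = 0

lemma dotp_cont (n p : ℝ × ℝ) : Continuous (fun z : ℝ × ℝ => dotp (z - p) n) := by
  unfold dotp; fun_prop

lemma Frame.decomp {τ ν : ℝ × ℝ} (h : Frame τ ν) (v : ℝ × ℝ) :
    v = dotp v τ • τ + dotp v ν • ν := by
  obtain ⟨h1, h2, h3⟩ := h
  unfold dotp at *
  set c := τ.1 * ν.2 - τ.2 * ν.1 with hc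
  have e1 : τ.1 = c * ν.2 := by rw [hc]; linear_combination (-τ.1) * h2 + ν.1 * h3
  have e2 : τ.2 = - (c * ν.1) := by rw [hc]; linear_combination (-τ.2) * h2 + ν.2 * h3
  have ec : c ^ 2 = 1 := by
    have := h1; rw [e1, e2] at this; linear_combination this - c ^ 2 * h2
  ext
  · simp
    rw [e1, e2]
    linear_combination (-v.1) * h2 - ν.2 * (v.1 * ν.2 - v.2 * ν.1) * ec
  · simp
    rw [e1, e2]
    linear_combination (-v.2) * h2 + ν.1 * (v.1 * ν.2 - v.2 * ν.1) * ec

/-- length of an edge -/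
noncomputable def ell (P : ℕ → ℝ × ℝ) (i : ℕ) : ℝ := len (P (i + 1) - P i)

/-- unit tangent of an edge -/
noncomputable def tau (P : ℕ → ℝ × ℝ) (i : ℕ) : ℝ × ℝ := (ell P i)⁻¹ • (P (i + 1) - P i)

/-- the open strip in coordinates -/
def strU (p τ ν : ℝ × ℝ) (ℓ : ℝ) : Set (ℝ × ℝ) :=
  {z | 0 < dotp (z - p) τ ∧ dotp (z - p) τ < ℓ ∧ 0 < dotp (z - p) ν}

lemma strU_open (p τ ν : ℝ × ℝ) (ℓ : ℝ) : IsOpen (strU p τ ν ℓ) :=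
  (isOpen_lt continuous_const (dotp_cont τ p)).inter
    ((isOpen_lt (dotp_cont τ p) continuous_const).inter (isOpen_lt continuous_const (dotp_cont ν p)))

lemma len_sq (v : ℝ × ℝ) : len v ^ 2 = dotp v v := by
  unfold len dotp; rw [Real.sq_sqrt (by positivity)]; ring

lemma len_pos {v : ℝ × ℝ} (h : v ≠ 0) : 0 < len v := by
  unfold len
  apply Real.sqrt_pos.2
  by_contra hc
  apply h
  have h1 : v.1 ^ 2 = 0 := by nlinarith [sq_nonneg v.1, sq_nonneg v.2]
  have h2 : v.2 ^ 2 = 0 := by nlinarith [sq_nonneg v.1, sq_nonneg v.2]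
  ext
  · simpa using h1
  · simpa using h2

section
variable {r : ℕ} {P ν : ℕ → ℝ × ℝ}

lemma Pmod (h : IsConvexPolygonData r P ν) (i : ℕ) : P (i % r) = P i :=
  Function.Periodic.map_mod_nat h.periodicP i

lemma νmod (h : IsConvexPolygonData r P ν) (i : ℕ) : ν (i % r) = ν i :=
  Function.Periodic.map_mod_nat h.periodicν i

lemma Pmod1 (h : IsConvexPolygonData r P ν) (i : ℕ) : P (i % r + 1) = P (i + 1) := by
  rw [← Pmod h (i % r + 1), ← Pmod h (i + 1), Nat.mod_add_mod]

lemma modlt (h : IsConvexPolygonData r P ν) (i : ℕ) : i % r < r :=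
  Nat.mod_lt _ (by have := h.three_le; omega)

lemma P_ne (h : IsConvexPolygonData r P ν) (i : ℕ) : P (i + 1) - P i ≠ 0 := by
  intro h0
  have h1 : P ((i + 1) % r) = P (i % r) := by
    rw [Pmod h, Pmod h]; exact sub_eq_zero.1 h0
  have h2 := h.inj (modlt h _) (modlt h _) h1
  have h3 := h.three_le
  have h4 : (i % r + 1) % r = i % r := by rw [Nat.mod_add_mod]; exact h2
  have h5 := modlt h i
  rcases lt_or_ge (i % r + 1) r with h6 | h6
  · rw [Nat.mod_eq_of_lt h6] at h4; omega
  · have : i % r + 1 = r := by omega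
    rw [this, Nat.mod_self] at h4; omega

lemma ell_pos (h : IsConvexPolygonData r P ν) (i : ℕ) : 0 < ell P i := len_pos (P_ne h i)

lemma P_succ (h : IsConvexPolygonData r P ν) (i : ℕ) : P (i + 1) = P i + ell P i • tau P i := by
  unfold tau
  rw [smul_smul, mul_inv_cancel₀ (ell_pos h i).ne', one_smul]; abel

lemma dotp_smul_left (a : ℝ) (v w : ℝ × ℝ) : dotp (a • v) w = a * dotp v w := by
  unfold dotp; simp; ring

lemma dotp_smul_right (a : ℝ) (v w : ℝ × ℝ) : dotp v (a • w) = a * dotp v w := by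
  unfold dotp; simp; ring

lemma dotp_add_left (a v w : ℝ × ℝ) : dotp (a + v) w = dotp a w + dotp v w := by
  unfold dotp; simp; ring

lemma dotp_sub_left (a v w : ℝ × ℝ) : dotp (a - v) w = dotp a w - dotp v w := by
  unfold dotp; simp; ring

lemma dotp_comm (v w : ℝ × ℝ) : dotp v w = dotp w v := by
  unfold dotp; ring

lemma frame (h : IsConvexPolygonData r P ν) (i : ℕ) : Frame (tau P i) (ν i) := by
  refine ⟨?_, ?_, ?_⟩
  · unfold tau
    rw [dotp_smul_left, dotp_smul_right, ← len_sq]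
    have := ell_pos h i
    change (ell P i)⁻¹ * ((ell P i)⁻¹ * ell P i ^ 2) = 1
    field_simp
  · rw [← len_sq, h.unit]; norm_num
  · unfold tau
    rw [dotp_smul_left, dotp_comm, h.orth, mul_zero]

lemma Frame.dot1 {τ ν : ℝ × ℝ} (h : Frame τ ν) (a b : ℝ) : dotp (a • τ + b • ν) τ = a := by
  rw [dotp_add_left, dotp_smul_left, dotp_smul_left, h.tt, dotp_comm ν τ, h.tn]; ring

lemma Frame.dot2 {τ ν : ℝ × ℝ} (h : Frame τ ν) (a b : ℝ) : dotp (a • τ + b • ν) ν = b := by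
  rw [dotp_add_left, dotp_smul_left, dotp_smul_left, h.nn, h.tn]; ring

lemma halfStrip_eq (h : IsConvexPolygonData r P ν) (i : ℕ) :
    halfStrip (P i) (P (i + 1)) (ν i) =
      {z | 0 ≤ dotp (z - P i) (tau P i) ∧ dotp (z - P i) (tau P i) ≤ ell P i ∧
        0 ≤ dotp (z - P i) (ν i)} := by
  have hf := frame h i
  have hl := ell_pos h i
  ext z
  constructor
  · rintro ⟨x, hx, t, ht, rfl⟩
    rw [segment_eq_image'] at hx
    obtain ⟨θ, ⟨h0, h1⟩, rfl⟩ := hx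
    have e : P i + θ • (P (i + 1) - P i) + t • ν i - P i
        = (θ * ell P i) • tau P i + t • ν i := by
      rw [P_succ h, mul_smul]; abel_nf
    simp only [mem_setOf_eq]
    rw [e, hf.dot1, hf.dot2]
    refine ⟨by positivity, by nlinarith, ht⟩
  · rintro ⟨h1, h2, h3⟩
    refine ⟨P i + dotp (z - P i) (tau P i) • tau P i, ?_, dotp (z - P i) (ν i), h3, ?_⟩
    · rw [segment_eq_image']
      refine ⟨dotp (z - P i) (tau P i) / ell P i, ⟨by positivity, by rw [div_le_one hl]; exact h2⟩, ?_⟩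
      rw [P_succ h]
      simp only [add_sub_cancel_left, smul_smul]
      rw [div_mul_cancel₀ _ hl.ne']
    · have := hf.decomp (z - P i)
      rw [add_assoc, ← this]; abel

lemma strip_sub (h : IsConvexPolygonData r P ν) (i : ℕ) :
    halfStrip (P i) (P (i + 1)) (ν i) ⊆ OmegaV r P ν := by
  intro z hz
  right
  rw [mem_iUnion₂]
  refine ⟨i % r, modlt h i, ?_⟩
  rw [Pmod h, Pmod1 h, νmod h]; exact hz

lemma hull_compact : IsCompact (polyHull r P) :=
  ((Set.finite_Iio r).image P).isCompact_convexHull (𝕜 := ℝ)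

lemma omega_closed (h : IsConvexPolygonData r P ν) : IsClosed (OmegaV r P ν) := by
  apply hull_compact.isClosed.union
  apply Set.Finite.isClosed_biUnion (Set.finite_Iio r)
  intro i _
  rw [halfStrip_eq h]
  exact (isClosed_le continuous_const (dotp_cont _ _)).inter
    ((isClosed_le (dotp_cont _ _) continuous_const).inter
      (isClosed_le continuous_const (dotp_cont _ _)))

lemma strU_sub (h : IsConvexPolygonData r P ν) (i : ℕ) :
    strU (P i) (tau P i) (ν i) (ell P i) ⊆ interior (OmegaV r P ν) := by
  apply interior_maximal _ (strU_open _ _ _ _)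
  refine Subset.trans ?_ (strip_sub h i)
  rw [halfStrip_eq h]
  rintro z ⟨h1, h2, h3⟩
  exact ⟨h1.le, h2.le, h3.le⟩

lemma P_mem (h : IsConvexPolygonData r P ν) (i : ℕ) : P i ∈ polyHull r P := by
  rw [← Pmod h]
  exact subset_convexHull ℝ _ ⟨_, modlt h i, rfl⟩

/-- points on the left side of a strip are in the closure -/
lemma side_left (h : IsConvexPolygonData r P ν) (i : ℕ) {t : ℝ} (ht : 0 < t) :
    P i + t • ν i ∈ closure (interior (OmegaV r P ν)) := by
  have hf := frame h i
  have hl := ell_pos h i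
  have hc : Tendsto (fun s : ℝ => P i + s • tau P i + t • ν i) (𝓝[>] 0) (𝓝 (P i + t • ν i)) := by
    have : Continuous (fun s : ℝ => P i + s • tau P i + t • ν i) := by fun_prop
    have := this.tendsto 0
    simp only [zero_smul, add_zero] at this
    exact this.mono_left nhdsWithin_le_nhds
  apply mem_closure_of_tendsto hc
  filter_upwards [Ioo_mem_nhdsGT hl] with s hs
  apply strU_sub h i
  have e : P i + s • tau P i + t • ν i - P i = s • tau P i + t • ν i := by abel
  unfold strU
  simp only [mem_setOf_eq]
  rw [e, hf.dot1, hf.dot2]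
  exact ⟨hs.1, hs.2, ht⟩

lemma hull_convex : Convex ℝ (polyHull r P) := convex_convexHull ℝ _

lemma hull_closure (h : IsConvexPolygonData r P ν) :
    polyHull r P ⊆ closure (interior (polyHull r P)) := by
  rw [hull_convex.closure_interior_eq_closure_of_nonempty_interior h.interior_nonempty]
  exact subset_closure

lemma outward_strict (h : IsConvexPolygonData r P ν) (i : ℕ) {c : ℝ × ℝ}
    (hc : c ∈ interior (polyHull r P)) : dotp (c - P i) (ν i) < 0 := by
  have hf := frame h i
  have hcont : Tendsto (fun s : ℝ => c + s • ν i) (𝓝[>] 0) (𝓝 c) := by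
    have : Continuous (fun s : ℝ => c + s • ν i) := by fun_prop
    have := this.tendsto 0
    simp only [zero_smul, add_zero] at this
    exact this.mono_left nhdsWithin_le_nhds
  have hev := hcont.eventually (isOpen_interior.mem_nhds hc)
  obtain ⟨s, hs, hs0⟩ := (hev.and self_mem_nhdsWithin).exists
  have := h.outward i _ (interior_subset hs)
  have e : c + s • ν i - P i = (c - P i) + s • ν i := by abel
  rw [e, dotp_add_left, dotp_smul_left, hf.nn] at this
  have hs0' : 0 < s := hs0
  linarith

end

section
variable {r : ℕ} {P ν : ℕ → ℝ × ℝ}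

lemma cross_ne (h : IsConvexPolygonData r P ν) (hne : ∀ k, ν k ≠ ν (k + 1)) (k : ℕ) :
    (ν k).1 * (ν (k + 1)).2 - (ν k).2 * (ν (k + 1)).1 ≠ 0 := by
  intro h0
  have u1 := (frame h k).nn
  have u2 := (frame h (k + 1)).nn
  obtain ⟨c, hc⟩ := h.interior_nonempty
  have o1 := outward_strict h k hc
  have o2 := outward_strict h (k + 1) hc
  have o3 := h.orth k
  set d := dotp (ν k) (ν (k + 1)) with hd
  have e1 : (ν (k+1)).1 = d * (ν k).1 := by
    rw [hd]; unfold dotp at *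
    linear_combination (-(ν (k+1)).1) * u1 - (ν k).2 * h0
  have e2 : (ν (k+1)).2 = d * (ν k).2 := by
    rw [hd]; unfold dotp at *
    linear_combination (-(ν (k+1)).2) * u1 + (ν k).1 * h0
  have hd2 : d ^ 2 = 1 := by
    have : dotp (ν (k+1)) (ν (k+1)) = d ^ 2 * dotp (ν k) (ν k) := by
      unfold dotp; rw [e1, e2]; ring
    rw [u1, u2] at this; linarith
  rcases mul_self_eq_one_iff.1 (by rw [← sq]; exact hd2 : d * d = 1) with hh | hh
  · apply hne k
    ext
    · rw [e1, hh, one_mul]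
    · rw [e2, hh, one_mul]
  · have e3 : dotp (c - P (k + 1)) (ν (k + 1)) = - dotp (c - P k) (ν k)
        + dotp (ν k) (P (k + 1) - P k) := by
      unfold dotp; rw [e1, e2, hh]; simp; ring
    rw [o3] at e3; linarith

lemma zero_of_cross {a b v : ℝ × ℝ} (h : a.1 * b.2 - a.2 * b.1 ≠ 0) (h1 : dotp v a = 0)
    (h2 : dotp v b = 0) : v = 0 := by
  unfold dotp at *
  have e1 : (a.1 * b.2 - a.2 * b.1) * v.1 = 0 := by linear_combination b.2 * h1 - a.2 * h2
  have e2 : (a.1 * b.2 - a.2 * b.1) * v.2 = 0 := by linear_combination a.1 * h2 - b.1 * h1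
  ext
  · exact (mul_eq_zero.1 e1).resolve_left h
  · exact (mul_eq_zero.1 e2).resolve_left h

lemma cone (h : IsConvexPolygonData r P ν) (hne : ∀ k, ν k ≠ ν (k + 1)) (k : ℕ) {x : ℝ × ℝ}
    (hx : x ∈ polyHull r P) : ∃ α β : ℝ, 0 ≤ α ∧ 0 ≤ β ∧
      x - P (k + 1) = α • (P (k + 2) - P (k + 1)) + β • (P k - P (k + 1)) ∧
      (dotp (x - P (k + 1)) (ν k) = 0 → α = 0) ∧
      (dotp (x - P (k + 1)) (ν (k + 1)) = 0 → β = 0) := by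
  have hcr := cross_ne h hne k
  have sh : ∀ y, dotp (y - P (k + 1)) (ν k) = dotp (y - P k) (ν k) := by
    intro y
    have := h.orth k
    unfold dotp at *
    simp at *
    linarith
  have a0 : dotp (P (k + 2) - P (k + 1)) (ν (k + 1)) = 0 := by
    rw [dotp_comm]; exact h.orth (k + 1)
  have b0 : dotp (P k - P (k + 1)) (ν k) = 0 := by
    rw [sh]; simp [dotp]
  have a1 : dotp (P (k + 2) - P (k + 1)) (ν k) < 0 := by
    rcases (h.outward k _ (P_mem h (k + 2))).lt_or_eq with h1 | h1
    · rw [sh]; exact h1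
    · exfalso
      exact P_ne h (k + 1) (zero_of_cross hcr (by rw [sh]; exact h1) a0)
  have b1 : dotp (P k - P (k + 1)) (ν (k + 1)) < 0 := by
    rcases (h.outward (k + 1) _ (P_mem h k)).lt_or_eq with h1 | h1
    · exact h1
    · exfalso
      have := zero_of_cross hcr b0 h1
      apply P_ne h k
      rw [← neg_sub, this, neg_zero]
  have x1 : dotp (x - P (k + 1)) (ν k) ≤ 0 := by rw [sh]; exact h.outward k x hx
  have x2 := h.outward (k + 1) x hx
  refine ⟨dotp (x - P (k + 1)) (ν k) / dotp (P (k + 2) - P (k + 1)) (ν k),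
    dotp (x - P (k + 1)) (ν (k + 1)) / dotp (P k - P (k + 1)) (ν (k + 1)),
    div_nonneg_of_nonpos x1 a1.le, div_nonneg_of_nonpos x2 b1.le, ?_, ?_, ?_⟩
  · rw [← sub_eq_zero]
    apply zero_of_cross hcr
    · rw [dotp_sub_left, dotp_add_left, dotp_smul_left, dotp_smul_left, b0,
        div_mul_cancel₀ _ a1.ne]; ring
    · rw [dotp_sub_left, dotp_add_left, dotp_smul_left, dotp_smul_left, a0,
        div_mul_cancel₀ _ b1.ne]; ring
  · intro h0; rw [h0, zero_div]
  · intro h0; rw [h0, zero_div]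

/-- a hull point on a supporting line is on the edge (shifted index) -/
lemma on_edge (h : IsConvexPolygonData r P ν) (hne : ∀ k, ν k ≠ ν (k + 1)) (k : ℕ) {x : ℝ × ℝ}
    (hx : x ∈ polyHull r P) (h0 : dotp (x - P (k + 1)) (ν (k + 1)) = 0) :
    x ∈ segment ℝ (P (k + 1)) (P (k + 2)) := by
  obtain ⟨α, β, ha, -, e, -, hb⟩ := cone h hne k hx
  rw [hb h0, zero_smul, add_zero] at e
  obtain ⟨α', β', -, hb', e', ha', -⟩ := cone h hne (k + 1) hx
  have h0' : dotp (x - P (k + 1 + 1)) (ν (k + 1)) = 0 := by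
    have := h.orth (k + 1)
    unfold dotp at *
    simp at *
    linarith
  rw [ha' h0', zero_smul, zero_add] at e'
  have hne' := P_ne h (k + 1)
  have e2 : (α - (1 - β')) • (P (k + 1 + 1) - P (k + 1)) = 0 := by
    have : x = P (k + 1) + α • (P (k + 1 + 1) - P (k + 1)) := by rw [← e]; abel
    have h2 : x = P (k + 1 + 1) + β' • (P (k + 1) - P (k + 1 + 1)) := by rw [← e']; abel
    have h3 := this.symm.trans h2
    rw [← sub_eq_zero] at h3
    rw [← h3]; module
  have e3 := (smul_eq_zero.1 e2).resolve_right hne'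
  rw [segment_eq_image']
  exact ⟨α, ⟨ha, by linarith⟩, by simp only; rw [← e]; simp⟩

lemma hull_cases (h : IsConvexPolygonData r P ν) (hne : ∀ k, ν k ≠ ν (k + 1)) {z : ℝ × ℝ}
    (hz : z ∈ polyHull r P) :
    z ∈ interior (polyHull r P) ∨ ∃ i, z ∈ segment ℝ (P i) (P (i + 1)) := by
  by_cases hi : z ∈ interior (polyHull r P)
  · exact Or.inl hi
  right
  obtain ⟨f, hf⟩ := geometric_hahn_banach_open_point hull_convex.interior isOpen_interior hi
  have hle : ∀ y ∈ polyHull r P, f y ≤ f z := by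
    intro y hy
    have := hull_closure h hy
    exact closure_minimal (fun w hw => (hf w hw).le : interior (polyHull r P) ⊆ {w | f w ≤ f z})
      (isClosed_le f.continuous continuous_const) this
  obtain ⟨a, -, hmax⟩ : ∃ a, True ∧ f (P a) = f z := by
    by_contra hcon
    push Not at hcon
    have h1 : P '' Set.Iio r ⊆ {w | f w < f z} := by
      rintro _ ⟨j, hj, rfl⟩
      exact lt_of_le_of_ne (hle _ (P_mem h j)) (hcon j trivial)
    have h2 : Convex ℝ {w | f w < f z} := convex_halfSpace_lt f.isBoundedLinearMap.toIsLinearMap _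
    have h3 : f z < f z := convexHull_min h1 h2 hz
    exact lt_irrefl _ h3
  obtain ⟨k, hk⟩ : ∃ k, P (k + 1) = P a :=
    ⟨a + r - 1, by
      have := h.three_le
      rw [← h.periodicP a]; congr 1; omega⟩
  rw [← hk] at hmax
  have hf1 := hle _ (P_mem h k)
  have hf2 := hle _ (P_mem h (k + 2))
  rcases hf2.lt_or_eq with s2 | s2
  · rcases hf1.lt_or_eq with s1 | s1
    · -- vertex
      obtain ⟨α, β, ha, hb, e, -, -⟩ := cone h hne k hz
      have ef := congrArg f e
      simp only [map_sub, map_add, map_smul, smul_eq_mul] at ef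
      rw [hmax] at ef
      have hα : α = 0 := by nlinarith
      have hβ : β = 0 := by nlinarith
      rw [hα, hβ] at e
      simp at e
      refine ⟨k, ?_⟩
      rw [sub_eq_zero.1 e]
      exact right_mem_segment ℝ _ _
    · -- edge k
      obtain ⟨α, β, ha, hb, e, -, -⟩ := cone h hne k hz
      have ef := congrArg f e
      simp only [map_sub, map_add, map_smul, smul_eq_mul] at ef
      rw [hmax, s1] at ef
      have hα : α = 0 := by nlinarith
      rw [hα, zero_smul, zero_add] at e
      refine ⟨k + r - 1 + 1, ?_⟩
      have hr := h.three_le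
      apply on_edge h hne _ hz
      have e1 : k + r - 1 + 1 = k + r := by omega
      rw [e1, h.periodicP, h.periodicν]
      have e2 : z - P k = (1 - β) • (P (k + 1) - P k) := by
        have : z = P (k + 1) + β • (P k - P (k + 1)) := by rw [← e]; abel
        rw [this]; module
      rw [e2, dotp_smul_left, dotp_comm, h.orth, mul_zero]
  · -- edge k+1
    refine ⟨k + 1, on_edge h hne k hz ?_⟩
    obtain ⟨α, β, ha, hb, e, -, -⟩ := cone h hne k hz
    have ef := congrArg f e
    simp only [map_sub, map_add, map_smul, smul_eq_mul] at ef
    rw [hmax, s2] at ef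
    have hs1 : f (P k) < f z := by
      apply lt_of_le_of_ne hf1
      intro s1
      obtain ⟨c, hc⟩ := h.interior_nonempty
      obtain ⟨α', β', -, -, e', -, -⟩ := cone h hne k (interior_subset hc)
      have ef' := congrArg f e'
      simp only [map_sub, map_add, map_smul, smul_eq_mul] at ef'
      rw [hmax, s2, s1] at ef'
      have := hf c hc
      linarith
    have hβ : β = 0 := by nlinarith
    rw [e, hβ, zero_smul, add_zero, dotp_smul_left, dotp_comm]
    have := h.orth (k + 1)
    rw [show k + 2 = k + 1 + 1 from rfl, this, mul_zero]

lemma edge_open (h : IsConvexPolygonData r P ν) (i : ℕ) {z : ℝ × ℝ}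
    (h1 : 0 < dotp (z - P i) (tau P i)) (h2 : dotp (z - P i) (tau P i) < ell P i)
    (h3 : dotp (z - P i) (ν i) = 0) : z ∈ interior (OmegaV r P ν) := by
  have hf := frame h i
  have hl := ell_pos h i
  obtain ⟨c, hc⟩ := h.interior_nonempty
  have hct := outward_strict h i hc
  set tc := dotp (c - P i) (ν i) with htc
  set sc := dotp (c - P i) (tau P i) with hsc
  rw [mem_interior_iff_mem_nhds]
  have ct := dotp_cont (ν i) (P i)
  have cs := dotp_cont (tau P i) (P i)
  have cl : Continuous fun y : ℝ × ℝ => dotp (y - P i) (ν i) / tc := ct.div_const _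
  have E1 := (cs.tendsto z).eventually (lt_mem_nhds h1)
  have E2 := (cs.tendsto z).eventually (gt_mem_nhds h2)
  have E3 : ∀ᶠ y in 𝓝 z, dotp (y - P i) (ν i) / tc < 1 :=
    (cl.tendsto z).eventually (gt_mem_nhds (by rw [h3]; simp))
  have E4 : ∀ᶠ y in 𝓝 z, 0 < dotp (y - P i) (tau P i) - dotp (y - P i) (ν i) / tc * sc :=
    ((cs.sub (cl.mul continuous_const)).tendsto z).eventually (lt_mem_nhds (by
      simp [h3, h1]))
  have E5 : ∀ᶠ y in 𝓝 z, dotp (y - P i) (tau P i) - dotp (y - P i) (ν i) / tc * sc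
      - ell P i * (1 - dotp (y - P i) (ν i) / tc) < 0 :=
    (((cs.sub (cl.mul continuous_const)).sub
      (continuous_const.mul (continuous_const.sub cl))).tendsto z).eventually (gt_mem_nhds (by
      simp [h3, h2]))
  filter_upwards [E1, E2, E3, E4, E5] with y y1 y2 y3 y4 y5
  rcases le_or_gt 0 (dotp (y - P i) (ν i)) with ht | ht
  · apply strip_sub h i
    rw [halfStrip_eq h]
    exact ⟨y1.le, y2.le, ht⟩
  · left
    set l := dotp (y - P i) (ν i) / tc with hlam
    have hl0 : 0 < l := div_pos_of_neg_of_neg ht hct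
    have hle : dotp (y - P i) (ν i) = l * tc := by rw [hlam, div_mul_cancel₀ _ hct.ne]
    set θ := (dotp (y - P i) (tau P i) - l * sc) / (ell P i * (1 - l)) with hθ
    have hp : 0 < ell P i * (1 - l) := mul_pos hl (by linarith)
    have hθ0 : 0 ≤ θ := div_nonneg y4.le hp.le
    have hθ1 : θ ≤ 1 := by rw [hθ, div_le_one hp]; linarith
    have hE : P i + θ • (P (i + 1) - P i) ∈ polyHull r P := by
      apply hull_convex.segment_subset (P_mem h i) (P_mem h (i + 1))
      rw [segment_eq_image']
      exact ⟨θ, ⟨hθ0, hθ1⟩, rfl⟩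
    have := hull_convex hE (interior_subset hc) (a := 1 - l) (b := l) (by linarith) hl0.le (by ring)
    convert this using 1
    have ey := hf.decomp (y - P i)
    have ec := hf.decomp (c - P i)
    rw [hle] at ey
    rw [← htc, ← hsc] at ec
    have hs : dotp (y - P i) (tau P i) = θ * (ell P i * (1 - l)) + l * sc := by
      rw [hθ, div_mul_cancel₀ _ hp.ne']; ring
    rw [hs] at ey
    have ey' : y = P i + ((θ * (ell P i * (1 - l)) + l * sc) • tau P i + (l * tc) • ν i) := by
      rw [← ey]; abel
    have ec' : c = P i + (sc • tau P i + tc • ν i) := by rw [← ec]; abel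
    rw [P_succ h]
    rw [ey']
    conv_rhs => rw [ec']
    module

end

section
variable {r : ℕ} {P ν : ℕ → ℝ × ℝ} {u : ℝ × ℝ → ℝ}

/-- the boundary behaviour, for all indices -/
structure Blow (P ν : ℕ → ℝ × ℝ) (u : ℝ × ℝ → ℝ) (Ω : Set (ℝ × ℝ)) : Prop where
  cont : ContinuousOn u Ω
  plus : ∀ i : ℕ, ∀ t > (0:ℝ), Tendsto u (𝓝[Ω] (P i + t • ν i)) atTop
  minus : ∀ i : ℕ, ∀ t > (0:ℝ), Tendsto u (𝓝[Ω] (P (i + 1) + t • ν i)) atBot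

lemma blow_of (h : IsConvexPolygonData r P ν) {Ω : Set (ℝ × ℝ)} (hc : ContinuousOn u Ω)
    (hp : ∀ i < r, ∀ t > (0:ℝ), Tendsto u (𝓝[Ω] (P i + t • ν i)) atTop)
    (hm : ∀ i < r, ∀ t > (0:ℝ), Tendsto u (𝓝[Ω] (P i + t • ν (i + r - 1))) atBot) :
    Blow P ν u Ω := by
  refine ⟨hc, fun i t ht => ?_, fun i t ht => ?_⟩
  · have := hp (i % r) (modlt h i) t ht
    rwa [Pmod h, νmod h] at this
  · rw [← Pmod1 h, ← νmod h]
    have h3 := h.three_le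
    have h5 := modlt h i
    rcases lt_or_ge (i % r + 1) r with h6 | h6
    · have := hm (i % r + 1) h6 t ht
      rwa [show i % r + 1 + r - 1 = i % r + r by omega, h.periodicν] at this
    · have h7 : i % r + 1 = r := by omega
      have := hm 0 (by omega) t ht
      rw [show 0 + r - 1 = i % r by omega, ← h.periodicP 0, zero_add] at this
      rwa [h7]


lemma ν_ne (h : IsConvexPolygonData r P ν)
    (hb : Blow P ν u (interior (OmegaV r P ν))) (k : ℕ) : ν k ≠ ν (k + 1) := by
  intro e
  have h1 := hb.plus (k + 1) 1 one_pos
  have h2 := hb.minus k 1 one_pos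
  rw [e] at h2
  have := mem_closure_iff_nhdsWithin_neBot.1 (side_left h (k + 1) one_pos)
  exact h1.not_tendsto disjoint_atTop_atBot h2

lemma left_out (hb : Blow P ν u (interior (OmegaV r P ν))) (i : ℕ) {t : ℝ} (ht : 0 < t) : P i + t • ν i ∉ interior (OmegaV r P ν) := by
  intro hz
  have h1 := hb.plus i t ht
  have h2 := hb.cont _ hz
  have := mem_closure_iff_nhdsWithin_neBot.1 (subset_closure hz)
  exact h2.not_tendsto (disjoint_nhds_atTop _) h1

lemma right_out (hb : Blow P ν u (interior (OmegaV r P ν))) (i : ℕ) {t : ℝ} (ht : 0 < t) : P (i + 1) + t • ν i ∉ interior (OmegaV r P ν) := by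
  intro hz
  have h1 := hb.minus i t ht
  have h2 := hb.cont _ hz
  have := mem_closure_iff_nhdsWithin_neBot.1 (subset_closure hz)
  exact h2.not_tendsto (disjoint_nhds_atBot _) h1

lemma omega_cases (h : IsConvexPolygonData r P ν)
    (hb : Blow P ν u (interior (OmegaV r P ν))) {z : ℝ × ℝ} (hz : z ∈ OmegaV r P ν) :
    z ∈ interior (polyHull r P) ∨
    (∃ i, 0 < dotp (z - P i) (tau P i) ∧ dotp (z - P i) (tau P i) < ell P i ∧
      0 ≤ dotp (z - P i) (ν i)) ∨
    (∃ i, ∃ t > (0:ℝ), z = P i + t • ν i) ∨ (∃ i, ∃ t > (0:ℝ), z = P (i + 1) + t • ν i) ∨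
    ∃ i, z = P i := by
  have key : ∀ i, z ∈ halfStrip (P i) (P (i + 1)) (ν i) →
    (∃ i, 0 < dotp (z - P i) (tau P i) ∧ dotp (z - P i) (tau P i) < ell P i ∧
      0 ≤ dotp (z - P i) (ν i)) ∨
    (∃ i, ∃ t > (0:ℝ), z = P i + t • ν i) ∨ (∃ i, ∃ t > (0:ℝ), z = P (i + 1) + t • ν i) ∨
    ∃ i, z = P i := by
    intro i hi
    rw [halfStrip_eq h] at hi
    obtain ⟨h1, h2, h3⟩ := hi
    have hd := (frame h i).decomp (z - P i)
    rcases h1.lt_or_eq with h1 | h1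
    · rcases h2.lt_or_eq with h2 | h2
      · exact Or.inl ⟨i, h1, h2, h3⟩
      · have hd' : z = P (i + 1) + dotp (z - P i) (ν i) • ν i := by
          rw [P_succ h i, ← h2, add_assoc, ← hd]; abel
        rcases h3.lt_or_eq with h3 | h3
        · exact Or.inr (Or.inr (Or.inl ⟨i, _, h3, hd'⟩))
        · rw [← h3, zero_smul, add_zero] at hd'
          exact Or.inr (Or.inr (Or.inr ⟨i + 1, hd'⟩))
    · have hd' : z = P i + dotp (z - P i) (ν i) • ν i := by
        rw [← h1, zero_smul, zero_add] at hd
        rw [← hd]; abel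
      rcases h3.lt_or_eq with h3 | h3
      · exact Or.inr (Or.inl ⟨i, _, h3, hd'⟩)
      · rw [← h3, zero_smul, add_zero] at hd'
        exact Or.inr (Or.inr (Or.inr ⟨i, hd'⟩))
  rcases hz with hz | hz
  · rcases hull_cases h (ν_ne h hb) hz with hz | ⟨i, hz⟩
    · exact Or.inl hz
    · exact Or.inr (key i ⟨z, hz, 0, le_rfl, by simp⟩)
  · rw [mem_iUnion₂] at hz
    obtain ⟨i, -, hz⟩ := hz
    exact Or.inr (key i hz)

lemma hull_int_sub : interior (polyHull r P) ⊆ interior (OmegaV r P ν) :=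
  interior_mono subset_union_left

lemma W_sub (h : IsConvexPolygonData r P ν) (i : ℕ) : {z | 0 < dotp (z - P i) (tau P i) ∧ dotp (z - P i) (tau P i) < ell P i ∧
      0 ≤ dotp (z - P i) (ν i)} ⊆ interior (OmegaV r P ν) := by
  rintro z ⟨h1, h2, h3⟩
  rcases h3.lt_or_eq with h3 | h3
  · exact strU_sub h i ⟨h1, h2, h3⟩
  · exact edge_open h i h1 h2 h3.symm

lemma omega_mem_cases (h : IsConvexPolygonData r P ν)
    (hb : Blow P ν u (interior (OmegaV r P ν))) {z : ℝ × ℝ} (hz : z ∈ interior (OmegaV r P ν)) :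
    z ∈ interior (polyHull r P) ∨
    (∃ i, 0 < dotp (z - P i) (tau P i) ∧ dotp (z - P i) (tau P i) < ell P i ∧
      0 ≤ dotp (z - P i) (ν i)) ∨ ∃ i, z = P i := by
  rcases omega_cases h hb (interior_subset hz) with h1 | h1 | ⟨i, t, ht, rfl⟩ | ⟨i, t, ht, rfl⟩ | h1
  · exact Or.inl h1
  · exact Or.inr (Or.inl h1)
  · exact absurd hz (left_out hb i ht)
  · exact absurd hz (right_out hb i ht)
  · exact Or.inr (Or.inr h1)

lemma omega_preconn (h : IsConvexPolygonData r P ν)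
    (hb : Blow P ν u (interior (OmegaV r P ν))) : IsPreconnected (interior (OmegaV r P ν)) := by
  set I := interior (polyHull r P) with hI
  set W : ℕ → Set (ℝ × ℝ) := fun i => {z | 0 < dotp (z - P i) (tau P i) ∧
    dotp (z - P i) (tau P i) < ell P i ∧ 0 ≤ dotp (z - P i) (ν i)} with hW
  have hIc : IsPreconnected I := hull_convex.interior.isPreconnected
  obtain ⟨c, hc⟩ := h.interior_nonempty
  have lin : ∀ (p n : ℝ × ℝ), ∀ x y : ℝ × ℝ, ∀ a b : ℝ, a + b = 1 →
      dotp (a • x + b • y - p) n = a * dotp (x - p) n + b * dotp (y - p) n := by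
    intro p n x y a b hab
    have : b = 1 - a := by linarith
    subst this
    unfold dotp; simp; ring
  have hWc : ∀ i, Convex ℝ (W i) := by
    rintro i x ⟨x1, x2, x3⟩ y ⟨y1, y2, y3⟩ a b ha hb hab
    simp only [hW, mem_setOf_eq]
    rw [lin _ _ _ _ _ _ hab, lin _ _ _ _ _ _ hab]
    have : b = 1 - a := by linarith
    subst this
    refine ⟨?_, ?_, by positivity⟩
    · rcases ha.lt_or_eq with h0 | h0
      · nlinarith [mul_pos h0 x1, mul_nonneg hb y1.le]
      · rw [← h0]; simpa using y1
    · rcases ha.lt_or_eq with h0 | h0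
      · nlinarith [mul_pos h0 (sub_pos.2 x2), mul_nonneg hb (sub_pos.2 y2).le]
      · rw [← h0]; simpa using y2
  have hA : ∀ i, IsPreconnected (I ∪ W i) := by
    intro i
    set m := P i + (ell P i / 2) • tau P i with hm
    have hl := ell_pos h i
    have em : m - P i = (ell P i / 2) • tau P i + (0:ℝ) • ν i := by rw [hm]; simp
    have hmW : m ∈ W i := by
      simp only [hW, mem_setOf_eq]
      rw [em, (frame h i).dot1, (frame h i).dot2]
      exact ⟨by linarith, by linarith, le_rfl⟩
    have hmH : m ∈ polyHull r P := by
      apply hull_convex.segment_subset (P_mem h i) (P_mem h (i + 1))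
      rw [segment_eq_image']
      refine ⟨1 / 2, by norm_num, ?_⟩
      rw [P_succ h i, hm]
      simp only [add_sub_cancel_left, smul_smul]
      ring_nf
    have h1 : IsPreconnected (insert m I) := hIc.subset_closure (subset_insert _ _)
      (insert_subset (hull_closure h hmH) subset_closure)
    have h2 := IsPreconnected.union m (mem_insert _ _) hmW h1 (hWc i).isPreconnected
    have : insert m I ∪ W i = I ∪ W i := by
      rw [insert_union]; exact insert_eq_of_mem (Or.inr hmW)
    rwa [this] at h2
  have hS : IsPreconnected (⋃ i, I ∪ W i) :=
    isPreconnected_iUnion ⟨c, mem_iInter.2 fun i => Or.inl hc⟩ hA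
  apply hS.subset_closure
  · apply iUnion_subset
    intro i
    exact union_subset (hull_int_sub) (W_sub h i)
  · intro z hz
    rcases omega_mem_cases h hb hz with h1 | ⟨i, h1⟩ | ⟨i, rfl⟩
    · exact subset_closure (mem_iUnion.2 ⟨0, Or.inl h1⟩)
    · exact subset_closure (mem_iUnion.2 ⟨i, Or.inr h1⟩)
    · have hsub : I ⊆ ⋃ i, I ∪ W i := fun w hw => mem_iUnion.2 ⟨0, Or.inl hw⟩
      exact closure_mono hsub (hull_closure h (P_mem h i))

end

/-- a half strip sitting inside the domain with its sides outside of it -/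
structure StripIn (Ω : Set (ℝ × ℝ)) (p τ ν : ℝ × ℝ) (ℓ : ℝ) : Prop where
  fr : Frame τ ν
  lpos : 0 < ℓ
  sub : strU p τ ν ℓ ⊆ Ω
  left : ∀ t > (0:ℝ), p + t • ν ∉ Ω
  right : ∀ t > (0:ℝ), p + ℓ • τ + t • ν ∉ Ω

/-- function of the height in a strip, extended by zero -/
noncomputable def sfun (p τ ν : ℝ × ℝ) (ℓ : ℝ) (η : ℝ → ℝ) : ℝ × ℝ → ℝ :=
  indicator (strU p τ ν ℓ) (fun z => η (dotp (z - p) ν))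

/-- the compact box in a strip -/
def sbox (p τ ν : ℝ × ℝ) (ℓ a b : ℝ) : Set (ℝ × ℝ) :=
  {z | 0 ≤ dotp (z - p) τ ∧ dotp (z - p) τ ≤ ℓ ∧ a ≤ dotp (z - p) ν ∧ dotp (z - p) ν ≤ b}

section
variable {Ω : Set (ℝ × ℝ)} {p τ ν : ℝ × ℝ} {ℓ : ℝ}

lemma StripIn.rec_eq (hS : StripIn Ω p τ ν ℓ) (z : ℝ × ℝ) :
    z = p + dotp (z - p) τ • τ + dotp (z - p) ν • ν := by
  have := hS.fr.decomp (z - p)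
  rw [add_assoc, ← this]; abel

lemma StripIn.box_compact (hS : StripIn Ω p τ ν ℓ) (a b : ℝ) : IsCompact (sbox p τ ν ℓ a b) := by
  have hc : IsCompact ((fun w : ℝ × ℝ => p + w.1 • τ + w.2 • ν) '' (Icc 0 ℓ ×ˢ Icc a b)) :=
    (isCompact_Icc.prod isCompact_Icc).image (by fun_prop)
  apply hc.of_isClosed_subset
  · exact (isClosed_le continuous_const (dotp_cont _ _)).inter
      ((isClosed_le (dotp_cont _ _) continuous_const).inter
        ((isClosed_le continuous_const (dotp_cont _ _)).inter
          (isClosed_le (dotp_cont _ _) continuous_const)))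
  · rintro z ⟨h1, h2, h3, h4⟩
    exact ⟨(dotp (z - p) τ, dotp (z - p) ν), ⟨⟨h1, h2⟩, h3, h4⟩, (hS.rec_eq z).symm⟩

lemma StripIn.box_vol (hS : StripIn Ω p τ ν ℓ) (a b c : ℝ) :
    volume (sbox p τ ν ℓ (a + c) (b + c)) = volume (sbox p τ ν ℓ a b) := by
  have : sbox p τ ν ℓ a b = (fun z => z + c • ν) ⁻¹' (sbox p τ ν ℓ (a + c) (b + c)) := by
    ext z
    have e : z + c • ν - p = (z - p) + c • ν := by abel
    simp only [sbox, mem_preimage, mem_setOf_eq, e]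
    rw [dotp_add_left, dotp_add_left, dotp_smul_left, dotp_smul_left, hS.fr.nn, dotp_comm ν τ,
      hS.fr.tn]
    simp
  rw [this, measure_preimage_add_right]

lemma StripIn.loc (hS : StripIn Ω p τ ν ℓ) {η : ℝ → ℝ} (h0 : ∀ t ≤ 1, η t = 0) {z : ℝ × ℝ}
    (hz : z ∈ Ω) :
    (z ∈ strU p τ ν ℓ ∧ sfun p τ ν ℓ η =ᶠ[𝓝 z] fun y => η (dotp (y - p) ν)) ∨
    (z ∉ strU p τ ν ℓ ∧ sfun p τ ν ℓ η =ᶠ[𝓝 z] fun _ => 0) := by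
  by_cases hU : z ∈ strU p τ ν ℓ
  · left
    refine ⟨hU, ?_⟩
    filter_upwards [(strU_open p τ ν ℓ).mem_nhds hU] with y hy
    exact indicator_of_mem hy _
  · right
    refine ⟨hU, ?_⟩
    rcases lt_or_ge (dotp (z - p) ν) 1 with ht | ht
    · filter_upwards [((dotp_cont ν p).tendsto z).eventually (gt_mem_nhds ht)] with y hy
      unfold sfun
      by_cases hyU : y ∈ strU p τ ν ℓ
      · rw [indicator_of_mem hyU, h0 _ hy.le]
      · exact indicator_of_notMem hyU _
    · have ht0 : 0 < dotp (z - p) ν := by linarith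
      have hr := hS.rec_eq z
      have n0 : dotp (z - p) τ ≠ 0 := by
        intro h
        rw [h, zero_smul, add_zero] at hr
        exact hS.left _ ht0 (hr ▸ hz)
      have n1 : dotp (z - p) τ ≠ ℓ := by
        intro h
        rw [h] at hr
        exact hS.right _ ht0 (hr ▸ hz)
      rcases lt_or_gt_of_ne n0 with hs | hs
      · filter_upwards [((dotp_cont τ p).tendsto z).eventually (gt_mem_nhds hs)] with y hy
        exact indicator_of_notMem (fun hyU => absurd hyU.1 (not_lt.2 hy.le)) _
      · rcases lt_or_gt_of_ne n1 with hs' | hs'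
        · exact absurd ⟨hs, hs', ht0⟩ hU
        · filter_upwards [((dotp_cont τ p).tendsto z).eventually (lt_mem_nhds hs')] with y hy
          exact indicator_of_notMem (fun hyU => absurd hyU.2.1 (not_lt.2 hy.le)) _

lemma dotp_contDiff (n p : ℝ × ℝ) : ContDiff ℝ 1 (fun z : ℝ × ℝ => dotp (z - p) n) := by
  unfold dotp; fun_prop

lemma dotp_hasFD (n p z : ℝ × ℝ) : ∃ A : ℝ × ℝ →L[ℝ] ℝ,
    HasFDerivAt (fun z : ℝ × ℝ => dotp (z - p) n) A z ∧ ∀ v, A v = dotp v n := by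
  refine ⟨n.1 • ContinuousLinearMap.fst ℝ ℝ ℝ + n.2 • ContinuousLinearMap.snd ℝ ℝ ℝ, ?_, ?_⟩
  · have h1 := (((hasFDerivAt_fst (𝕜 := ℝ) (p := z)).sub_const p.1).const_mul n.1).fun_add
      (((hasFDerivAt_snd (𝕜 := ℝ) (p := z)).sub_const p.2).const_mul n.2)
    refine h1.congr_of_eventuallyEq (Eventually.of_forall fun y => ?_)
    unfold dotp; simp; ring
  · intro v; unfold dotp; simp; ring

lemma StripIn.cd (hS : StripIn Ω p τ ν ℓ) {η : ℝ → ℝ} (h0 : ∀ t ≤ 1, η t = 0)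
    (hη : ContDiff ℝ 1 η) : ContDiffOn ℝ 1 (sfun p τ ν ℓ η) Ω := by
  intro z hz
  apply ContDiffAt.contDiffWithinAt
  rcases hS.loc h0 hz with ⟨-, h⟩ | ⟨-, h⟩
  · exact (hη.comp (dotp_contDiff ν p)).contDiffAt.congr_of_eventuallyEq h
  · exact contDiffAt_const.congr_of_eventuallyEq h

lemma StripIn.fd (hS : StripIn Ω p τ ν ℓ) {η η' : ℝ → ℝ} (h0 : ∀ t ≤ 1, η t = 0)
    (hη : ∀ t, HasDerivAt η (η' t) t) {z : ℝ × ℝ} (hz : z ∈ Ω) (v : ℝ × ℝ) :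
    fderiv ℝ (sfun p τ ν ℓ η) z v = sfun p τ ν ℓ η' z * dotp v ν := by
  rcases hS.loc h0 hz with ⟨hU, h⟩ | ⟨hU, h⟩
  · rw [h.fderiv_eq]
    obtain ⟨A, hA, hAv⟩ := dotp_hasFD ν p z
    have := (hη (dotp (z - p) ν)).comp_hasFDerivAt z hA
    have e : fderiv ℝ (fun y => η (dotp (y - p) ν)) z = _ := this.fderiv
    rw [e]
    unfold sfun
    rw [indicator_of_mem hU]
    simp [hAv]
  · rw [h.fderiv_eq]
    unfold sfun
    rw [indicator_of_notMem hU]; simp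

end

section
variable {Ω : Set (ℝ × ℝ)} {p τ ν : ℝ × ℝ} {ℓ : ℝ} {u : ℝ × ℝ → ℝ} {X : ℝ × ℝ → ℝ × ℝ}

lemma Frame.pars (h : Frame τ ν) (v : ℝ × ℝ) :
    dotp v τ ^ 2 + dotp v ν ^ 2 = v.1 ^ 2 + v.2 ^ 2 := by
  have e := h.decomp v
  have h1 : dotp v v = dotp v τ * dotp v τ + dotp v ν * dotp v ν := by
    conv_lhs => rw [dotp_comm]; arg 1; rw [e]
    rw [dotp_add_left, dotp_smul_left, dotp_smul_left, dotp_comm τ, dotp_comm ν]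
  unfold dotp at *
  nlinarith

lemma Frame.bd (h : Frame τ ν) (v : ℝ × ℝ) : |dotp v ν| ≤ 2 * ‖v‖ := by
  have h1 := h.nn
  have a1 : |ν.1| ≤ 1 := abs_le_of_sq_le_sq (by unfold dotp at h1; nlinarith [sq_nonneg ν.2]) zero_le_one
  have a2 : |ν.2| ≤ 1 := abs_le_of_sq_le_sq (by unfold dotp at h1; nlinarith [sq_nonneg ν.1]) zero_le_one
  have b1 : |v.1| ≤ ‖v‖ := norm_fst_le v
  have b2 : |v.2| ≤ ‖v‖ := norm_snd_le v
  unfold dotp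
  have := abs_add_le (v.1 * ν.1) (v.2 * ν.2)
  rw [abs_mul, abs_mul] at this
  nlinarith [abs_nonneg v.1, abs_nonneg v.2, abs_nonneg ν.1, abs_nonneg ν.2]

lemma sfun_abs_le {η : ℝ → ℝ} {M : ℝ} (hM : 0 ≤ M) (h : ∀ t, |η t| ≤ M) (z : ℝ × ℝ) :
    |sfun p τ ν ℓ η z| ≤ M := by
  unfold sfun
  by_cases hz : z ∈ strU p τ ν ℓ
  · rw [indicator_of_mem hz]; exact h _
  · rw [indicator_of_notMem hz]; simpa using hM

lemma StripIn.fd_bdd (hS : StripIn Ω p τ ν ℓ) {η η' : ℝ → ℝ} (h0 : ∀ t ≤ 1, η t = 0)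
    (hη : ∀ t, HasDerivAt η (η' t) t) {M : ℝ} (hM0 : 0 ≤ M) (hM : ∀ t, |η' t| ≤ M)
    {z : ℝ × ℝ} (hz : z ∈ Ω) : ‖fderiv ℝ (sfun p τ ν ℓ η) z‖ ≤ M * 2 := by
  apply ContinuousLinearMap.opNorm_le_bound _ (by positivity)
  intro v
  rw [hS.fd h0 hη hz, Real.norm_eq_abs, abs_mul]
  have h1 := sfun_abs_le (p := p) (τ := τ) (ν := ν) (ℓ := ℓ) hM0 hM z
  have h2 := hS.fr.bd v
  calc _ ≤ M * (2 * ‖v‖) := mul_le_mul h1 h2 (abs_nonneg _) hM0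
    _ = _ := by ring

/-- profile of the cutoff -/
noncomputable def prof (n : ℕ) (t : ℝ) : ℝ := stp (t - 1) - stp (t - 1 - n)
/-- derivative of the profile of the cutoff -/
noncomputable def prof' (n : ℕ) (t : ℝ) : ℝ := stp' (t - 1) - stp' (t - 1 - n)

lemma stp_shift (c t : ℝ) : HasDerivAt (fun t => stp (t - c)) (stp' (t - c)) t := by
  have := (stp_hasDerivAt (t - c)).comp t ((hasDerivAt_id t).sub_const c)
  simpa [Function.comp_def] using this

lemma prof_hasDerivAt (n : ℕ) (t : ℝ) : HasDerivAt (prof n) (prof' n t) t := by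
  have h1 := stp_shift 1 t
  have h2 := stp_shift (1 + n) t
  have := h1.fun_sub h2
  unfold prof prof'
  simpa only [sub_sub] using this

lemma stp_shift_cd (c : ℝ) : ContDiff ℝ 1 (fun t => stp (t - c)) :=
  stp_contDiff.comp (contDiff_id.sub contDiff_const)

lemma prof_cd (n : ℕ) : ContDiff ℝ 1 (prof n) := by
  have := (stp_shift_cd 1).sub (stp_shift_cd (1 + n))
  simp only [← sub_sub] at this
  exact this

lemma prof_left (n : ℕ) : ∀ t ≤ 1, prof n t = 0 := by
  intro t ht
  have : (0:ℝ) ≤ n := Nat.cast_nonneg n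
  unfold prof; rw [stp_left (by linarith), stp_left (by linarith), sub_zero]

lemma prof_right (n : ℕ) {t : ℝ} (ht : n + 2 ≤ t) : prof n t = 0 := by
  have : (0:ℝ) ≤ n := Nat.cast_nonneg n
  unfold prof; rw [stp_right (by linarith), stp_right (by linarith), sub_self]

lemma prof_nonneg (n : ℕ) (t : ℝ) : 0 ≤ prof n t := by
  have : (0:ℝ) ≤ n := Nat.cast_nonneg n
  exact sub_nonneg.2 (stp_mono (by linarith))

lemma prof_le_one (n : ℕ) (t : ℝ) : prof n t ≤ 1 := by
  unfold prof
  linarith [stp_le_one (t - 1), stp_nonneg (t - 1 - n)]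

lemma prof'_abs (n : ℕ) (t : ℝ) : |prof' n t| ≤ stpC := by
  unfold prof'
  rw [abs_le]
  constructor <;> linarith [stp'_nonneg (t - 1), stp'_nonneg (t - 1 - n), stp'_le (t - 1),
    stp'_le (t - 1 - n)]

lemma sfun_prof_nonneg (n : ℕ) (z : ℝ × ℝ) : 0 ≤ sfun p τ ν ℓ (prof n) z :=
  indicator_nonneg (fun _ _ => prof_nonneg n _) z

lemma sfun_prof_le_one (n : ℕ) (z : ℝ × ℝ) : sfun p τ ν ℓ (prof n) z ≤ 1 :=
  (le_abs_self _).trans (sfun_abs_le zero_le_one (fun t => abs_le.2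
    ⟨by linarith [prof_nonneg n t], prof_le_one n t⟩) z)

lemma StripIn.adm (hS : StripIn Ω p τ ν ℓ) (n : ℕ) :
    Adm (sfun p τ ν ℓ (prof n)) Ω (sbox p τ ν ℓ 1 (n + 2)) := by
  refine ⟨hS.cd (prof_left n) (prof_cd n), fun z _ => sfun_prof_nonneg n z,
    fun z _ => sfun_prof_le_one n z, hS.box_compact _ _, fun z _ hz => ?_,
    ⟨stpC * 2, fun z hz => hS.fd_bdd (prof_left n) (prof_hasDerivAt n) stpC_pos.le
      (prof'_abs n) hz⟩⟩
  unfold sfun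
  by_cases hU : z ∈ strU p τ ν ℓ
  · rw [indicator_of_mem hU]
    rcases le_or_gt (dotp (z - p) ν) 1 with h1 | h1
    · exact prof_left n _ h1
    · rcases le_or_gt (n + 2 : ℝ) (dotp (z - p) ν) with h2 | h2
      · exact prof_right n h2
      · exact absurd ⟨hU.1.le, hU.2.1.le, h1.le, h2.le⟩ hz
  · exact indicator_of_notMem hU _

/-- the side function -/
noncomputable def sideh (p τ : ℝ × ℝ) (ℓ η : ℝ) (z : ℝ × ℝ) : ℝ :=
  1 - 2 * stepη η (dotp (z - p) τ / ℓ)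

lemma sideh_cd (η : ℝ) : ContDiff ℝ 1 (sideh p τ ℓ η) :=
  contDiff_const.sub (contDiff_const.mul ((step_contDiff η).comp ((dotp_contDiff τ p).div_const ℓ)))

lemma sideh_fd (η : ℝ) (z v : ℝ × ℝ) : fderiv ℝ (sideh p τ ℓ η) z v =
    -(2 * (trap η (dotp (z - p) τ / ℓ) / trapMass η) * (dotp v τ / ℓ)) := by
  obtain ⟨A, hA, hAv⟩ := dotp_hasFD τ p z
  have h1 : HasFDerivAt (fun z => dotp (z - p) τ / ℓ) (ℓ⁻¹ • A) z := by
    simpa only [div_eq_mul_inv, mul_comm] using hA.mul_const ℓ⁻¹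
  have h2 := (((step_hasDerivAt η (dotp (z - p) τ / ℓ)).comp_hasFDerivAt z h1).const_mul 2).const_sub 1
  have e : fderiv ℝ (sideh p τ ℓ η) z = _ := h2.fderiv
  rw [e]
  simp [hAv]
  ring

lemma StripIn.sat (hS : StripIn Ω p τ ν ℓ)
    (hp : ∀ t > (0:ℝ), Tendsto u (𝓝[Ω] (p + t • ν)) atTop)
    (hm : ∀ t > (0:ℝ), Tendsto u (𝓝[Ω] (p + ℓ • τ + t • ν)) atBot)
    {η : ℝ} (hη : 0 < η) (hη' : η ≤ 1 / 4) (b : ℝ) :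
    Sat u (sideh p τ ℓ η) Ω (sbox p τ ν ℓ 1 b) := by
  rintro z ⟨h1, h2, h3, h4⟩ hz
  have hr := hS.rec_eq z
  have ht : 0 < dotp (z - p) ν := by linarith
  have hl := hS.lpos
  have cs := (dotp_cont τ p).div_const ℓ
  rcases h1.lt_or_eq with h1 | h1
  · rcases h2.lt_or_eq with h2 | h2
    · exact absurd (hS.sub ⟨h1, h2, ht⟩) hz
    · right
      constructor
      · rw [h2] at hr
        rw [hr]; exact hm _ ht
      · apply mem_nhdsWithin_of_mem_nhds
        have : 1 - η < dotp (z - p) τ / ℓ := by rw [h2, div_self hl.ne']; linarith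
        filter_upwards [(cs.tendsto z).eventually (lt_mem_nhds this)] with y hy
        change sideh p τ ℓ η y = -1
        unfold sideh; rw [step_right hη hη' hy.le]; norm_num
  · left
    constructor
    · rw [← h1, zero_smul, add_zero] at hr
      rw [hr]; exact hp _ ht
    · apply mem_nhdsWithin_of_mem_nhds
      have : dotp (z - p) τ / ℓ < η := by rw [← h1, zero_div]; exact hη
      filter_upwards [(cs.tendsto z).eventually (gt_mem_nhds this)] with y hy
      change sideh p τ ℓ η y = 1
      unfold sideh; rw [step_left hη hy.le]; norm_num

lemma sideh_abs {η : ℝ} (hη : 0 < η) (hη' : η ≤ 1 / 4) (z : ℝ × ℝ) : |sideh p τ ℓ η z| ≤ 1 := by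
  unfold sideh
  rw [abs_le]
  constructor <;> linarith [step_nonneg hη hη' (dotp (z - p) τ / ℓ), step_le_one hη hη' (dotp (z - p) τ / ℓ)]

lemma StripIn.q_bd (hS : StripIn Ω p τ ν ℓ) {v : ℝ × ℝ} (hv : v.1 ^ 2 + v.2 ^ 2 ≤ 1) :
    0 ≤ 1 + dotp v τ ∧ 1 + dotp v τ ≤ 2 ∧ dotp v ν ^ 2 ≤ 2 * (1 + dotp v τ) ∧ |dotp v ν| ≤ 1 := by
  have h := hS.fr.pars v
  have h1 := abs_le.1 (abs_le_of_sq_le_sq (by nlinarith [sq_nonneg (dotp v ν)] : dotp v τ ^ 2 ≤ 1 ^ 2) zero_le_one)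
  refine ⟨by linarith, by linarith, by nlinarith, ?_⟩
  exact abs_le_of_sq_le_sq (by nlinarith [sq_nonneg (dotp v τ)]) zero_le_one

lemma StripIn.prof'_bd (n : ℕ) {z : ℝ × ℝ} :
    |sfun p τ ν ℓ (prof' n) z| ≤ stpC * (indicator (sbox p τ ν ℓ 1 2) (fun _ => (1:ℝ)) z +
      indicator (sbox p τ ν ℓ (1 + n) (2 + n)) (fun _ => (1:ℝ)) z) := by
  have i1 : 0 ≤ indicator (sbox p τ ν ℓ 1 2) (fun _ => (1:ℝ)) z :=
    indicator_nonneg (fun _ _ => zero_le_one) z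
  have i2 : 0 ≤ indicator (sbox p τ ν ℓ (1 + n) (2 + n)) (fun _ => (1:ℝ)) z :=
    indicator_nonneg (fun _ _ => zero_le_one) z
  have hC := stpC_pos
  by_cases hU : z ∈ strU p τ ν ℓ
  · have e : sfun p τ ν ℓ (prof' n) z = prof' n (dotp (z - p) ν) := indicator_of_mem hU _
    rw [e]
    by_cases hb1 : z ∈ sbox p τ ν ℓ 1 2
    · rw [indicator_of_mem hb1]
      have := prof'_abs n (dotp (z - p) ν)
      nlinarith
    · by_cases hb2 : z ∈ sbox p τ ν ℓ (1 + n) (2 + n)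
      · rw [indicator_of_mem hb2]
        have := prof'_abs n (dotp (z - p) ν)
        nlinarith
      · have z1 : stp' (dotp (z - p) ν - 1) = 0 := by
          rcases le_or_gt (dotp (z - p) ν) 1 with h1 | h1
          · exact stp'_left (by linarith)
          · rcases le_or_gt 2 (dotp (z - p) ν) with h2 | h2
            · exact stp'_right (by linarith)
            · exact absurd ⟨hU.1.le, hU.2.1.le, h1.le, h2.le⟩ hb1
        have z2 : stp' (dotp (z - p) ν - 1 - n) = 0 := by
          rcases le_or_gt (dotp (z - p) ν) (1 + n) with h1 | h1
          · exact stp'_left (by linarith)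
          · rcases le_or_gt (2 + n : ℝ) (dotp (z - p) ν) with h2 | h2
            · exact stp'_right (by linarith)
            · exact absurd ⟨hU.1.le, hU.2.1.le, h1.le, h2.le⟩ hb2
        unfold prof'
        rw [z1, z2, sub_zero, abs_zero]
        positivity
  · have e : sfun p τ ν ℓ (prof' n) z = 0 := indicator_of_notMem hU _
    rw [e, abs_zero]
    positivity

lemma StripIn.box_int (hS : StripIn Ω p τ ν ℓ) (a b : ℝ) :
    Integrable (indicator (sbox p τ ν ℓ a b) (fun _ => (1:ℝ))) ∧
    ∫ z in Ω, indicator (sbox p τ ν ℓ a b) (fun _ => (1:ℝ)) z ≤ (volume (sbox p τ ν ℓ a b)).toReal := by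
  have hm := (hS.box_compact a b).measurableSet
  have hi : Integrable (indicator (sbox p τ ν ℓ a b) (fun _ => (1:ℝ))) :=
    (integrable_indicator_iff hm).2 (integrableOn_const (hS.box_compact a b).measure_lt_top.ne)
  refine ⟨hi, ?_⟩
  refine (setIntegral_le_integral hi (Eventually.of_forall
    (fun z => indicator_nonneg (fun _ _ => zero_le_one) z))).trans (le_of_eq ?_)
  rw [integral_indicator hm]
  simp [Measure.real]

end

section
variable {Ω : Set (ℝ × ℝ)} {p τ ν : ℝ × ℝ} {ℓ : ℝ} {u u₁ u₂ : ℝ × ℝ → ℝ} {X X₁ X₂ : ℝ × ℝ → ℝ × ℝ}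

lemma dotp_cont_on (n : ℝ × ℝ) (hX : ContinuousOn X Ω) : ContinuousOn (fun z => dotp (X z) n) Ω := by
  unfold dotp; fun_prop

lemma StripIn.int_rq (hS : StripIn Ω p τ ν ℓ) (ho : IsOpen Ω) (hf : Fld u X Ω) (n : ℕ)
    {g : ℝ × ℝ → ℝ} (hg : ContinuousOn g Ω) (hg1 : ∀ z ∈ Ω, |g z| ≤ 1) :
    IntegrableOn (fun z => sfun p τ ν ℓ (prof n) z * g z * (1 + dotp (X z) τ)) Ω := by
  have ha := hS.adm n
  apply integrableOn_bdd ho ha.cpt (M := 2)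
  · exact (ha.cd.continuousOn.mul hg).mul
      (continuousOn_const.add (dotp_cont_on τ hf.df.cd.continuousOn))
  · intro z hz
    have h1 := ha.nonneg z hz
    have h2 := ha.le_one z hz
    have h3 := hS.q_bd (hf.sq_le hz)
    rw [abs_mul, abs_mul, abs_of_nonneg h1, abs_of_nonneg h3.1]
    have h4 : sfun p τ ν ℓ (prof n) z * |g z| ≤ 1 := mul_le_one₀ h2 (abs_nonneg _) (hg1 z hz)
    nlinarith [h3.1, h3.2.1]
  · intro z hz hzK
    rw [ha.zero z hz hzK]; simp

lemma StripIn.trap_int (hS : StripIn Ω p τ ν ℓ) (ho : IsOpen Ω) (hf : Fld u X Ω)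
    (hp : ∀ t > (0:ℝ), Tendsto u (𝓝[Ω] (p + t • ν)) atTop)
    (hm : ∀ t > (0:ℝ), Tendsto u (𝓝[Ω] (p + ℓ • τ + t • ν)) atBot)
    {η : ℝ} (hη : 0 < η) (hη' : η ≤ 1 / 4) (n : ℕ) :
    ∫ z in Ω, sfun p τ ν ℓ (prof n) z * trap η (dotp (z - p) τ / ℓ) * (1 + dotp (X z) τ)
      ≤ ℓ * stpC * (volume (sbox p τ ν ℓ 1 2)).toReal := by
  have ha := hS.adm n
  have hl := hS.lpos
  have hs := hS.sat hp hm hη hη' ((n:ℝ) + 2)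
  have hY1 : ∀ z ∈ Ω, ((fun _ : ℝ × ℝ => -τ) z).1 ^ 2 + ((fun _ : ℝ × ℝ => -τ) z).2 ^ 2 ≤ 1 := by
    intro z _
    have := hS.fr.tt
    unfold dotp at this
    simp only [Prod.fst_neg, Prod.snd_neg]
    nlinarith
  have hY := divFree_const (-τ) Ω
  have hh : ContDiffOn ℝ 1 (sideh p τ ℓ η) Ω := (sideh_cd η).contDiffOn
  have h0 := flux_nonneg ho ha hf hY hY1 hh hs
  have hi := (flux_split ho ha (hf.df.sub ho hY) (norm_sub_le_two (fun z hz => hf.sq_le hz) hY1)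
    hf.cd hh hs one_pos).1
  have htc : ContinuousOn (fun z => trap η (dotp (z - p) τ / ℓ)) Ω :=
    ((trap_cont η).comp ((dotp_cont τ p).div_const ℓ)).continuousOn
  have hi2 := hS.int_rq ho hf n htc
    (fun z _ => abs_le.2 ⟨by linarith [trap_nonneg η (dotp (z - p) τ / ℓ)], trap_le_one _ _⟩)
  obtain ⟨b1, b1'⟩ := hS.box_int 1 2
  obtain ⟨b2, b2'⟩ := hS.box_int (1 + n) (2 + n)
  rw [hS.box_vol 1 2 n] at b2'
  have hr := ((b1.integrableOn (s := Ω)).add (b2.integrableOn (s := Ω))).const_mul stpC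
  have hr2 := (hi2.const_mul (2 / ℓ)).neg
  have hmono := setIntegral_mono_on hi (hr2.add hr) ho.measurableSet (by
    intro z hz
    have q := hS.q_bd (hf.sq_le hz)
    rw [fd_mul ho ha.cd hh hz, sideh_fd, hS.fd (prof_left n) (prof_hasDerivAt n) hz]
    have e1 : dotp (X z - -τ) τ = 1 + dotp (X z) τ := by
      have := hS.fr.tt
      unfold dotp at *; simp; linarith
    have e2 : dotp (X z - -τ) ν = dotp (X z) ν := by
      have := hS.fr.tn
      unfold dotp at *; simp; linarith
    rw [e1, e2]
    have p1 := StripIn.prof'_bd (p := p) (τ := τ) (ν := ν) (ℓ := ℓ) n (z := z)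
    have t1 : sideh p τ ℓ η z * (sfun p τ ν ℓ (prof' n) z * dotp (X z) ν) ≤
        |sfun p τ ν ℓ (prof' n) z| := by
      refine (le_abs_self _).trans ?_
      rw [abs_mul, abs_mul]
      have a := sideh_abs (p := p) (τ := τ) (ℓ := ℓ) hη hη' z
      have b : |sfun p τ ν ℓ (prof' n) z| * |dotp (X z) ν| ≤ |sfun p τ ν ℓ (prof' n) z| :=
        mul_le_of_le_one_right (abs_nonneg _) q.2.2.2
      exact (mul_le_of_le_one_left (by positivity) a).trans b
    have t2 : trap η (dotp (z - p) τ / ℓ) ≤ trap η (dotp (z - p) τ / ℓ) / trapMass η := by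
      rw [le_div_iff₀ (trapMass_pos hη hη')]
      exact mul_le_of_le_one_right (trap_nonneg _ _) (trapMass_le_one η)
    have t3 : 2 / ℓ * (sfun p τ ν ℓ (prof n) z * trap η (dotp (z - p) τ / ℓ) * (1 + dotp (X z) τ)) ≤
        sfun p τ ν ℓ (prof n) z * (2 * (trap η (dotp (z - p) τ / ℓ) / trapMass η) *
          ((1 + dotp (X z) τ) / ℓ)) := by
      have hn : 0 ≤ 2 / ℓ * sfun p τ ν ℓ (prof n) z * (1 + dotp (X z) τ) :=
        mul_nonneg (mul_nonneg (by positivity) (ha.nonneg z hz)) q.1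
      calc _ = 2 / ℓ * sfun p τ ν ℓ (prof n) z * (1 + dotp (X z) τ) *
            trap η (dotp (z - p) τ / ℓ) := by ring
        _ ≤ 2 / ℓ * sfun p τ ν ℓ (prof n) z * (1 + dotp (X z) τ) *
            (trap η (dotp (z - p) τ / ℓ) / trapMass η) := mul_le_mul_of_nonneg_left t2 hn
        _ = _ := by ring
    simp only [Pi.add_apply, Pi.neg_apply]
    linarith)
  have hsum : ∫ z in Ω, ((-fun z => 2 / ℓ * (sfun p τ ν ℓ (prof n) z * trap η (dotp (z - p) τ / ℓ) *
      (1 + dotp (X z) τ))) + fun x => stpC * (((sbox p τ ν ℓ 1 2).indicator fun x => (1:ℝ)) +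
        (sbox p τ ν ℓ (1 + n) (2 + n)).indicator fun x => (1:ℝ)) x) z =
      -(2 / ℓ * ∫ z in Ω, sfun p τ ν ℓ (prof n) z * trap η (dotp (z - p) τ / ℓ) * (1 + dotp (X z) τ))
      + stpC * ((∫ z in Ω, (sbox p τ ν ℓ 1 2).indicator (fun x => (1:ℝ)) z) +
        ∫ z in Ω, (sbox p τ ν ℓ (1 + n) (2 + n)).indicator (fun x => (1:ℝ)) z) := by
    rw [integral_add' hr2 hr, integral_neg', integral_const_mul, integral_const_mul,
      integral_add' b1.integrableOn b2.integrableOn]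
  rw [hsum] at hmono
  set A := ∫ z in Ω, sfun p τ ν ℓ (prof n) z * trap η (dotp (z - p) τ / ℓ) * (1 + dotp (X z) τ)
  set V := (volume (sbox p τ ν ℓ 1 2)).toReal
  have hC := stpC_pos
  have hfin : 2 / ℓ * A ≤ stpC * (V + V) := by nlinarith
  have := mul_le_mul_of_nonneg_left hfin (by positivity : (0:ℝ) ≤ ℓ / 2)
  calc A = ℓ / 2 * (2 / ℓ * A) := by field_simp
    _ ≤ _ := this
    _ = _ := by ring

lemma StripIn.rq_bd (hS : StripIn Ω p τ ν ℓ) (ho : IsOpen Ω) (hf : Fld u X Ω)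
    (hp : ∀ t > (0:ℝ), Tendsto u (𝓝[Ω] (p + t • ν)) atTop)
    (hm : ∀ t > (0:ℝ), Tendsto u (𝓝[Ω] (p + ℓ • τ + t • ν)) atBot) (n : ℕ) :
    ∫ z in Ω, sfun p τ ν ℓ (prof n) z * (1 + dotp (X z) τ)
      ≤ ℓ * stpC * (volume (sbox p τ ν ℓ 1 2)).toReal := by
  have hl := hS.lpos
  have e1 : ∀ m : ℕ, (0:ℝ) < 1 / ((m:ℝ) + 4) ∧ 1 / ((m:ℝ) + 4) ≤ 1 / 4 := fun m =>
    ⟨by positivity, one_div_le_one_div_of_le (by norm_num) (by linarith [(Nat.cast_nonneg m : (0:ℝ) ≤ m)])⟩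
  have hb : IntegrableOn (fun z => sfun p τ ν ℓ (prof n) z * (1 + dotp (X z) τ)) Ω := by
    simpa using hS.int_rq ho hf n (g := fun _ => 1) continuousOn_const (fun z _ => by simp)
  have htc : ∀ η, ContinuousOn (fun z => trap η (dotp (z - p) τ / ℓ)) Ω := fun η =>
    ((trap_cont η).comp ((dotp_cont τ p).div_const ℓ)).continuousOn
  have hlim : Tendsto (fun m : ℕ => 1 / ((m:ℝ) + 4)) atTop (𝓝 0) :=
    tendsto_const_nhds.div_atTop (tendsto_atTop_add_const_right _ _ tendsto_natCast_atTop_atTop)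
  have ht : Tendsto (fun m : ℕ => ∫ z in Ω, sfun p τ ν ℓ (prof n) z *
      trap (1 / ((m:ℝ) + 4)) (dotp (z - p) τ / ℓ) * (1 + dotp (X z) τ)) atTop
      (𝓝 (∫ z in Ω, sfun p τ ν ℓ (prof n) z * (1 + dotp (X z) τ))) := by
    apply tendsto_integral_of_dominated_convergence
      (fun z => sfun p τ ν ℓ (prof n) z * (1 + dotp (X z) τ)) _ hb
    · intro m
      refine (ae_restrict_iff' ho.measurableSet).2 (Eventually.of_forall fun z hz => ?_)
      have h3 := hS.q_bd (hf.sq_le hz)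
      have h4 := sfun_prof_nonneg (p := p) (τ := τ) (ν := ν) (ℓ := ℓ) n z
      have h5 := trap_nonneg (1 / ((m:ℝ) + 4)) (dotp (z - p) τ / ℓ)
      rw [Real.norm_eq_abs, abs_of_nonneg (mul_nonneg (mul_nonneg h4 h5) h3.1)]
      exact mul_le_mul_of_nonneg_right (mul_le_of_le_one_right h4 (trap_le_one _ _)) h3.1
    · refine (ae_restrict_iff' ho.measurableSet).2 (Eventually.of_forall fun z hz => ?_)
      by_cases hU : z ∈ strU p τ ν ℓ
      · have y0 : 0 < dotp (z - p) τ / ℓ := div_pos hU.1 hl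
        have y1 : dotp (z - p) τ / ℓ < 1 := (div_lt_one hl).2 hU.2.1
        apply tendsto_const_nhds.congr'
        have a1 := (hlim.const_mul 2).eventually (gt_mem_nhds (by simpa using y0))
        have a2 := (hlim.const_mul 2).eventually (gt_mem_nhds
          (by simpa using y1 : 2 * 0 < 1 - dotp (z - p) τ / ℓ))
        filter_upwards [a1, a2] with m m1 m2
        rw [trap_eq_one (e1 m).1 m1.le (by linarith), mul_one]
      · have : sfun p τ ν ℓ (prof n) z = 0 := indicator_of_notMem hU _
        simp [this]
    · intro m
      exact (hS.int_rq ho hf n (htc (1 / ((m:ℝ) + 4))) (fun z _ => abs_le.2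
        ⟨by linarith [trap_nonneg (1 / ((m:ℝ) + 4)) (dotp (z - p) τ / ℓ)], trap_le_one _ _⟩)).aestronglyMeasurable
  exact le_of_tendsto ht (Eventually.of_forall fun m =>
    hS.trap_int ho hf hp hm (e1 m).1 (e1 m).2 n)

lemma prof_mono {m n : ℕ} (h : m ≤ n) (t : ℝ) : prof m t ≤ prof n t := by
  unfold prof
  have : (m:ℝ) ≤ n := by exact_mod_cast h
  linarith [stp_mono (by linarith : t - 1 - n ≤ t - 1 - m)]

lemma sfun_prof_mono {m n : ℕ} (h : m ≤ n) (z : ℝ × ℝ) :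
    sfun p τ ν ℓ (prof m) z ≤ sfun p τ ν ℓ (prof n) z := by
  unfold sfun
  exact indicator_le_indicator (prof_mono h _)

lemma StripIn.rq_diff (hS : StripIn Ω p τ ν ℓ) (ho : IsOpen Ω) (hf : Fld u X Ω)
    (hp : ∀ t > (0:ℝ), Tendsto u (𝓝[Ω] (p + t • ν)) atTop)
    (hm : ∀ t > (0:ℝ), Tendsto u (𝓝[Ω] (p + ℓ • τ + t • ν)) atBot) :
    Tendsto (fun n : ℕ => ∫ z in Ω, (sfun p τ ν ℓ (prof (n + 2)) z - sfun p τ ν ℓ (prof n) z) *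
      (1 + dotp (X z) τ)) atTop (𝓝 0) := by
  have hb : ∀ n : ℕ, IntegrableOn (fun z => sfun p τ ν ℓ (prof n) z * (1 + dotp (X z) τ)) Ω := by
    intro n
    simpa using hS.int_rq ho hf n (g := fun _ => 1) continuousOn_const (fun z _ => by simp)
  set A : ℕ → ℝ := fun n => ∫ z in Ω, sfun p τ ν ℓ (prof n) z * (1 + dotp (X z) τ) with hA
  have hmono : Monotone A := by
    intro m n h
    exact setIntegral_mono_on (hb m) (hb n) ho.measurableSet fun z hz =>
      mul_le_mul_of_nonneg_right (sfun_prof_mono h z) (hS.q_bd (hf.sq_le hz)).1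
  have hbd : BddAbove (range A) := by
    refine ⟨ℓ * stpC * (volume (sbox p τ ν ℓ 1 2)).toReal, ?_⟩
    rintro _ ⟨n, rfl⟩
    exact hS.rq_bd ho hf hp hm n
  have ht := tendsto_atTop_ciSup hmono hbd
  have := ((tendsto_add_atTop_iff_nat 2).2 ht).sub ht
  rw [sub_self] at this
  refine this.congr fun n => ?_
  rw [hA]
  simp only
  rw [← integral_sub (hb _) (hb _)]
  congr 1; ext z; ring

end

section
variable {Ω : Set (ℝ × ℝ)} {p τ ν : ℝ × ℝ} {ℓ : ℝ} {u u₁ u₂ : ℝ × ℝ → ℝ} {X X₁ X₂ : ℝ × ℝ → ℝ × ℝ}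

/-- far cutoff in a strip -/
noncomputable def sig (p τ ν : ℝ × ℝ) (ℓ : ℝ) (n : ℕ) : ℝ × ℝ → ℝ :=
  sfun p τ ν ℓ (fun t => stp (t - (n + 2)))

lemma sig_left (n : ℕ) : ∀ t ≤ (1:ℝ), stp (t - (n + 2)) = 0 := by
  intro t ht
  exact stp_left (by linarith [(Nat.cast_nonneg n : (0:ℝ) ≤ n)])

lemma StripIn.sig_cd (hS : StripIn Ω p τ ν ℓ) (n : ℕ) : ContDiffOn ℝ 1 (sig p τ ν ℓ n) Ω :=
  hS.cd (sig_left n) (stp_shift_cd _)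

lemma StripIn.sig_fd (hS : StripIn Ω p τ ν ℓ) (n : ℕ) {z : ℝ × ℝ} (hz : z ∈ Ω) (v : ℝ × ℝ) :
    fderiv ℝ (sig p τ ν ℓ n) z v = sfun p τ ν ℓ (fun t => stp' (t - (n + 2))) z * dotp v ν :=
  hS.fd (sig_left n) (stp_shift _) hz v

lemma stp'_abs (t : ℝ) : |stp' t| ≤ stpC := by
  rw [abs_of_nonneg (stp'_nonneg t)]; exact stp'_le t

lemma StripIn.sig_bdd (hS : StripIn Ω p τ ν ℓ) (n : ℕ) {z : ℝ × ℝ} (hz : z ∈ Ω) :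
    ‖fderiv ℝ (sig p τ ν ℓ n) z‖ ≤ stpC * 2 :=
  hS.fd_bdd (sig_left n) (stp_shift _) stpC_pos.le (fun _ => stp'_abs _) hz

lemma sig_nonneg (n : ℕ) (z : ℝ × ℝ) : 0 ≤ sig p τ ν ℓ n z := by
  unfold sig sfun
  by_cases hU : z ∈ strU p τ ν ℓ
  · rw [indicator_of_mem hU]; exact stp_nonneg _
  · rw [indicator_of_notMem hU]

lemma sig_dom (n : ℕ) (z : ℝ × ℝ) : |sfun p τ ν ℓ (fun t => stp' (t - (n + 2))) z| ≤
    stpC * (sfun p τ ν ℓ (prof (n + 2)) z - sfun p τ ν ℓ (prof n) z) := by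
  unfold sfun
  by_cases hU : z ∈ strU p τ ν ℓ
  · simp only [indicator_of_mem hU]
    set t := dotp (z - p) ν
    have hC := stpC_pos
    have h0 := prof_mono (by omega : n ≤ n + 2) t
    rcases le_or_gt t (n + 2) with h | h
    · rw [stp'_left (by linarith), abs_zero]
      exact mul_nonneg hC.le (sub_nonneg.2 h0)
    · rcases le_or_gt (n + 3 : ℝ) t with h' | h'
      · rw [stp'_right (by linarith), abs_zero]
        exact mul_nonneg hC.le (sub_nonneg.2 h0)
      · have : prof (n + 2) t - prof n t = 1 := by
          unfold prof
          rw [stp_right (x := t - 1 - n) (by linarith), stp_left (x := t - 1 - (n + 2 : ℕ))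
            (by push_cast; linarith)]
          ring
        rw [this, mul_one]; exact stp'_abs _
  · simp only [indicator_of_notMem hU]; simp

lemma prof_diff_box (n : ℕ) (z : ℝ × ℝ) :
    sfun p τ ν ℓ (prof (n + 2)) z - sfun p τ ν ℓ (prof n) z ≤
      indicator (sbox p τ ν ℓ (1 + n) (4 + n)) (fun _ => (1:ℝ)) z := by
  by_cases hb : z ∈ sbox p τ ν ℓ (1 + n) (4 + n)
  · rw [indicator_of_mem hb]
    linarith [sfun_prof_nonneg (p := p) (τ := τ) (ν := ν) (ℓ := ℓ) n z,
      sfun_prof_le_one (p := p) (τ := τ) (ν := ν) (ℓ := ℓ) (n + 2) z]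
  · rw [indicator_of_notMem hb]
    unfold sfun
    by_cases hU : z ∈ strU p τ ν ℓ
    · simp only [indicator_of_mem hU]
      set t := dotp (z - p) ν with ht
      unfold prof
      rcases le_or_gt t (1 + n) with h | h
      · rw [stp_left (x := t - 1 - n) (by linarith), stp_left (x := t - 1 - (n + 2 : ℕ))
            (by push_cast; linarith)]
        simp
      · rcases le_or_gt (4 + n : ℝ) t with h' | h'
        · rw [stp_right (x := t - 1 - n) (by linarith), stp_right (x := t - 1 - (n + 2 : ℕ))
            (by push_cast; linarith)]
          simp
        · exact absurd ⟨hU.1.le, hU.2.1.le, h.le, h'.le⟩ hb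
    · simp only [indicator_of_notMem hU]; simp

lemma StripIn.sig_int (hS : StripIn Ω p τ ν ℓ) (ho : IsOpen Ω) {Z : ℝ × ℝ → ℝ × ℝ}
    (hZ : ContinuousOn Z Ω) (hZb : ∀ z ∈ Ω, ‖Z z‖ ≤ 2) (n : ℕ) :
    IntegrableOn (fun z => |fderiv ℝ (sig p τ ν ℓ n) z (Z z)|) Ω := by
  apply integrableOn_bdd ho (hS.box_compact 1 (n + 3)) (M := stpC * 2 * 2)
  · exact (cont_fd ho (hS.sig_cd n) hZ).abs
  · intro z hz
    rw [abs_abs]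
    have h1 := (fderiv ℝ (sig p τ ν ℓ n) z).le_opNorm (Z z)
    rw [Real.norm_eq_abs] at h1
    exact h1.trans (mul_le_mul (hS.sig_bdd n hz) (hZb z hz) (norm_nonneg _)
      (mul_nonneg stpC_pos.le zero_le_two))
  · intro z hz hzK
    rw [hS.sig_fd n hz, abs_eq_zero]
    unfold sfun
    by_cases hU : z ∈ strU p τ ν ℓ
    · simp only [indicator_of_mem hU]
      rcases le_or_gt (dotp (z - p) ν) (n + 2) with h1 | h1
      · rw [stp'_left (by linarith), zero_mul]
      · rcases le_or_gt (n + 3 : ℝ) (dotp (z - p) ν) with h2 | h2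
        · rw [stp'_right (by linarith), zero_mul]
        · exact absurd ⟨hU.1.le, hU.2.1.le, by linarith [(Nat.cast_nonneg n : (0:ℝ) ≤ n)], h2.le⟩ hzK
    · rw [indicator_of_notMem hU, zero_mul]

lemma abs_young {x e : ℝ} (he : 0 < e) : |x| ≤ e + x ^ 2 / e := by
  rw [← sq_abs]
  have : |x| * e ≤ (e + |x| ^ 2 / e) * e := by
    have : (e + |x| ^ 2 / e) * e = e ^ 2 + |x| ^ 2 := by field_simp
    nlinarith [sq_nonneg (|x| - e)]
  exact le_of_mul_le_mul_right this he

lemma StripIn.sig_tail (hS : StripIn Ω p τ ν ℓ) (ho : IsOpen Ω) (h₁ : Fld u₁ X₁ Ω)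
    (h₂ : Fld u₂ X₂ Ω)
    (hp₁ : ∀ t > (0:ℝ), Tendsto u₁ (𝓝[Ω] (p + t • ν)) atTop)
    (hm₁ : ∀ t > (0:ℝ), Tendsto u₁ (𝓝[Ω] (p + ℓ • τ + t • ν)) atBot)
    (hp₂ : ∀ t > (0:ℝ), Tendsto u₂ (𝓝[Ω] (p + t • ν)) atTop)
    (hm₂ : ∀ t > (0:ℝ), Tendsto u₂ (𝓝[Ω] (p + ℓ • τ + t • ν)) atBot) :
    Tendsto (fun n : ℕ => ∫ z in Ω, |fderiv ℝ (sig p τ ν ℓ n) z (X₁ z - X₂ z)|) atTop (𝓝 0) := by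
  have l1 := hS.rq_diff ho h₁ hp₁ hm₁
  have l2 := hS.rq_diff ho h₂ hp₂ hm₂
  set D : ℕ → ℝ × ℝ → ℝ := fun n z => sfun p τ ν ℓ (prof (n + 2)) z - sfun p τ ν ℓ (prof n) z with hD
  set V := (volume (sbox p τ ν ℓ 1 4)).toReal
  have hV : 0 ≤ V := ENNReal.toReal_nonneg
  have hC := stpC_pos
  have hq : ∀ {u X}, Fld u X Ω → ∀ n : ℕ, IntegrableOn (fun z => D n z * (1 + dotp (X z) τ)) Ω := by
    intro u X hf n
    have a := hS.int_rq ho hf n (g := fun _ => 1) continuousOn_const (fun z _ => by simp)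
    have b := hS.int_rq ho hf (n + 2) (g := fun _ => 1) continuousOn_const (fun z _ => by simp)
    refine (b.sub a).congr (Eventually.of_forall fun z => ?_)
    simp [hD]; ring
  have key : ∀ (n : ℕ) (e : ℝ), 0 < e →
      ∫ z in Ω, |fderiv ℝ (sig p τ ν ℓ n) z (X₁ z - X₂ z)| ≤
        stpC * (e * V + 4 / e * ((∫ z in Ω, D n z * (1 + dotp (X₁ z) τ)) +
          ∫ z in Ω, D n z * (1 + dotp (X₂ z) τ))) := by
    intro n e he
    obtain ⟨b1, b1'⟩ := hS.box_int (1 + n) (4 + n)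
    rw [hS.box_vol 1 4 n] at b1'
    have i1 := (b1.integrableOn (s := Ω)).const_mul e
    have i2 := ((hq h₁ n).add (hq h₂ n)).const_mul (4 / e)
    have i3 := (i1.add i2).const_mul stpC
    have hmono := setIntegral_mono_on (hS.sig_int ho ((h₁.df.sub ho h₂.df).cd.continuousOn)
      (norm_sub_le_two (fun z hz => h₁.sq_le hz) (fun z hz => h₂.sq_le hz)) n) i3 ho.measurableSet (by
      intro z hz
      have q1 := hS.q_bd (h₁.sq_le hz)
      have q2 := hS.q_bd (h₂.sq_le hz)
      have hd := sig_dom (p := p) (τ := τ) (ν := ν) (ℓ := ℓ) n z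
      have hb := prof_diff_box (p := p) (τ := τ) (ν := ν) (ℓ := ℓ) n z
      have hD0 : 0 ≤ D n z := sub_nonneg.2 (sfun_prof_mono (by omega) z)
      change _ ≤ stpC * D n z at hd
      change D n z ≤ _ at hb
      rw [hS.sig_fd n hz, abs_mul]
      simp only [Pi.add_apply]
      have ey := abs_young (x := dotp (X₁ z - X₂ z) ν) he
      have es : dotp (X₁ z - X₂ z) ν ^ 2 ≤ 4 * ((1 + dotp (X₁ z) τ) + (1 + dotp (X₂ z) τ)) := by
        rw [dotp_sub_left]
        nlinarith [sq_nonneg (dotp (X₁ z) ν + dotp (X₂ z) ν)]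
      have es2 : dotp (X₁ z - X₂ z) ν ^ 2 / e ≤
          4 / e * ((1 + dotp (X₁ z) τ) + (1 + dotp (X₂ z) τ)) := by
        rw [div_mul_eq_mul_div]
        exact div_le_div_of_nonneg_right es he.le
      calc _ ≤ (stpC * D n z) * (e + 4 / e * ((1 + dotp (X₁ z) τ) + (1 + dotp (X₂ z) τ))) :=
            mul_le_mul hd (by linarith) (abs_nonneg _) (by positivity)
        _ = stpC * (e * D n z + 4 / e * (D n z * (1 + dotp (X₁ z) τ) +
            D n z * (1 + dotp (X₂ z) τ))) := by ring
        _ ≤ _ := by gcongr)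
    refine hmono.trans ?_
    rw [integral_const_mul, integral_add' i1 i2, integral_const_mul, integral_const_mul,
      integral_add' (hq h₁ n) (hq h₂ n)]
    gcongr
  rw [tendsto_order]
  refine ⟨fun a ha => Eventually.of_forall fun n => lt_of_lt_of_le ha
    (integral_nonneg fun z => abs_nonneg _), fun a ha => ?_⟩
  set e := a / (2 * stpC * (V + 1)) with he
  have he0 : 0 < e := by positivity
  have l3 := ((l1.add l2).const_mul (4 / e)).const_add (e * V) |>.const_mul stpC
  have hlt : stpC * (e * V + 4 / e * (0 + 0)) < a := by
    have : stpC * e * (V + 1) = a / 2 := by rw [he]; field_simp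
    nlinarith [mul_pos hC he0]
  filter_upwards [l3.eventually (gt_mem_nhds hlt)] with n hn
  exact (key n e he0).trans_lt hn

end

/-- squared distance -/
noncomputable def sqd (P z : ℝ × ℝ) : ℝ := (z.1 - P.1) ^ 2 + (z.2 - P.2) ^ 2

/-- vertex cutoff -/
noncomputable def vc (P : ℝ × ℝ) (δ : ℝ) (z : ℝ × ℝ) : ℝ := 1 - stp (sqd P z / δ ^ 2 - 1)

lemma sqd_cd (P : ℝ × ℝ) : ContDiff ℝ 1 (sqd P) := by
  unfold sqd; fun_prop

lemma sqd_nonneg (P z : ℝ × ℝ) : 0 ≤ sqd P z := by unfold sqd; positivity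

lemma sqd_fd (P z v : ℝ × ℝ) : fderiv ℝ (sqd P) z v = 2 * dotp v (z - P) := by
  have h1 := (hasFDerivAt_fst (𝕜 := ℝ) (p := z)).sub_const P.1
  have h2 := (hasFDerivAt_snd (𝕜 := ℝ) (p := z)).sub_const P.2
  have h3 := (h1.pow 2).fun_add (h2.pow 2)
  have e : fderiv ℝ (sqd P) z = _ := h3.fderiv
  rw [e]; unfold dotp; simp; ring

lemma vc_cd (P : ℝ × ℝ) (δ : ℝ) : ContDiff ℝ 1 (vc P δ) :=
  contDiff_const.sub (stp_contDiff.comp (((sqd_cd P).div_const _).sub contDiff_const))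

lemma vc_fd (P : ℝ × ℝ) (δ : ℝ) (z v : ℝ × ℝ) :
    fderiv ℝ (vc P δ) z v = -(stp' (sqd P z / δ ^ 2 - 1) * (2 * dotp v (z - P) / δ ^ 2)) := by
  have hA := ((sqd_cd P).differentiable one_ne_zero z).hasFDerivAt
  have h1 : HasFDerivAt (fun z => sqd P z / δ ^ 2 - 1) ((δ ^ 2)⁻¹ • fderiv ℝ (sqd P) z) z := by
    have := (hA.mul_const (δ ^ 2)⁻¹).sub_const 1
    simpa only [div_eq_mul_inv] using this
  have h2 := ((stp_hasDerivAt (sqd P z / δ ^ 2 - 1)).comp_hasFDerivAt z h1).const_sub 1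
  have e : fderiv ℝ (vc P δ) z = _ := h2.fderiv
  rw [e]
  simp only [neg_apply, smul_apply, smul_eq_mul, sqd_fd]
  ring

lemma vc_nonneg (P : ℝ × ℝ) (δ : ℝ) (z : ℝ × ℝ) : 0 ≤ vc P δ z := by
  unfold vc; linarith [stp_le_one (sqd P z / δ ^ 2 - 1)]

lemma vc_near {P : ℝ × ℝ} {δ : ℝ} (hδ : 0 < δ) {z : ℝ × ℝ} (h : sqd P z ≤ δ ^ 2) : vc P δ z = 1 := by
  have : sqd P z / δ ^ 2 ≤ 1 := (div_le_one (by positivity)).2 h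
  unfold vc; rw [stp_left (by linarith), sub_zero]

lemma vc_far {P : ℝ × ℝ} {δ : ℝ} (hδ : 0 < δ) {z : ℝ × ℝ} (h : 2 * δ ^ 2 ≤ sqd P z) : vc P δ z = 0 := by
  have : 2 ≤ sqd P z / δ ^ 2 := (le_div_iff₀ (by positivity)).2 h
  unfold vc; rw [stp_right (by linarith), sub_self]

lemma vc_fd_bd {P : ℝ × ℝ} {δ : ℝ} (hδ : 0 < δ) (z v : ℝ × ℝ) :
    |fderiv ℝ (vc P δ) z v| ≤ stpC * (8 / δ) * ‖v‖ *
      indicator (Metric.closedBall P (2 * δ)) (fun _ => (1:ℝ)) z := by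
  rw [vc_fd, abs_neg, abs_mul]
  have hC := stpC_pos
  have hind : 0 ≤ indicator (Metric.closedBall P (2 * δ)) (fun _ => (1:ℝ)) z := by
    by_cases hb : z ∈ Metric.closedBall P (2 * δ)
    · rw [indicator_of_mem hb]; exact zero_le_one
    · rw [indicator_of_notMem hb]
  rcases le_or_gt (2 * δ ^ 2) (sqd P z) with h | h
  · have : 2 ≤ sqd P z / δ ^ 2 := (le_div_iff₀ (by positivity)).2 h
    rw [stp'_right (by linarith), abs_zero, zero_mul]
    positivity
  · have a1 : |z.1 - P.1| ≤ 2 * δ := abs_le_of_sq_le_sq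
      (by unfold sqd at h; nlinarith [sq_nonneg (z.2 - P.2)]) (by positivity)
    have a2 : |z.2 - P.2| ≤ 2 * δ := abs_le_of_sq_le_sq
      (by unfold sqd at h; nlinarith [sq_nonneg (z.1 - P.1)]) (by positivity)
    have hb : z ∈ Metric.closedBall P (2 * δ) := by
      rw [Metric.mem_closedBall, dist_eq_norm, Prod.norm_def]
      exact max_le a1 a2
    rw [indicator_of_mem hb, mul_one]
    have b1 : |v.1| ≤ ‖v‖ := norm_fst_le v
    have b2 : |v.2| ≤ ‖v‖ := norm_snd_le v
    have hd : |dotp v (z - P)| ≤ 4 * δ * ‖v‖ := by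
      unfold dotp
      have := abs_add_le (v.1 * (z - P).1) (v.2 * (z - P).2)
      rw [abs_mul, abs_mul] at this
      have c1 : |v.1| * |(z - P).1| ≤ ‖v‖ * (2 * δ) :=
        mul_le_mul b1 a1 (abs_nonneg _) (norm_nonneg _)
      have c2 : |v.2| * |(z - P).2| ≤ ‖v‖ * (2 * δ) :=
        mul_le_mul b2 a2 (abs_nonneg _) (norm_nonneg _)
      linarith
    have hd2 : |2 * dotp v (z - P) / δ ^ 2| ≤ 8 / δ * ‖v‖ := by
      rw [abs_div, abs_mul, abs_of_pos (by positivity : 0 < δ ^ 2), div_le_iff₀ (by positivity),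
        abs_two]
      have : 8 / δ * ‖v‖ * δ ^ 2 = 8 * δ * ‖v‖ := by field_simp
      rw [this]; linarith
    calc _ ≤ stpC * (8 / δ * ‖v‖) := mul_le_mul (stp'_abs _) hd2 (abs_nonneg _) hC.le
      _ = _ := by ring

lemma vc_bdd {P : ℝ × ℝ} {δ : ℝ} (hδ : 0 < δ) (z : ℝ × ℝ) :
    ‖fderiv ℝ (vc P δ) z‖ ≤ stpC * (8 / δ) := by
  have hC := stpC_pos
  apply ContinuousLinearMap.opNorm_le_bound _ (by positivity)
  intro v
  refine (vc_fd_bd hδ z v).trans (mul_le_of_le_one_right (by positivity) ?_)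
  by_cases hb : z ∈ Metric.closedBall P (2 * δ)
  · rw [indicator_of_mem hb]
  · rw [indicator_of_notMem hb]; exact zero_le_one

lemma vc_int {Ω : Set (ℝ × ℝ)} (ho : IsOpen Ω) {Z : ℝ × ℝ → ℝ × ℝ}
    (hZ : ContinuousOn Z Ω) (hZb : ∀ z ∈ Ω, ‖Z z‖ ≤ 2) (P : ℝ × ℝ) {δ : ℝ} (hδ : 0 < δ) :
    IntegrableOn (fun z => |fderiv ℝ (vc P δ) z (Z z)|) Ω ∧
    ∫ z in Ω, |fderiv ℝ (vc P δ) z (Z z)| ≤ 256 * stpC * δ := by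
  have hC := stpC_pos
  have hK : IsCompact (Metric.closedBall P (2 * δ)) := isCompact_closedBall _ _
  have pw : ∀ z ∈ Ω, |fderiv ℝ (vc P δ) z (Z z)| ≤ stpC * (16 / δ) *
      indicator (Metric.closedBall P (2 * δ)) (fun _ => (1:ℝ)) z := by
    intro z hz
    refine (vc_fd_bd hδ z _).trans ?_
    apply mul_le_mul_of_nonneg_right
    · calc stpC * (8 / δ) * ‖Z z‖ ≤ stpC * (8 / δ) * 2 :=
            mul_le_mul_of_nonneg_left (hZb z hz) (by positivity)
        _ = _ := by ring
    · exact indicator_nonneg (fun _ _ => zero_le_one) z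
  have hi : IntegrableOn (fun z => |fderiv ℝ (vc P δ) z (Z z)|) Ω := by
    apply integrableOn_bdd ho hK (M := stpC * (16 / δ))
    · exact (cont_fd ho (vc_cd P δ).contDiffOn hZ).abs
    · intro z hz
      rw [abs_abs]
      refine (pw z hz).trans (mul_le_of_le_one_right (by positivity) ?_)
      by_cases hb : z ∈ Metric.closedBall P (2 * δ)
      · rw [indicator_of_mem hb]
      · rw [indicator_of_notMem hb]; exact zero_le_one
    · intro z hz hzK
      have := pw z hz
      rw [indicator_of_notMem hzK, mul_zero] at this
      exact le_antisymm this (abs_nonneg _)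
  refine ⟨hi, ?_⟩
  have hI : Integrable (indicator (Metric.closedBall P (2 * δ)) (fun _ => (1:ℝ))) :=
    (integrable_indicator_iff hK.measurableSet).2 (integrableOn_const hK.measure_lt_top.ne)
  refine (setIntegral_mono_on hi (hI.integrableOn.const_mul _) ho.measurableSet pw).trans ?_
  rw [integral_const_mul]
  have hv : ∫ z in Ω, indicator (Metric.closedBall P (2 * δ)) (fun _ => (1:ℝ)) z ≤ (4 * δ) ^ 2 := by
    refine (setIntegral_le_integral hI (Eventually.of_forall
      (fun z => indicator_nonneg (fun _ _ => zero_le_one) z))).trans (le_of_eq ?_)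
    rw [integral_indicator hK.measurableSet]
    have : Metric.closedBall P (2 * δ) = Metric.closedBall P.1 (2 * δ) ×ˢ Metric.closedBall P.2 (2 * δ) :=
      (closedBall_prod_same P.1 P.2 _).symm
    rw [this]
    simp only [integral_const, smul_eq_mul, mul_one, Measure.real, Measure.restrict_apply_univ]
    rw [Measure.volume_eq_prod, Measure.prod_prod, Real.volume_closedBall, Real.volume_closedBall,
      ENNReal.toReal_mul, ENNReal.toReal_ofReal (by positivity)]
    ring
  calc _ ≤ stpC * (16 / δ) * (4 * δ) ^ 2 := mul_le_mul_of_nonneg_left hv (by positivity)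
    _ = _ := by field_simp; ring

section
variable {ι : Type} {Ω K : Set (ℝ × ℝ)} {s : Finset ι} {g : ι → ℝ × ℝ → ℝ}

lemma rho_fd (ho : IsOpen Ω) (hcd : ∀ i ∈ s, ContDiffOn ℝ 1 (g i) Ω) {z : ℝ × ℝ} (hz : z ∈ Ω) :
    fderiv ℝ (fun z => 1 - stp (∑ i ∈ s, g i z)) z =
      -(stp' (∑ i ∈ s, g i z) • ∑ i ∈ s, fderiv ℝ (g i) z) := by
  have h1 : HasFDerivAt (fun z => ∑ i ∈ s, g i z) (∑ i ∈ s, fderiv ℝ (g i) z) z :=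
    HasFDerivAt.fun_sum fun i hi => (diffAt ho (hcd i hi) hz).hasFDerivAt
  have h2 := ((stp_hasDerivAt (∑ i ∈ s, g i z)).comp_hasFDerivAt z h1).const_sub 1
  exact h2.fderiv

lemma rho_adm (ho : IsOpen Ω) (hcd : ∀ i ∈ s, ContDiffOn ℝ 1 (g i) Ω)
    (hbd : ∀ i, ∃ M, ∀ z ∈ Ω, ‖fderiv ℝ (g i) z‖ ≤ M)
    (hK : IsCompact K) (hnn : ∀ i ∈ s, ∀ z, 0 ≤ g i z)
    (h0 : ∀ z ∈ Ω, z ∉ K → ∃ i ∈ s, 1 ≤ g i z) :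
    Adm (fun z => 1 - stp (∑ i ∈ s, g i z)) Ω K := by
  choose M hM using hbd
  refine ⟨?_, fun z _ => by linarith [stp_le_one (∑ i ∈ s, g i z)],
    fun z _ => by linarith [stp_nonneg (∑ i ∈ s, g i z)], hK, ?_, ?_⟩
  · exact contDiffOn_const.sub (stp_contDiff.comp_contDiffOn (ContDiffOn.sum hcd))
  · intro z hz hzK
    obtain ⟨i, hi, h1⟩ := h0 z hz hzK
    have : 1 ≤ ∑ i ∈ s, g i z :=
      h1.trans (Finset.single_le_sum (f := fun i => g i z) (fun j hj => hnn j hj z) hi)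
    change 1 - stp (∑ i ∈ s, g i z) = 0
    rw [stp_right this, sub_self]
  · refine ⟨stpC * ∑ i ∈ s, M i, fun z hz => ?_⟩
    rw [rho_fd ho hcd hz, norm_neg, norm_smul]
    exact mul_le_mul (stp'_abs _) ((norm_sum_le _ _).trans (Finset.sum_le_sum fun i _ => hM i z hz))
      (norm_nonneg _) stpC_pos.le

lemma rho_int (ho : IsOpen Ω) (hcd : ∀ i ∈ s, ContDiffOn ℝ 1 (g i) Ω) {Z : ℝ × ℝ → ℝ × ℝ}
    (hi : ∀ i ∈ s, IntegrableOn (fun z => |fderiv ℝ (g i) z (Z z)|) Ω) :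
    ∫ z in Ω, |fderiv ℝ (fun z => 1 - stp (∑ i ∈ s, g i z)) z (Z z)| ≤
      stpC * ∑ i ∈ s, ∫ z in Ω, |fderiv ℝ (g i) z (Z z)| := by
  rw [← integral_finsetSum _ hi, ← integral_const_mul]
  apply integral_mono_of_nonneg (Eventually.of_forall fun z => abs_nonneg _)
    ((integrable_finsetSum _ hi).const_mul _)
  refine (ae_restrict_iff' ho.measurableSet).2 (Eventually.of_forall fun z hz => ?_)
  simp only
  rw [rho_fd ho hcd hz]
  simp only [neg_apply, smul_apply, smul_eq_mul, abs_neg, abs_mul, sum_apply]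
  exact mul_le_mul (stp'_abs _) (Finset.abs_sum_le_sum_abs _ _) (abs_nonneg _) stpC_pos.le
end

section
variable {r : ℕ} {P ν : ℕ → ℝ × ℝ} {u u₁ u₂ : ℝ × ℝ → ℝ} {X₁ X₂ : ℝ × ℝ → ℝ × ℝ}

lemma stripIn_of (h : IsConvexPolygonData r P ν) (hb : Blow P ν u (interior (OmegaV r P ν))) (i : ℕ) :
    StripIn (interior (OmegaV r P ν)) (P i) (tau P i) (ν i) (ell P i) :=
  ⟨frame h i, ell_pos h i, strU_sub h i, fun _ ht => left_out hb i ht, fun t ht => by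
    rw [← P_succ h i]; exact right_out hb i ht⟩

/-- the family of cutoffs -/
noncomputable def fam (P ν : ℕ → ℝ × ℝ) (n : ℕ) : ℕ ⊕ ℕ → ℝ × ℝ → ℝ
  | Sum.inl i => vc (P i) (1 / ((n:ℝ) + 1))
  | Sum.inr i => sig (P i) (tau P i) (ν i) (ell P i) n

/-- index set of the cutoffs -/
def fidx (r : ℕ) : Finset (ℕ ⊕ ℕ) := (Finset.range r).disjSum (Finset.range r)

/-- the compact set carrying the cutoff -/
def bigK (r : ℕ) (P ν : ℕ → ℝ × ℝ) (n : ℕ) : Set (ℝ × ℝ) :=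
  (polyHull r P ∪ ⋃ i ∈ Iio r, sbox (P i) (tau P i) (ν i) (ell P i) 0 (n + 3)) \
    ⋃ i ∈ Iio r, {z | sqd (P i) z < (1 / ((n:ℝ) + 1)) ^ 2}

lemma bigK_compact (h : IsConvexPolygonData r P ν) (hb : Blow P ν u (interior (OmegaV r P ν))) (n : ℕ) :
    IsCompact (bigK r P ν n) := by
  apply IsCompact.diff
  · exact hull_compact.union ((finite_Iio r).isCompact_biUnion fun i _ =>
      (stripIn_of h hb i).box_compact _ _)
  · exact isOpen_biUnion fun i _ => isOpen_lt (sqd_cd (P i)).continuous continuous_const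

lemma bigK_sub (h : IsConvexPolygonData r P ν) (n : ℕ) : bigK r P ν n ⊆ OmegaV r P ν := by
  rintro z ⟨hz | hz, -⟩
  · exact Or.inl hz
  · simp only [mem_iUnion] at hz
    obtain ⟨i, -, hz⟩ := hz
    apply strip_sub h i
    rw [halfStrip_eq h i]
    exact ⟨hz.1, hz.2.1, hz.2.2.1⟩

lemma bigK_vertex (h : IsConvexPolygonData r P ν) (n i : ℕ) : P i ∉ bigK r P ν n := by
  rintro ⟨-, hz⟩
  apply hz
  simp only [mem_iUnion]
  refine ⟨i % r, modlt h i, ?_⟩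
  rw [Pmod h i]
  change sqd (P i) (P i) < (1 / ((n:ℝ) + 1)) ^ 2
  have : sqd (P i) (P i) = 0 := by simp [sqd]
  rw [this]
  positivity

lemma bigK_blow (h : IsConvexPolygonData r P ν) (h₁ : Blow P ν u₁ (interior (OmegaV r P ν)))
    (h₂ : Blow P ν u₂ (interior (OmegaV r P ν))) (n : ℕ) :
    SameBlow u₁ u₂ (interior (OmegaV r P ν)) (bigK r P ν n) := by
  intro z hz hzo
  rcases omega_cases h h₁ (bigK_sub h n hz) with hc | ⟨i, hc⟩ | ⟨i, t, ht, rfl⟩ | ⟨i, t, ht, rfl⟩ | ⟨i, rfl⟩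
  · exact absurd (hull_int_sub hc) hzo
  · exact absurd (W_sub h i hc) hzo
  · exact Or.inl ⟨h₁.plus i t ht, h₂.plus i t ht⟩
  · exact Or.inr ⟨h₁.minus i t ht, h₂.minus i t ht⟩
  · exact absurd hz (bigK_vertex h n i)

lemma tau_mod (h : IsConvexPolygonData r P ν) (i : ℕ) : tau P (i % r) = tau P i := by
  unfold tau ell; rw [Pmod h, Pmod1 h]

lemma ell_mod (h : IsConvexPolygonData r P ν) (i : ℕ) : ell P (i % r) = ell P i := by
  unfold ell; rw [Pmod h, Pmod1 h]

lemma fam_out (h : IsConvexPolygonData r P ν) (hb : Blow P ν u (interior (OmegaV r P ν))) (n : ℕ)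
    {z : ℝ × ℝ} (hz : z ∈ interior (OmegaV r P ν)) (hzK : z ∉ bigK r P ν n) :
    ∃ i ∈ fidx r, 1 ≤ fam P ν n i z := by
  have hδ : (0:ℝ) < 1 / ((n:ℝ) + 1) := by positivity
  have disc : z ∈ polyHull r P ∪ ⋃ i ∈ Iio r, sbox (P i) (tau P i) (ν i) (ell P i) 0 (n + 3) →
      ∃ i ∈ fidx r, 1 ≤ fam P ν n i z := by
    intro hK
    have : z ∈ ⋃ i ∈ Iio r, {z | sqd (P i) z < (1 / ((n:ℝ) + 1)) ^ 2} := by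
      by_contra hno
      exact hzK ⟨hK, hno⟩
    simp only [mem_iUnion] at this
    obtain ⟨i, hi, hs⟩ := this
    refine ⟨Sum.inl i, by simpa [fidx] using hi, ?_⟩
    change 1 ≤ vc (P i) (1 / ((n:ℝ) + 1)) z
    rw [vc_near hδ (le_of_lt hs)]
  rcases omega_mem_cases h hb hz with hc | ⟨i, h1, h2, h3⟩ | ⟨i, rfl⟩
  · exact disc (Or.inl (interior_subset hc))
  · rcases le_or_gt (dotp (z - P i) (ν i)) (n + 3) with h4 | h4
    · apply disc
      right
      simp only [mem_iUnion]
      refine ⟨i % r, modlt h i, ?_⟩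
      rw [Pmod h, tau_mod h, νmod h, ell_mod h]
      exact ⟨h1.le, h2.le, h3, h4⟩
    · refine ⟨Sum.inr (i % r), by simpa [fidx] using modlt h i, ?_⟩
      change 1 ≤ sig (P (i % r)) (tau P (i % r)) (ν (i % r)) (ell P (i % r)) n z
      rw [Pmod h, tau_mod h, νmod h, ell_mod h]
      have hn : (0:ℝ) ≤ n := Nat.cast_nonneg n
      have hU : z ∈ strU (P i) (tau P i) (ν i) (ell P i) := ⟨h1, h2, by linarith⟩
      unfold sig sfun
      simp only [indicator_of_mem hU]
      rw [stp_right (by linarith)]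
  · exact disc (Or.inl (P_mem h i))

lemma fam_cd (h : IsConvexPolygonData r P ν) (hb : Blow P ν u (interior (OmegaV r P ν))) (n : ℕ) :
    ∀ i, ContDiffOn ℝ 1 (fam P ν n i) (interior (OmegaV r P ν))
  | Sum.inl _ => (vc_cd _ _).contDiffOn
  | Sum.inr i => (stripIn_of h hb i).sig_cd n

lemma fam_bdd (h : IsConvexPolygonData r P ν) (hb : Blow P ν u (interior (OmegaV r P ν))) (n : ℕ) :
    ∀ i, ∃ M, ∀ z ∈ interior (OmegaV r P ν), ‖fderiv ℝ (fam P ν n i) z‖ ≤ M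
  | Sum.inl _ => ⟨_, fun z _ => vc_bdd (by positivity) z⟩
  | Sum.inr i => ⟨_, fun _ hz => (stripIn_of h hb i).sig_bdd n hz⟩

lemma fam_nonneg (n : ℕ) : ∀ i z, 0 ≤ fam P ν n i z
  | Sum.inl _ => fun z => vc_nonneg _ _ z
  | Sum.inr _ => fun z => sig_nonneg n z

lemma fam_int (h : IsConvexPolygonData r P ν) (hb : Blow P ν u (interior (OmegaV r P ν))) (n : ℕ)
    {Z : ℝ × ℝ → ℝ × ℝ} (hZ : ContinuousOn Z (interior (OmegaV r P ν)))
    (hZb : ∀ z ∈ interior (OmegaV r P ν), ‖Z z‖ ≤ 2) :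
    ∀ i, IntegrableOn (fun z => |fderiv ℝ (fam P ν n i) z (Z z)|) (interior (OmegaV r P ν))
  | Sum.inl _ => (vc_int isOpen_interior hZ hZb _ (by positivity)).1
  | Sum.inr i => (stripIn_of h hb i).sig_int isOpen_interior hZ hZb n

lemma fam_tail (h : IsConvexPolygonData r P ν) (hb₁ : Blow P ν u₁ (interior (OmegaV r P ν)))
    (hb₂ : Blow P ν u₂ (interior (OmegaV r P ν)))
    (h₁ : Fld u₁ X₁ (interior (OmegaV r P ν))) (h₂ : Fld u₂ X₂ (interior (OmegaV r P ν))) :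
    ∀ i, Tendsto (fun n => ∫ z in interior (OmegaV r P ν),
      |fderiv ℝ (fam P ν n i) z (X₁ z - X₂ z)|) atTop (𝓝 0)
  | Sum.inl i => by
    have l : Tendsto (fun n : ℕ => 256 * stpC * (1 / ((n:ℝ) + 1))) atTop (𝓝 0) := by
      simpa using tendsto_one_div_add_atTop_nhds_zero_nat.const_mul (256 * stpC)
    exact squeeze_zero (fun n => integral_nonneg fun z => abs_nonneg _) (fun n =>
      (vc_int isOpen_interior (h₁.df.sub isOpen_interior h₂.df).cd.continuousOn
        (norm_sub_le_two (fun z hz => h₁.sq_le hz) (fun z hz => h₂.sq_le hz)) (P i)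
        (by positivity)).2) l
  | Sum.inr i => (stripIn_of h hb₁ i).sig_tail isOpen_interior h₁ h₂ (hb₁.plus i)
      (fun t ht => by rw [← P_succ h i]; exact hb₁.minus i t ht) (hb₂.plus i)
      (fun t ht => by rw [← P_succ h i]; exact hb₂.minus i t ht)

lemma fam_ev {B : Set (ℝ × ℝ)} (hB : IsCompact B)
    (hP : ∀ i < r, P i ∉ B) : ∀ i ∈ fidx r, ∀ᶠ n in atTop, ∀ z ∈ B, fam P ν n i z = 0
  | Sum.inl i => fun hi => by
    have hi : i < r := by simpa [fidx] using hi
    rcases B.eq_empty_or_nonempty with rfl | hne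
    · exact Eventually.of_forall fun n z hz => absurd hz (notMem_empty z)
    obtain ⟨w, hw, hmin⟩ := hB.exists_isMinOn hne (sqd_cd (P i)).continuous.continuousOn
    have hpos : 0 < sqd (P i) w := by
      have hne : w ≠ P i := fun e => hP i hi (e ▸ hw)
      refine (sqd_nonneg _ _).lt_of_ne fun e => hne ?_
      unfold sqd at e
      have e1 : (w.1 - (P i).1) ^ 2 = 0 := by nlinarith [sq_nonneg (w.1 - (P i).1), sq_nonneg (w.2 - (P i).2)]
      have e2 : (w.2 - (P i).2) ^ 2 = 0 := by nlinarith [sq_nonneg (w.1 - (P i).1), sq_nonneg (w.2 - (P i).2)]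
      exact Prod.ext (sub_eq_zero.1 (pow_eq_zero_iff two_ne_zero |>.1 e1))
        (sub_eq_zero.1 (pow_eq_zero_iff two_ne_zero |>.1 e2))
    have l : Tendsto (fun n : ℕ => 2 * (1 / ((n:ℝ) + 1)) ^ 2) atTop (𝓝 0) := by
      simpa using (tendsto_one_div_add_atTop_nhds_zero_nat (𝕜 := ℝ)).pow 2 |>.const_mul 2
    filter_upwards [l.eventually (gt_mem_nhds hpos)] with n hn z hz
    exact vc_far (by positivity) (hn.le.trans (hmin hz))
  | Sum.inr i => fun _ => by
    obtain ⟨M, hM⟩ := hB.bddAbove_image (dotp_cont (ν i) (P i)).continuousOn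
    filter_upwards [tendsto_natCast_atTop_atTop.eventually_ge_atTop M] with n hn z hz
    change sig (P i) (tau P i) (ν i) (ell P i) n z = 0
    have hz' := hM (mem_image_of_mem _ hz)
    unfold sig sfun
    by_cases hU : z ∈ strU (P i) (tau P i) (ν i) (ell P i)
    · simp only [indicator_of_mem hU]
      exact stp_left (by linarith)
    · rw [indicator_of_notMem hU]

lemma fd_eq_off (h : IsConvexPolygonData r P ν) (hb₁ : Blow P ν u₁ (interior (OmegaV r P ν)))
    (hb₂ : Blow P ν u₂ (interior (OmegaV r P ν)))
    (h₁ : Fld u₁ X₁ (interior (OmegaV r P ν))) (h₂ : Fld u₂ X₂ (interior (OmegaV r P ν)))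
    {z : ℝ × ℝ} (hz : z ∈ interior (OmegaV r P ν)) (hzP : z ∉ P '' Iio r) :
    fderiv ℝ u₁ z = fderiv ℝ u₂ z := by
  have ho : IsOpen (interior (OmegaV r P ν)) := isOpen_interior
  have hfin : (P '' Iio r).Finite := (finite_Iio r).image P
  have hop : IsOpen (interior (OmegaV r P ν) ∩ (P '' Iio r)ᶜ) := ho.inter hfin.isClosed.isOpen_compl
  obtain ⟨R, hR, hsub⟩ := Metric.nhds_basis_closedBall.mem_iff.1 (hop.mem_nhds ⟨hz, hzP⟩)
  set B := Metric.closedBall z R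
  have hB : IsCompact B := isCompact_closedBall _ _
  have hBΩ : B ⊆ interior (OmegaV r P ν) := hsub.trans inter_subset_left
  have hPB : ∀ i < r, P i ∉ B := fun i hi hm => (hsub hm).2 (mem_image_of_mem P hi)
  have hev : ∀ᶠ n in atTop, ∀ i ∈ fidx r, ∀ w ∈ B, fam P ν n i w = 0 :=
    (Finset.eventually_all (fidx r)).2 (fam_ev hB hPB)
  have hle : ∀ᶠ n in atTop, ∫ w in B, enr u₁ u₂ X₁ X₂ w ≤ (π / 2) * (stpC * ∑ i ∈ fidx r,
      ∫ z in interior (OmegaV r P ν), |fderiv ℝ (fam P ν n i) z (X₁ z - X₂ z)|) := by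
    filter_upwards [hev] with n hn
    have ha : Adm (fun z => 1 - stp (∑ i ∈ fidx r, fam P ν n i z)) (interior (OmegaV r P ν))
        (bigK r P ν n) :=
      rho_adm ho (fun i _ => fam_cd h hb₁ n i) (fam_bdd h hb₁ n) (bigK_compact h hb₁ n)
        (fun i _ => fam_nonneg n i) (fun w hw hwK => fam_out h hb₁ n hw hwK)
    refine (energy_le ho ha h₁ h₂ (bigK_blow h hb₁ hb₂ n) hB hBΩ (fun w hw => ?_)).trans ?_
    · rw [Finset.sum_eq_zero (fun i hi => hn i hi w hw), stp_left le_rfl, sub_zero]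
    · apply mul_le_mul_of_nonneg_left _ (by positivity)
      exact rho_int ho (fun i _ => fam_cd h hb₁ n i) (fun i _ => fam_int h hb₁ n
        (h₁.df.sub ho h₂.df).cd.continuousOn
        (norm_sub_le_two (fun z hz => h₁.sq_le hz) (fun z hz => h₂.sq_le hz)) i)
  have hlim := ((tendsto_finsetSum (fidx r) (fun i _ => fam_tail h hb₁ hb₂ h₁ h₂ i)).const_mul
    stpC).const_mul (π / 2)
  simp only [Finset.sum_const_zero, mul_zero] at hlim
  have h0 : ∫ w in B, enr u₁ u₂ X₁ X₂ w ≤ 0 := ge_of_tendsto hlim hle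
  have hc : ContinuousOn (enr u₁ u₂ X₁ X₂) B := (enr_cont ho h₁ h₂).mono hBΩ
  have hnn : ∀ w ∈ B, 0 ≤ enr u₁ u₂ X₁ X₂ w := fun w hw => enr_nonneg h₁ h₂ (hBΩ hw)
  have h0' : ∫ w in B, enr u₁ u₂ X₁ X₂ w = 0 :=
    le_antisymm h0 (setIntegral_nonneg hB.measurableSet hnn)
  have hae := (setIntegral_eq_zero_iff_of_nonneg_ae
    ((ae_restrict_iff' hB.measurableSet).2 (Eventually.of_forall hnn))
    (hc.integrableOn_compact hB)).1 h0'
  have hae2 : enr u₁ u₂ X₁ X₂ =ᵐ[volume.restrict (Metric.ball z R)] 0 :=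
    ae_restrict_of_ae_restrict_of_subset Metric.ball_subset_closedBall hae
  have heq := Measure.eqOn_open_of_ae_eq hae2 Metric.isOpen_ball
    (hc.mono Metric.ball_subset_closedBall) continuousOn_const (Metric.mem_ball_self hR)
  apply (h₁.mono h₂ hz).2
  unfold enr at heq
  rcases mul_eq_zero.1 heq with e | e
  · exact absurd e (by positivity)
  · exact e

lemma fd_eq (h : IsConvexPolygonData r P ν) (hb₁ : Blow P ν u₁ (interior (OmegaV r P ν)))
    (hb₂ : Blow P ν u₂ (interior (OmegaV r P ν)))
    (h₁ : Fld u₁ X₁ (interior (OmegaV r P ν))) (h₂ : Fld u₂ X₂ (interior (OmegaV r P ν))) :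
    EqOn (fderiv ℝ u₁) (fderiv ℝ u₂) (interior (OmegaV r P ν)) := by
  have ho : IsOpen (interior (OmegaV r P ν)) := isOpen_interior
  have hfin : (P '' Iio r).Finite := (finite_Iio r).image P
  exact EqOn.of_subset_closure (s := interior (OmegaV r P ν) ∩ (P '' Iio r)ᶜ)
    (fun z hz => fd_eq_off h hb₁ hb₂ h₁ h₂ hz.1 hz.2)
    (h₁.cd.continuousOn_fderiv_of_isOpen ho le_rfl) (h₂.cd.continuousOn_fderiv_of_isOpen ho le_rfl)
    inter_subset_left ((hfin.countable.dense_compl ℝ).open_subset_closure_inter ho)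

lemma main_aux (hpoly : IsConvexPolygonData r P ν) 
    (hu₁ : IsMSE u₁ (interior (OmegaV r P ν)))
    (hu₂ : IsMSE u₂ (interior (OmegaV r P ν)))
    (hb₁ : Blow P ν u₁ (interior (OmegaV r P ν)))
    (hb₂ : Blow P ν u₂ (interior (OmegaV r P ν))) :
    ∃ c : ℝ, ∀ z ∈ interior (OmegaV r P ν), u₁ z = u₂ z + c := by
  have ho : IsOpen (interior (OmegaV r P ν)) := isOpen_interior
  have h₁ := fld_of_mse ho hu₁
  have h₂ := fld_of_mse ho hu₂
  have hfd := fd_eq hpoly hb₁ hb₂ h₁ h₂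
  obtain ⟨c, hc⟩ := ho.exists_is_const_of_fderiv_eq_zero (𝕜 := ℝ) (f := fun z => u₁ z - u₂ z)
    (omega_preconn hpoly hb₁)
    (fun z hz => ((diffAt ho h₁.cd hz).sub (diffAt ho h₂.cd hz)).differentiableWithinAt)
    (fun z hz => by
      rw [fderiv_fun_sub (diffAt ho h₁.cd hz) (diffAt ho h₂.cd hz), hfd hz, sub_self]; rfl)
  exact ⟨c, fun z hz => by linarith [hc z hz]⟩
end

/-- Uniqueness up to an additive constant for the Dirichlet problem on the unbounded
multi-domain `Ω(V)` over a convex polygon `V`: two solutions of the minimal surfaces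
equation on the interior of `Ω(V)` taking the boundary value `+∞` on each half-line
`L_i⁺ ∖ {P i} = {P i + tν_i : t > 0}` and `−∞` on each `L_i⁻ ∖ {P i}` differ by a
constant. -/
theorem omegaV_uniqueness
    (r : ℕ) (P ν : ℕ → ℝ × ℝ) (hpoly : IsConvexPolygonData r P ν)
    (u₁ u₂ : ℝ × ℝ → ℝ)
    (hu₁ : IsMSE u₁ (interior (OmegaV r P ν)))
    (hu₂ : IsMSE u₂ (interior (OmegaV r P ν)))
    (hplus₁ : ∀ i < r, ∀ t > (0:ℝ),
      Tendsto u₁ (𝓝[interior (OmegaV r P ν)] (P i + t • ν i)) atTop)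
    (hplus₂ : ∀ i < r, ∀ t > (0:ℝ),
      Tendsto u₂ (𝓝[interior (OmegaV r P ν)] (P i + t • ν i)) atTop)
    (hminus₁ : ∀ i < r, ∀ t > (0:ℝ),
      Tendsto u₁ (𝓝[interior (OmegaV r P ν)] (P i + t • ν (i + r - 1))) atBot)
    (hminus₂ : ∀ i < r, ∀ t > (0:ℝ),
      Tendsto u₂ (𝓝[interior (OmegaV r P ν)] (P i + t • ν (i + r - 1))) atBot) :
    ∃ c : ℝ, ∀ z ∈ interior (OmegaV r P ν), u₁ z = u₂ z + c := by
  exact main_aux hpoly hu₁ hu₂ (blow_of hpoly hu₁.1.continuousOn hplus₁ hminus₁)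
    (blow_of hpoly hu₂.1.continuousOn hplus₂ hminus₂)
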